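/- arXiv:1503.03091 — 4 statements merged into one kernel-verified Lean document; each statement's English description precedes it below -/
import Mathlib

section
/- Let n = 2 or n = 3. For α ∈ 𝔻ⁿ and ω ∈ 𝕋^{n−1} let ψ_{ω,α}(λ) = (λ·m_{α_1}(λ), ω_1·λ·m_{α_2}(λ), …, ω_{n−1}·λ·m_{α_n}(λ)), and for t ∈ ℝⁿ let t·α = Σ_j t_j·α_j. Suppose x, y, x', y' ∈ 𝔻∖{0} with x ≠ y and x' ≠ y'; t, t' ∈ ℝⁿ with all entries positive and summing to 1; ω, ω' ∈ 𝕋^{n−1}; and α, α' ∈ 𝔻ⁿ, where for n = 2 one assumes α_1 ≠ α_2 and α'_1 ≠ α'_2, and for n = 3 one assumes that α_1, α_2, α_3 are not co-linear and α'_1, α'_2, α'_3 are not co-linear. If ψ_{ω,α}(x) = ψ_{ω',α'}(x'), ψ_{ω,α}(y) = ψ_{ω',α'}(y'), and x·m_{t·α}(x) · y'·m_{t'·α'}(y') = y·m_{t·α}(y) · x'·m_{t'·α'}(x') (equality of the projective points [x·m_{t·α}(x) : y·m_{t·α}(y)] and [x'·m_{t'·α'}(x') : y'·m_{t'·α'}(y')]),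 then ω = ω', t = t', and either (x, y, α) = (x', y', α') or (x, y, α) = (−x', −y', −α'). Conversely, ψ_{ω,α}(x) = ψ_{ω,−α}(−x) always holds, so the map Φ(x, y, α, t, ω) = (ψ_{ω,α}(x), ψ_{ω,α}(y), [x·m_{t·α}(x) : y·m_{t·α}(y)]) is exactly 2-to-1 on this set. -/
open Complex Set ComplexConjugate

noncomputable section

/-- The Möbius factor `m_a(l) = (a - l)/(1 - conj a · l)`. -/
def mob (a l : ℂ) : ℂ := (a - l) / (1 - conj a * l)

/-- The open unit disc in `ℂ`. -/
def uDisc : Set ℂ := {z : ℂ | ‖z‖ < 1}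

/-- The open unit polydisc in `ℂⁿ`. -/
def uPolydisc (n : ℕ) : Set (Fin n → ℂ) := {z | ∀ i, ‖z i‖ < 1}

/-- `B` is (on the unit disc) a Blaschke product of degree exactly `d`. -/
def IsBlaschkeDeg (d : ℕ) (B : ℂ → ℂ) : Prop :=
  ∃ c : ℂ, ‖c‖ = 1 ∧ ∃ a : Fin d → ℂ, (∀ j, ‖a j‖ < 1) ∧
    ∀ l ∈ uDisc, B l = c * ∏ j, mob (a j) l

/-- `B` is a Blaschke product of degree at most `k`. -/
def IsBlaschkeLe (k : ℕ) (B : ℂ → ℂ) : Prop := ∃ d ≤ k, IsBlaschkeDeg d B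

/-- `F` is an interpolating function of the `N`-point Pick problem on `𝔻ⁿ` with
nodes `z j` and targets `lam j`. -/
def Interpolates (n N : ℕ) (z : Fin N → Fin n → ℂ) (lam : Fin N → ℂ)
    (F : (Fin n → ℂ) → ℂ) : Prop :=
  DifferentiableOn ℂ F (uPolydisc n) ∧ (∀ x ∈ uPolydisc n, ‖F x‖ ≤ 1) ∧
    ∀ j, F (z j) = lam j

/-- The `N`-point Pick problem on `𝔻ⁿ` is extremal: it is solvable, but not solvable
with supremum norm less than `1`. -/
def ExtremalPick (n N : ℕ) (z : Fin N → Fin n → ℂ) (lam : Fin N → ℂ) : Prop :=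
  (∃ F, Interpolates n N z lam F) ∧
    ¬ ∃ F : (Fin n → ℂ) → ℂ, DifferentiableOn ℂ F (uPolydisc n) ∧
      (∃ r : ℝ, r < 1 ∧ ∀ x ∈ uPolydisc n, ‖F x‖ ≤ r) ∧ ∀ j, F (z j) = lam j

/-- A three-point Pick problem is degenerate if one of its two-point subproblems
is extremal. -/
def DegeneratePick (n : ℕ) (z : Fin 3 → Fin n → ℂ) (lam : Fin 3 → ℂ) : Prop :=
  ∃ i j : Fin 3, i ≠ j ∧ ExtremalPick n 2 ![z i, z j] ![lam i, lam j]

/-- `F` depends only on the coordinates in `S`. -/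
def DependsOnlyOn (n : ℕ) (S : Finset (Fin n)) (F : (Fin n → ℂ) → ℂ) : Prop :=
  ∀ x ∈ uPolydisc n, ∀ y ∈ uPolydisc n, (∀ i ∈ S, x i = y i) → F x = F y

/-- The Pick problem is `k`-dimensional: some interpolating function depends only on
`k` of the coordinates. -/
def KDim (n N k : ℕ) (z : Fin N → Fin n → ℂ) (lam : Fin N → ℂ) : Prop :=
  ∃ S : Finset (Fin n), S.card ≤ k ∧ ∃ F, Interpolates n N z lam F ∧ DependsOnlyOn n S F

/-- The Poincaré (hyperbolic) distance on the unit disc. -/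
def hypDist (a b : ℂ) : ℝ :=
  Real.log ((1 + ‖(a - b) / (1 - conj b * a)‖) / (1 - ‖(a - b) / (1 - conj b * a)‖))

/-- `φ` is a unimodular constant on the disc. -/
def IsUnimodConst (φ : ℂ → ℂ) : Prop := ∃ c : ℂ, ‖c‖ = 1 ∧ ∀ l ∈ uDisc, φ l = c

/-- `φ` coincides on the disc with a holomorphic automorphism of the disc (a Möbius map). -/
def IsDiscAut (φ : ℂ → ℂ) : Prop :=
  ∃ c a : ℂ, ‖c‖ = 1 ∧ ‖a‖ < 1 ∧ ∀ l ∈ uDisc, φ l = c * mob a l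

/-- The magic function `Φ_{s,η}`. -/
def PhiMagic (s : ℝ) (η z1 z2 : ℂ) : ℂ :=
  ((s:ℂ) * z1 + (1 - (s:ℂ)) * z2 - η * z1 * z2) /
    (1 - ((1 - (s:ℂ)) * z1 + (s:ℂ) * z2) * η)

/-- The rational function of formula (F), with `ω = (conj α1 − conj α2)/(α1 − α2)`. -/
def magicF (t : ℝ) (η α1 α2 z1 z2 : ℂ) : ℂ :=
  ((t:ℂ) * z1 + conj η * (1 - (t:ℂ)) * z2 +
      ((conj α1 - conj α2) / (α1 - α2)) * conj η * z1 * z2) /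
    (1 + (((1 - (t:ℂ)) * z1 + (t:ℂ) * conj η * z2) *
      ((conj α1 - conj α2) / (α1 - α2))))

/-- A function of two variables of the form (F). -/
def IsMagicForm (F : ℂ → ℂ → ℂ) : Prop :=
  ∃ t ∈ Ioo (0:ℝ) 1, ∃ η α1 α2 : ℂ, ‖η‖ = 1 ∧ ‖α1‖ < 1 ∧ ‖α2‖ < 1 ∧ α1 ≠ α2 ∧
    ∀ z1 z2 : ℂ, ‖z1‖ < 1 → ‖z2‖ < 1 → F z1 z2 = magicF t η α1 α2 z1 z2

/-- The disc `ψ_{ω,α}(λ) = (ω i · λ m_{α i}(λ))_i` (normalized so that `ω 0 = 1`). -/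
def psiDisc (n : ℕ) (om a : Fin n → ℂ) (l : ℂ) : Fin n → ℂ :=
  fun i => om i * (l * mob (a i) l)

/-- `t·α = Σ_j t_j α_j`. -/
def tDot (n : ℕ) (t : Fin n → ℝ) (a : Fin n → ℂ) : ℂ := ∑ i, (t i : ℂ) * a i

lemma nz_of_disc {a l : ℂ} (ha : ‖a‖ < 1) (hl : ‖l‖ < 1) : 1 - conj a * l ≠ 0 := by
  intro h
  have h1 : conj a * l = 1 := by linear_combination -h
  have h2 : ‖a‖ * ‖l‖ = 1 := by
    have := congrArg norm h1
    simpa using this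
  nlinarith [norm_nonneg a, norm_nonneg l]

lemma mob_pick {a l m : ℂ} (ha : ‖a‖ < 1) (hl : ‖l‖ < 1) (hm : ‖m‖ < 1) :
    (1 - conj a * l) * conj (1 - conj a * m) * (1 - (l * mob a l) * conj (m * mob a m))
      = (1 - l * conj m) * (1 + l * conj m - conj a * l - a * conj m) := by
  have h1 := nz_of_disc ha hl
  have h2 := nz_of_disc ha hm
  have h3 : conj (1 - conj a * m) ≠ 0 := (map_ne_zero _).2 h2
  unfold mob
  simp only [map_mul, map_div₀, map_sub, map_one, Complex.conj_conj] at h3 ⊢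
  field_simp
  ring

lemma szego_nonneg (L a : Fin 3 → ℂ) (hL : ∀ j, ‖L j‖ < 1) :
    ∃ S : ℝ, 0 ≤ S ∧ ∑ j, ∑ k, a j * conj (a k) / (1 - L j * conj (L k)) = (S : ℂ) := by
  have h1 : ∀ j k, HasSum (fun n : ℕ => a j * conj (a k) * (L j * conj (L k)) ^ n)
      (a j * conj (a k) / (1 - L j * conj (L k))) := by
    intro j k
    rw [div_eq_mul_inv]
    apply HasSum.mul_left
    apply hasSum_geometric_of_norm_lt_one
    rw [norm_mul, RCLike.norm_conj]
    nlinarith [norm_nonneg (L j), norm_nonneg (L k), hL j, hL k]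
  have h2 : HasSum (fun n : ℕ => ∑ j, ∑ k, a j * conj (a k) * (L j * conj (L k)) ^ n)
      (∑ j, ∑ k, a j * conj (a k) / (1 - L j * conj (L k))) :=
    hasSum_sum fun j _ => hasSum_sum fun k _ => h1 j k
  have h3 : ∀ n : ℕ, ∑ j, ∑ k, a j * conj (a k) * (L j * conj (L k)) ^ n
      = ((Complex.normSq (∑ j, a j * L j ^ n) : ℝ) : ℂ) := by
    intro n
    rw [Complex.normSq_eq_conj_mul_self]
    simp only [Fin.sum_univ_three, map_add, map_mul, map_pow, mul_pow]
    ring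
  simp only [h3] at h2
  have h4 : Summable (fun n : ℕ => Complex.normSq (∑ j, a j * L j ^ n)) :=
    Complex.summable_ofReal.1 h2.summable
  refine ⟨∑' n : ℕ, Complex.normSq (∑ j, a j * L j ^ n),
    tsum_nonneg fun n => Complex.normSq_nonneg _, ?_⟩
  rw [Complex.ofReal_tsum]
  exact h2.tsum_eq.symm

lemma tDot_norm_lt {n : ℕ} (t : Fin n → ℝ) (ht : ∀ i, 0 < t i) (hts : (∑ i, t i) = 1)
    (α : Fin n → ℂ) (hα : ∀ i, ‖α i‖ < 1) : ‖tDot n t α‖ < 1 := by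
  have hne : (Finset.univ : Finset (Fin n)).Nonempty := by
    by_contra h
    rw [Finset.not_nonempty_iff_eq_empty] at h
    rw [h] at hts
    simp at hts
  unfold tDot
  calc ‖∑ i, (t i : ℂ) * α i‖ ≤ ∑ i, ‖(t i : ℂ) * α i‖ := norm_sum_le _ _
    _ < ∑ i, t i := by
        apply Finset.sum_lt_sum_of_nonempty hne
        intro i _
        rw [norm_mul, Complex.norm_real, Real.norm_of_nonneg (ht i).le]
        nlinarith [ht i, hα i]
    _ = 1 := hts

/-- The key step: equality in the duality pairing forces the Agler vectors to coincide. -/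
lemma agler_key {n : ℕ} (x y x' y' : ℂ)
    (hx : ‖x‖ < 1) (hy : ‖y‖ < 1) (hx' : ‖x'‖ < 1) (hy' : ‖y'‖ < 1)
    (hx'0 : x' ≠ 0) (hy'0 : y' ≠ 0) (hxy' : x' ≠ y')
    (t : Fin n → ℝ) (ht : ∀ i, 0 < t i) (hts : (∑ i, t i) = 1)
    (om om' : Fin n → ℂ) (hom : ∀ i, ‖om i‖ = 1) (hom' : ∀ i, ‖om' i‖ = 1)
    (α α' : Fin n → ℂ) (hα : ∀ i, ‖α i‖ < 1) (hα' : ∀ i, ‖α' i‖ < 1)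
    (a' : ℂ) (ha' : ‖a'‖ < 1)
    (h1 : ∀ i, om i * (x * mob (α i) x) = om' i * (x' * mob (α' i) x'))
    (h2 : ∀ i, om i * (y * mob (α i) y) = om' i * (y' * mob (α' i) y'))
    (d : ℂ) (hd : 1 ≤ ‖d‖)
    (h3 : x * mob (tDot n t α) x = d * (x' * mob a' x'))
    (h4 : y * mob (tDot n t α) y = d * (y' * mob a' y')) (i : Fin n) :
    (1 - conj (α i) * x) * (1 - conj a' * x')
      = (1 - conj (α' i) * x') * (1 - conj (tDot n t α) * x) ∧
    (1 - conj (α i) * y) * (1 - conj a' * y')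
      = (1 - conj (α' i) * y') * (1 - conj (tDot n t α) * y) := by
  have ha := tDot_norm_lt t ht hts α hα
  set a := tDot n t α with hadef
  obtain ⟨L, hLd⟩ : ∃ L : Fin 3 → ℂ, L = ![0, x, y] := ⟨_, rfl⟩
  obtain ⟨M, hMd⟩ : ∃ L : Fin 3 → ℂ, L = ![0, x', y'] := ⟨_, rfl⟩
  obtain ⟨w, hwd⟩ : ∃ w : Fin 3 → ℂ, w = ![x' - y', y', -x'] := ⟨_, rfl⟩
  have hL : ∀ j, ‖L j‖ < 1 := by
    intro j; subst hLd; fin_cases j <;> simp [hx, hy]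
  have hM : ∀ j, ‖M j‖ < 1 := by
    intro j; subst hMd; fin_cases j <;> simp [hx', hy']
  have hz : ∀ i j, om i * (L j * mob (α i) (L j)) = om' i * (M j * mob (α' i) (M j)) := by
    intro i j; subst hLd; subst hMd; fin_cases j
    · simp
    · exact h1 i
    · exact h2 i
  have hp : ∀ j, L j * mob a (L j) = d * (M j * mob a' (M j)) := by
    intro j; subst hLd; subst hMd; fin_cases j
    · simp
    · exact h3
    · exact h4
  have hw0 : ∑ j, w j = 0 := by subst hwd; simp [Fin.sum_univ_three]
  have hw1 : ∑ j, w j * M j = 0 := by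
    subst hwd; subst hMd; simp [Fin.sum_univ_three]; ring
  -- nonvanishing
  have gα := fun i j => nz_of_disc (hα i) (hL j)
  have gα' := fun i j => nz_of_disc (hα' i) (hM j)
  have ga := fun j => nz_of_disc ha (hL j)
  have ga' := fun j => nz_of_disc ha' (hM j)
  have hs : ∀ j k, 1 - M j * conj (M k) ≠ 0 := by
    intro j k
    have := nz_of_disc (hM k) (hM j)
    rwa [mul_comm] at this
  have cnz : ∀ {z : ℂ}, z ≠ 0 → conj z ≠ 0 := fun h => (map_ne_zero _).2 h
  set u : Fin n → Fin 3 → ℂ := fun i j =>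
    w j * ((1 - conj a' * M j) / (1 - conj a * L j)) *
      ((1 - conj (α i) * L j) / (1 - conj (α' i) * M j)) with hu
  have unit : ∀ {z : ℂ}, ‖z‖ = 1 → z * conj z = 1 := by
    intro z hz
    rw [Complex.mul_conj, Complex.normSq_eq_norm_sq, hz]; simp
  have hzz : ∀ i j k, (L j * mob (α i) (L j)) * conj (L k * mob (α i) (L k))
      = (M j * mob (α' i) (M j)) * conj (M k * mob (α' i) (M k)) := by
    intro i j k
    have e1 := hz i j
    have e2 := congrArg conj (hz i k)
    rw [map_mul, map_mul conj (om' i)] at e2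
    have o1 := unit (hom i)
    have o2 := unit (hom' i)
    calc _ = (om i * conj (om i)) * ((L j * mob (α i) (L j)) * conj (L k * mob (α i) (L k))) := by
          rw [o1, one_mul]
      _ = (om i * (L j * mob (α i) (L j))) *
            (conj (om i) * conj (L k * mob (α i) (L k))) := by ring
      _ = (om' i * conj (om' i)) *
            ((M j * mob (α' i) (M j)) * conj (M k * mob (α' i) (M k))) := by
          rw [e1, e2]; ring
      _ = _ := by rw [o2, one_mul]
  -- the polarized identity
  have hN : ∀ j k, ∑ i, (t i : ℂ) *
      (1 + L j * conj (L k) - conj (α i) * L j - α i * conj (L k))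
      = 1 + L j * conj (L k) - conj a * L j - a * conj (L k) := by
    intro j k
    have hts' : ∑ i, (t i : ℂ) = 1 := by exact_mod_cast hts
    have e1 : a = ∑ i, (t i : ℂ) * α i := rfl
    have e2 : conj a = ∑ i, (t i : ℂ) * conj (α i) := by rw [e1]; simp [map_sum]
    rw [e2, e1]
    calc _ = ∑ i, ((t i : ℂ) * (1 + L j * conj (L k)) - ((t i : ℂ) * conj (α i)) * L j
              - ((t i : ℂ) * α i) * conj (L k)) := by
            apply Finset.sum_congr rfl; intros; ring
      _ = _ := by
            rw [Finset.sum_sub_distrib, Finset.sum_sub_distrib, ← Finset.sum_mul,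
              ← Finset.sum_mul, ← Finset.sum_mul, hts', one_mul]
  have hterm : ∀ i j k, u i j * conj (u i k) *
        (1 + M j * conj (M k) - conj (α' i) * M j - α' i * conj (M k))
      = w j * conj (w k) * ((1 - conj a' * M j) / (1 - conj a * L j)) *
          conj ((1 - conj a' * M k) / (1 - conj a * L k)) *
          (1 - L j * conj (L k)) / (1 - M j * conj (M k)) *
          (1 + L j * conj (L k) - conj (α i) * L j - α i * conj (L k)) := by
    intro i j k
    have e1 := mob_pick (hα i) (hL j) (hL k)
    have e2 := mob_pick (hα' i) (hM j) (hM k)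
    rw [hzz] at e1
    have n1 := gα' i j
    have n2 := cnz (gα' i k)
    have n3 := hs j k
    have e3 : (1 - conj (α i) * L j) / (1 - conj (α' i) * M j) *
        conj ((1 - conj (α i) * L k) / (1 - conj (α' i) * M k)) *
        (1 + M j * conj (M k) - conj (α' i) * M j - α' i * conj (M k))
        = (1 - L j * conj (L k)) / (1 - M j * conj (M k)) *
          (1 + L j * conj (L k) - conj (α i) * L j - α i * conj (L k)) := by
      rw [map_div₀]
      generalize (1 - M j * conj (M k)) = s at *
      generalize (1 - L j * conj (L k)) = s' at *
      generalize (1 - conj (α' i) * M j) = g1 at *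
      generalize conj (1 - conj (α' i) * M k) = g2 at *
      generalize conj (1 - conj (α i) * L k) = g3 at *
      generalize (1 - conj (α i) * L j) = g4 at *
      generalize (1 + M j * conj (M k) - conj (α' i) * M j - α' i * conj (M k)) = X at *
      generalize (1 + L j * conj (L k) - conj (α i) * L j - α i * conj (L k)) = Y at *
      generalize (1 - M j * mob (α' i) (M j) * conj (M k * mob (α' i) (M k))) = Z at *
      field_simp
      linear_combination g1 * g2 * e1 - g4 * g3 * e2
    simp only [hu, map_mul]
    linear_combination (w j * conj (w k) * ((1 - conj a' * M j) / (1 - conj a * L j)) *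
          conj ((1 - conj a' * M k) / (1 - conj a * L k))) * e3
  have hright : ∀ j k, w j * conj (w k) * ((1 - conj a' * M j) / (1 - conj a * L j)) *
          conj ((1 - conj a' * M k) / (1 - conj a * L k)) *
          (1 - L j * conj (L k)) / (1 - M j * conj (M k)) *
          (1 + L j * conj (L k) - conj a * L j - a * conj (L k))
      = (1 - d * conj d) * ((w j * (1 - conj a' * M j)) * conj (w k * (1 - conj a' * M k))
            / (1 - M j * conj (M k)))
        + d * conj d * (w j * conj (w k) *
          (1 + M j * conj (M k) - conj a' * M j - a' * conj (M k))) := by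
    intro j k
    have e1 := mob_pick ha (hL j) (hL k)
    have e2 := mob_pick ha' (hM j) (hM k)
    rw [hp, hp, map_mul conj d] at e1
    have n1 := ga j
    have n2 := cnz (ga k)
    have n3 := hs j k
    rw [map_div₀, map_mul conj (w k)]
    generalize (1 - M j * conj (M k)) = s at *
    generalize (1 - L j * conj (L k)) = s' at *
    generalize (1 - conj a' * M j) = g1 at *
    generalize conj (1 - conj a' * M k) = g2 at *
    generalize conj (1 - conj a * L k) = g3 at *
    generalize (1 - conj a * L j) = g4 at *
    generalize (1 + M j * conj (M k) - conj a' * M j - a' * conj (M k)) = X at *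
    generalize (1 + L j * conj (L k) - conj a * L j - a * conj (L k)) = Y at *
    generalize M j * mob a' (M j) = Z at *
    generalize conj (M k * mob a' (M k)) = Z' at *
    generalize conj (w k) = wk at *
    generalize conj d = d' at *
    field_simp
    linear_combination (-w j * wk * g1 * g2) * e1 + w j * wk * g4 * g3 * d * d' * e2
  have hjk : ∀ j k, ∑ i, (t i : ℂ) * (u i j * conj (u i k) *
        (1 + M j * conj (M k) - conj (α' i) * M j - α' i * conj (M k)))
      = (1 - d * conj d) * ((w j * (1 - conj a' * M j)) * conj (w k * (1 - conj a' * M k))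
            / (1 - M j * conj (M k)))
        + d * conj d * (w j * conj (w k) *
          (1 + M j * conj (M k) - conj a' * M j - a' * conj (M k))) := by
    intro j k
    rw [← hright, ← hN, Finset.mul_sum]
    apply Finset.sum_congr rfl
    intro i _
    rw [hterm]; ring
  obtain ⟨S, hS0, hS⟩ := szego_nonneg M (fun j => w j * (1 - conj a' * M j)) hM
  -- sums of squares
  have gram : ∀ (b : ℂ) (v : Fin 3 → ℂ), ∑ j, ∑ k, v j * conj (v k) *
        (1 + M j * conj (M k) - conj b * M j - b * conj (M k))
      = ((Complex.normSq (∑ j, v j * (1 - conj b * M j))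
          + (1 - Complex.normSq b) * Complex.normSq (∑ j, v j * M j) : ℝ) : ℂ) := by
    intro b v
    push_cast
    simp only [Complex.normSq_eq_conj_mul_self]
    simp only [Fin.sum_univ_three, map_add, map_mul, map_sub, map_one, Complex.conj_conj]
    ring
  have hwz : ∑ j, ∑ k, w j * conj (w k) *
        (1 + M j * conj (M k) - conj a' * M j - a' * conj (M k)) = 0 := by
    rw [gram]
    have : ∑ j, w j * (1 - conj a' * M j) = 0 := by
      have : ∑ j, w j * (1 - conj a' * M j) = ∑ j, w j - conj a' * ∑ j, w j * M j := by
        rw [Finset.mul_sum, ← Finset.sum_sub_distrib]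
        apply Finset.sum_congr rfl; intros; ring
      rw [this, hw0, hw1]; simp
    rw [this, hw1]; simp
  have hfin : ∑ i, t i * (Complex.normSq (∑ j, u i j * (1 - conj (α' i) * M j))
          + (1 - Complex.normSq (α' i)) * Complex.normSq (∑ j, u i j * M j))
      = (1 - Complex.normSq d) * S := by
    have e : ∑ j, ∑ k, ∑ i, (t i : ℂ) * (u i j * conj (u i k) *
        (1 + M j * conj (M k) - conj (α' i) * M j - α' i * conj (M k)))
        = (1 - d * conj d) * S := by
      simp only [hjk, Finset.sum_add_distrib, ← Finset.mul_sum]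
      rw [hwz, hS]; ring
    have e' : ∑ j, ∑ k, ∑ i, (t i : ℂ) * (u i j * conj (u i k) *
        (1 + M j * conj (M k) - conj (α' i) * M j - α' i * conj (M k)))
        = ∑ i, (t i : ℂ) * ∑ j, ∑ k, (u i j * conj (u i k) *
        (1 + M j * conj (M k) - conj (α' i) * M j - α' i * conj (M k))) := by
      simp only [Finset.mul_sum]
      calc _ = ∑ j, ∑ i, ∑ k, (t i : ℂ) * (u i j * conj (u i k) *
        (1 + M j * conj (M k) - conj (α' i) * M j - α' i * conj (M k))) :=
            Finset.sum_congr rfl fun j _ => Finset.sum_comm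
        _ = _ := Finset.sum_comm
    rw [e'] at e
    simp only [gram] at e
    rw [Complex.mul_conj] at e
    exact_mod_cast e
  have hsq : ∀ i, Complex.normSq (α' i) < 1 := by
    intro i
    rw [Complex.normSq_eq_norm_sq]
    nlinarith [norm_nonneg (α' i), hα' i]
  have hnn : ∀ i ∈ Finset.univ, 0 ≤ t i * (Complex.normSq (∑ j, u i j * (1 - conj (α' i) * M j))
          + (1 - Complex.normSq (α' i)) * Complex.normSq (∑ j, u i j * M j)) := by
    intro i _
    have := hsq i
    have := ht i
    have h5 := Complex.normSq_nonneg (∑ j, u i j * (1 - conj (α' i) * M j))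
    have h6 := Complex.normSq_nonneg (∑ j, u i j * M j)
    have : 0 ≤ 1 - Complex.normSq (α' i) := by linarith
    positivity
  have hD : 1 ≤ Complex.normSq d := by
    rw [Complex.normSq_eq_norm_sq]; nlinarith
  have hzero : ∑ i, t i * (Complex.normSq (∑ j, u i j * (1 - conj (α' i) * M j))
          + (1 - Complex.normSq (α' i)) * Complex.normSq (∑ j, u i j * M j)) = 0 := by
    apply le_antisymm _ (Finset.sum_nonneg hnn)
    rw [hfin]
    nlinarith
  have hi := (Finset.sum_eq_zero_iff_of_nonneg hnn).1 hzero i (Finset.mem_univ i)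
  have h5 := Complex.normSq_nonneg (∑ j, u i j * (1 - conj (α' i) * M j))
  have h6 := Complex.normSq_nonneg (∑ j, u i j * M j)
  have h7 : 0 < 1 - Complex.normSq (α' i) := by linarith [hsq i]
  have hi' := (mul_eq_zero.1 hi).resolve_left (ht i).ne'
  have h8 : 0 ≤ (1 - Complex.normSq (α' i)) * Complex.normSq (∑ j, u i j * M j) := by positivity
  have q1 : ∑ j, u i j * (1 - conj (α' i) * M j) = 0 :=
    Complex.normSq_eq_zero.1 (by linarith)
  have q2 : ∑ j, u i j * M j = 0 := by
    apply Complex.normSq_eq_zero.1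
    have : (1 - Complex.normSq (α' i)) * Complex.normSq (∑ j, u i j * M j) = 0 := by linarith
    exact (mul_eq_zero.1 this).resolve_left h7.ne'
  have n1 := gα' i 1
  have n2 := gα' i 2
  have n3 := ga 1
  have n4 := ga 2
  simp only [Fin.sum_univ_three, hu, hwd, hLd, hMd] at q1 q2 n1 n2 n3 n4
  simp at q1 q2 n1 n2 n3 n4
  have r1 : ∃ r, r = (1 - conj a' * x') / (1 - conj a * x) *
      ((1 - conj (α i) * x) / (1 - conj (α' i) * x')) := ⟨_, rfl⟩
  have r2 : ∃ r, r = (1 - conj a' * y') / (1 - conj a * y) *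
      ((1 - conj (α i) * y) / (1 - conj (α' i) * y')) := ⟨_, rfl⟩
  obtain ⟨r1, hr1⟩ := r1
  obtain ⟨r2, hr2⟩ := r2
  have q2' : x' * y' * (r1 - r2) = 0 := by rw [hr1, hr2]; linear_combination q2
  have hr : r1 - r2 = 0 := (mul_eq_zero.1 q2').resolve_left (mul_ne_zero hx'0 hy'0)
  have q1' : (x' - y') + y' * r1 - x' * r2 = 0 := by
    rw [hr1, hr2]; linear_combination q1 + conj (α' i) * q2
  have q3 : (x' - y') * (1 - r1) = 0 := by linear_combination q1' - x' * hr
  have hr1' : r1 = 1 := by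
    have := (mul_eq_zero.1 q3).resolve_left (sub_ne_zero.2 hxy')
    linear_combination -this
  have hr2' : r2 = 1 := by linear_combination hr1' - hr
  rw [hr1'] at hr1
  rw [hr2'] at hr2
  rw [div_mul_div_comm, eq_div_iff (mul_ne_zero n3 n1)] at hr1
  rw [div_mul_div_comm, eq_div_iff (mul_ne_zero n4 n2)] at hr2
  exact ⟨by linear_combination -hr1, by linear_combination -hr2⟩

/-- The endgame: the affine relation between the parameters is `±1`. -/
lemma endgame {n : ℕ} (x y x' y' : ℂ)
    (hx : ‖x‖ < 1) (hy : ‖y‖ < 1) (hx' : ‖x'‖ < 1) (hy' : ‖y'‖ < 1)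
    (hx0 : x ≠ 0) (hy0 : y ≠ 0) (hxy : x ≠ y) (hxy' : x' ≠ y')
    (om om' : Fin n → ℂ) (i0 i1 : Fin n)
    (hom0 : om i0 = 1) (hom'0 : om' i0 = 1) (hom : ∀ i, ‖om i‖ = 1)
    (α α' : Fin n → ℂ) (hα : ∀ i, ‖α i‖ < 1) (hα' : ∀ i, ‖α' i‖ < 1)
    (hne : α' i0 ≠ α' i1)
    (h1 : ∀ i, om i * (x * mob (α i) x) = om' i * (x' * mob (α' i) x'))
    (h2 : ∀ i, om i * (y * mob (α i) y) = om' i * (y' * mob (α' i) y'))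
    (a a' : ℂ) (ha : ‖a‖ < 1) (ha' : ‖a'‖ < 1)
    (g1 : ∀ i, (1 - conj (α i) * x) * (1 - conj a' * x')
      = (1 - conj (α' i) * x') * (1 - conj a * x))
    (g2 : ∀ i, (1 - conj (α i) * y) * (1 - conj a' * y')
      = (1 - conj (α' i) * y') * (1 - conj a * y)) :
    om = om' ∧ ((x = x' ∧ y = y' ∧ α = α' ∧ a = a') ∨
      (x = -x' ∧ y = -y' ∧ α = -α' ∧ a = -a')) := by
  obtain ⟨r, hr⟩ : ∃ r, r = (1 - conj a * x) / (1 - conj a' * x') := ⟨_, rfl⟩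
  obtain ⟨s, hs⟩ : ∃ s, s = (1 - conj a * y) / (1 - conj a' * y') := ⟨_, rfl⟩
  have nr := nz_of_disc ha' hx'
  have ns := nz_of_disc ha' hy'
  have hr0 : r ≠ 0 := by rw [hr]; exact div_ne_zero (nz_of_disc ha hx) nr
  have hs0 : s ≠ 0 := by rw [hs]; exact div_ne_zero (nz_of_disc ha hy) ns
  have hra : 1 - conj a * x = r * (1 - conj a' * x') := by rw [hr]; field_simp
  have hsa : 1 - conj a * y = s * (1 - conj a' * y') := by rw [hs]; field_simp
  have k1 : ∀ i, 1 - conj (α i) * x = r * (1 - conj (α' i) * x') := by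
    intro i
    apply mul_right_cancel₀ nr
    rw [g1 i, hra]; ring
  have k2 : ∀ i, 1 - conj (α i) * y = s * (1 - conj (α' i) * y') := by
    intro i
    apply mul_right_cancel₀ ns
    rw [g2 i, hsa]; ring
  have m1 : ∀ i, om i * (x * (α i - x)) = om' i * (r * x' * (α' i - x')) := by
    intro i
    have e := h1 i
    have n1 := nz_of_disc (hα' i) hx'
    unfold mob at e
    rw [k1 i] at e
    field_simp at e
    linear_combination e
  have m2 : ∀ i, om i * (y * (α i - y)) = om' i * (s * y' * (α' i - y')) := by
    intro i
    have e := h2 i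
    have n1 := nz_of_disc (hα' i) hy'
    unfold mob at e
    rw [k2 i] at e
    field_simp at e
    linear_combination e
  -- the affine map: `conj (α i) = B + K * conj (α' i)`
  obtain ⟨K, hK⟩ : ∃ K, K = r * x' / x := ⟨_, rfl⟩
  obtain ⟨B, hB⟩ : ∃ B, B = (1 - r) / x := ⟨_, rfl⟩
  have hKx : K * x = r * x' := by rw [hK]; field_simp
  have hBx : B * x = 1 - r := by rw [hB]; field_simp
  have c1 : ∀ i, conj (α i) = B + K * conj (α' i) := by
    intro i
    apply mul_right_cancel₀ hx0
    linear_combination -(k1 i) - hBx - conj (α' i) * hKx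
  have hcne : conj (α' i0) - conj (α' i1) ≠ 0 := by
    rw [← map_sub]; exact (map_ne_zero _).2 (sub_ne_zero.2 hne)
  have hKy : K * y = s * y' := by
    apply mul_right_cancel₀ hcne
    linear_combination -(k2 i0) + k2 i1 - y * c1 i0 + y * c1 i1
  have hBy : B * y = 1 - s := by
    linear_combination -(k2 i0) - y * c1 i0 - conj (α' i0) * hKy
  have c2 : ∀ i, α i = conj B + conj K * α' i := by
    intro i
    have := congrArg conj (c1 i)
    simpa using this
  have p1 : ∀ i, om i * (α i - x) = om' i * (K * (α' i - x')) := by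
    intro i
    apply mul_left_cancel₀ hx0
    linear_combination m1 i - om' i * (α' i - x') * hKx
  have p2 : ∀ i, om i * (α i - y) = om' i * (K * (α' i - y')) := by
    intro i
    apply mul_left_cancel₀ hy0
    linear_combination m2 i - om' i * (α' i - y') * hKy
  have d0 : x - y = K * (x' - y') := by
    have e1 := p1 i0
    have e2 := p2 i0
    rw [hom0, hom'0] at e1 e2
    linear_combination e2 - e1
  have hom_eq : ∀ i, om i = om' i := by
    intro i
    apply mul_right_cancel₀ (sub_ne_zero.2 hxy)
    linear_combination p2 i - p1 i - om' i * d0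
  have hom_nz : ∀ i, om i ≠ 0 := by
    intro i h
    have := hom i
    rw [h] at this; simp at this
  have p3 : ∀ i, α i - x = K * (α' i - x') := by
    intro i
    have := p1 i
    rw [← hom_eq i] at this
    exact mul_left_cancel₀ (hom_nz i) this
  have hKr : conj K = K := by
    apply mul_right_cancel₀ (sub_ne_zero.2 hne)
    linear_combination p3 i0 - p3 i1 - c2 i0 + c2 i1
  have hb : conj B = x - K * x' := by
    linear_combination p3 i0 - c2 i0 - α' i0 * hKr
  have hb' : conj B = y - K * y' := by linear_combination hb + d0
  have z1 : conj B * (1 - B * x) = x * (1 - B * x) - K ^ 2 * x := by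
    linear_combination (1 - B * x) * hb + K * hKx + K * x' * hBx
  have z2 : conj B * (1 - B * y) = y * (1 - B * y) - K ^ 2 * y := by
    linear_combination (1 - B * y) * hb' + K * hKy + K * y' * hBy
  have hB0 : B = 0 := by
    by_contra hB0
    have e : (x - y) * (conj B - B * (x * y)) = 0 := by
      linear_combination x * z2 - y * z1
    have e' := (mul_eq_zero.1 e).resolve_left (sub_ne_zero.2 hxy)
    have e'' : conj B = B * (x * y) := by linear_combination e'
    have e3 := congrArg norm e''
    rw [RCLike.norm_conj, norm_mul, norm_mul] at e3
    have hBp : 0 < ‖B‖ := norm_pos_iff.2 hB0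
    have : ‖x‖ * ‖y‖ < 1 := by nlinarith [norm_nonneg x, norm_nonneg y]
    nlinarith
  subst hB0
  rw [zero_mul] at hBx hBy
  rw [map_zero] at z1
  have r1 : r = 1 := by linear_combination hBx
  have s1 : s = 1 := by linear_combination hBy
  subst r1; subst s1
  have hK2 : K = 1 ∨ K = -1 := by
    have : K ^ 2 = 1 := by
      apply mul_right_cancel₀ hx0
      linear_combination z1
    simpa using this
  have haa : conj a * x = conj a' * x' := by linear_combination -hra
  refine ⟨funext hom_eq, ?_⟩
  have haa' : conj a = K * conj a' := by
    apply mul_right_cancel₀ hx0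
    linear_combination haa - conj a' * hKx
  have haK : a = K * a' := by
    have := congrArg conj haa'
    rw [map_mul, hKr] at this
    simpa using this
  rcases hK2 with rfl | rfl
  · left
    refine ⟨by linear_combination hKx, by linear_combination hKy, ?_, by simpa using haK⟩
    funext i
    simpa using c2 i
  · right
    refine ⟨by linear_combination -hKx, by linear_combination -hKy, ?_, by simpa using haK⟩
    funext i
    simpa using c2 i

lemma proj_eq {p q p' q' : ℂ} (h : p * q' = q * p') (h1 : p ≠ 0 ∨ q ≠ 0)
    (h2 : p' ≠ 0 ∨ q' ≠ 0) : ∃ d : ℂ, d ≠ 0 ∧ p = d * p' ∧ q = d * q' := by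
  rcases h2 with h2 | h2
  · refine ⟨p / p', ?_, by field_simp, by field_simp; linear_combination -h⟩
    intro h0
    have hp : p = 0 := by simpa [h2] using h0
    rw [hp, zero_mul] at h
    have hq : q = 0 := (mul_eq_zero.1 h.symm).resolve_right h2
    rcases h1 with h1 | h1 <;> contradiction
  · refine ⟨q / q', ?_, by field_simp; linear_combination h, by field_simp⟩
    intro h0
    have hq : q = 0 := by simpa [h2] using h0
    rw [hq, zero_mul] at h
    have hp : p = 0 := (mul_eq_zero.1 h).resolve_right h2
    rcases h1 with h1 | h1 <;> contradiction

lemma not_both_zero {a x y : ℂ} (ha : ‖a‖ < 1) (hx : ‖x‖ < 1) (hy : ‖y‖ < 1)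
    (hx0 : x ≠ 0) (hy0 : y ≠ 0) (hxy : x ≠ y) :
    x * mob a x ≠ 0 ∨ y * mob a y ≠ 0 := by
  by_contra! h
  obtain ⟨h1, h2⟩ := h
  have e1 := (mul_eq_zero.1 h1).resolve_left hx0
  have e2 := (mul_eq_zero.1 h2).resolve_left hy0
  unfold mob at e1 e2
  have e1' := (div_eq_zero_iff.1 e1).resolve_right (nz_of_disc ha hx)
  have e2' := (div_eq_zero_iff.1 e2).resolve_right (nz_of_disc ha hy)
  exact hxy (by linear_combination e2' - e1')

lemma exists_ne_of_case {n : ℕ} (α' : Fin n → ℂ) (i0 : Fin n)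
    (h : (n = 2 ∧ Function.Injective α') ∨ (n = 3 ∧ ¬ Collinear ℝ (Set.range α'))) :
    ∃ i1, α' i0 ≠ α' i1 := by
  by_contra! hc
  rcases h with ⟨rfl, h⟩ | ⟨rfl, h⟩
  · have h01 : (0 : Fin 2) = 1 := h ((hc 0).symm.trans (hc 1))
    exact absurd h01 (by decide)
  · apply h
    have : Set.range α' = {α' i0} := by
      ext z; constructor
      · rintro ⟨i, rfl⟩; simp [hc i]
      · rintro rfl; exact ⟨i0, rfl⟩
    rw [this]; exact collinear_singleton ℝ _

lemma weights_eq {n : ℕ} (α' : Fin n → ℂ) (t t' : Fin n → ℝ)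
    (hts : (∑ i, t i) = 1) (hts' : (∑ i, t' i) = 1)
    (he : tDot n t α' = tDot n t' α')
    (h : (n = 2 ∧ Function.Injective α') ∨ (n = 3 ∧ ¬ Collinear ℝ (Set.range α'))) :
    t = t' := by
  have hai : AffineIndependent ℝ α' := by
    rcases h with ⟨rfl, h⟩ | ⟨rfl, h⟩
    · have h01 : α' 0 ≠ α' 1 := fun e => absurd (h e) (by decide)
      have := affineIndependent_of_ne ℝ h01
      have e : α' = ![α' 0, α' 1] := by
        funext i; fin_cases i <;> rfl
      rw [e]; exact this
    · exact affineIndependent_iff_not_collinear.2 h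
  rw [affineIndependent_iff] at hai
  have := hai Finset.univ (fun i => t i - t' i) (by
      rw [Finset.sum_sub_distrib, hts, hts', sub_self]) (by
      simp only [tDot] at he
      simp only [sub_smul, Finset.sum_sub_distrib, Complex.real_smul]
      rw [he, sub_self])
  funext i
  have := this i (Finset.mem_univ i)
  linarith

lemma tDot_neg {n : ℕ} (t : Fin n → ℝ) (α : Fin n → ℂ) : tDot n t (-α) = -tDot n t α := by
  simp [tDot]

/-- for `n = 2` or `n = 3`, the parametrizing map
`Φ(x, y, α, t, ω) = (ψ_{ω,α}(x), ψ_{ω,α}(y), [x m_{t·α}(x) : y m_{t·α}(y)])` is `2`-to-`1`: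
if two parameter tuples have the same image then `ω = ω'`, `t = t'` and
`(x, y, α) = ±(x', y', α')`; conversely `ψ_{ω,α}(λ) = ψ_{ω,−α}(−λ)` always holds. -/
theorem statement_16 (n : ℕ) (hn : n = 2 ∨ n = 3)
    (x y x' y' : ℂ)
    (hx : x ∈ uDisc) (hy : y ∈ uDisc) (hx' : x' ∈ uDisc) (hy' : y' ∈ uDisc)
    (hx0 : x ≠ 0) (hy0 : y ≠ 0) (hx'0 : x' ≠ 0) (hy'0 : y' ≠ 0)
    (hxy : x ≠ y) (hxy' : x' ≠ y')
    (t t' : Fin n → ℝ)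
    (ht : ∀ i, 0 < t i) (hts : (∑ i, t i) = 1)
    (ht' : ∀ i, 0 < t' i) (hts' : (∑ i, t' i) = 1)
    (om om' : Fin n → ℂ)
    (hom0 : om ⟨0, by omega⟩ = 1) (hom : ∀ i, ‖om i‖ = 1)
    (hom'0 : om' ⟨0, by omega⟩ = 1) (hom' : ∀ i, ‖om' i‖ = 1)
    (α α' : Fin n → ℂ) (hα : ∀ i, ‖α i‖ < 1) (hα' : ∀ i, ‖α' i‖ < 1)
    (hcase : (n = 2 ∧ Function.Injective α ∧ Function.Injective α') ∨
      (n = 3 ∧ ¬ Collinear ℝ (Set.range α) ∧ ¬ Collinear ℝ (Set.range α')))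
    (heq1 : psiDisc n om α x = psiDisc n om' α' x')
    (heq2 : psiDisc n om α y = psiDisc n om' α' y')
    (heq3 : (x * mob (tDot n t α) x) * (y' * mob (tDot n t' α') y')
      = (y * mob (tDot n t α) y) * (x' * mob (tDot n t' α') x')) :
    (om = om' ∧ t = t' ∧
      ((x = x' ∧ y = y' ∧ α = α') ∨ (x = -x' ∧ y = -y' ∧ α = -α'))) ∧
    (∀ l : ℂ, psiDisc n om α l = psiDisc n om (-α) (-l)) := by
  have hcα : (n = 2 ∧ Function.Injective α) ∨ (n = 3 ∧ ¬ Collinear ℝ (Set.range α)) := by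
    rcases hcase with ⟨h, h1, _⟩ | ⟨h, h1, _⟩
    · exact Or.inl ⟨h, h1⟩
    · exact Or.inr ⟨h, h1⟩
  have hcα' : (n = 2 ∧ Function.Injective α') ∨ (n = 3 ∧ ¬ Collinear ℝ (Set.range α')) := by
    rcases hcase with ⟨h, _, h1⟩ | ⟨h, _, h1⟩
    · exact Or.inl ⟨h, h1⟩
    · exact Or.inr ⟨h, h1⟩
  refine ⟨?_, ?_⟩
  · have hx : ‖x‖ < 1 := hx
    have hy : ‖y‖ < 1 := hy
    have hx' : ‖x'‖ < 1 := hx'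
    have hy' : ‖y'‖ < 1 := hy'
    have ha := tDot_norm_lt t ht hts α hα
    have ha' := tDot_norm_lt t' ht' hts' α' hα'
    have h1 : ∀ i, om i * (x * mob (α i) x) = om' i * (x' * mob (α' i) x') :=
      fun i => congrFun heq1 i
    have h2 : ∀ i, om i * (y * mob (α i) y) = om' i * (y' * mob (α' i) y') :=
      fun i => congrFun heq2 i
    obtain ⟨d, hd0, hd1, hd2⟩ := proj_eq heq3 (not_both_zero ha hx hy hx0 hy0 hxy)
      (not_both_zero ha' hx' hy' hx'0 hy'0 hxy')
    have key : ∀ i, (1 - conj (α i) * x) * (1 - conj (tDot n t' α') * x')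
          = (1 - conj (α' i) * x') * (1 - conj (tDot n t α) * x) ∧
        (1 - conj (α i) * y) * (1 - conj (tDot n t' α') * y')
          = (1 - conj (α' i) * y') * (1 - conj (tDot n t α) * y) := by
      intro i
      rcases le_total 1 ‖d‖ with hd | hd
      · exact agler_key x y x' y' hx hy hx' hy' hx'0 hy'0 hxy' t ht hts om om' hom hom' α α'
          hα hα' _ ha' h1 h2 d hd hd1 hd2 i
      · have hd' : 1 ≤ ‖d⁻¹‖ := by
          rw [norm_inv]
          exact (one_le_inv₀ (norm_pos_iff.2 hd0)).2 hd
        have := agler_key x' y' x y hx' hy' hx hy hx0 hy0 hxy t' ht' hts' om' om hom' hom α' α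
          hα' hα _ ha (fun i => (h1 i).symm) (fun i => (h2 i).symm) d⁻¹ hd'
          (by rw [hd1]; field_simp) (by rw [hd2]; field_simp) i
        exact ⟨this.1.symm, this.2.symm⟩
    obtain ⟨i1, hi1⟩ := exists_ne_of_case α' ⟨0, by omega⟩ hcα'
    obtain ⟨e1, e2⟩ := endgame x y x' y' hx hy hx' hy' hx0 hy0 hxy hxy' om om' _ i1 hom0 hom'0
      hom α α' hα hα' hi1 h1 h2 _ _ ha ha' (fun i => (key i).1) (fun i => (key i).2)
    refine ⟨e1, ?_, ?_⟩
    · apply weights_eq α' t t' hts hts' _ hcα'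
      rcases e2 with ⟨_, _, e3, e4⟩ | ⟨_, _, e3, e4⟩
      · rw [← e4, e3]
      · rw [e3, tDot_neg] at e4
        exact neg_injective e4
    · rcases e2 with ⟨e5, e6, e3, _⟩ | ⟨e5, e6, e3, _⟩
      · exact Or.inl ⟨e5, e6, e3⟩
      · exact Or.inr ⟨e5, e6, e3⟩
  · intro l
    funext i
    simp only [psiDisc, mob, Pi.neg_apply, map_neg, neg_mul_neg]
    rw [show -α i - -l = -(α i - l) by ring, neg_div, neg_mul_neg]
end
end

section
/- Let 𝒟₂ = {(z, w) ∈ 𝔻² × 𝔻² : z ≠ w, z ≠ 0, w ≠ 0}. Let U'₁ = {(z, w) ∈ 𝒟₂ : |z_2| < |z_1|, |w_2| < |w_1|, ρ(z_2/z_1, w_2/w_1) ≤ ρ(z_1, w_1)}, let U''₁ be the image of U'₁ under simultaneously swapping the two coordinates of z and of w, let ℐ = {(z, w) ∈ 𝒟₂ : z_2 = ω·z_1 and w_2 = ω·w_1 for some ω ∈ 𝕋}, and set U₁ = U'₁ ∪ U''₁ ∪ ℐ. Then 𝒟₂∖U₁ is a domain, i.e. a nonempty open connected subset of ℂ² ×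 ℂ². -/
open Complex Set ComplexConjugate

noncomputable section

/-- The set `𝒟₂`. -/
def D2set : Set ((Fin 2 → ℂ) × (Fin 2 → ℂ)) :=
  {p | p.1 ∈ uPolydisc 2 ∧ p.2 ∈ uPolydisc 2 ∧ p.1 ≠ p.2 ∧ p.1 ≠ 0 ∧ p.2 ≠ 0}

/-- The set `U'₁`. -/
def U1' : Set ((Fin 2 → ℂ) × (Fin 2 → ℂ)) :=
  {p ∈ D2set | ‖p.1 1‖ < ‖p.1 0‖ ∧ ‖p.2 1‖ < ‖p.2 0‖ ∧
    hypDist (p.1 1 / p.1 0) (p.2 1 / p.2 0) ≤ hypDist (p.1 0) (p.2 0)}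

/-- Simultaneously swapping the two coordinates of `z` and of `w`. -/
def swapPair (p : (Fin 2 → ℂ) × (Fin 2 → ℂ)) : (Fin 2 → ℂ) × (Fin 2 → ℂ) :=
  (p.1 ∘ Equiv.swap 0 1, p.2 ∘ Equiv.swap 0 1)

/-- The set `U''₁`, the image of `U'₁` under the coordinate swap. -/
def U1'' : Set ((Fin 2 → ℂ) × (Fin 2 → ℂ)) := swapPair '' U1'

/-- The set `ℐ`. -/
def Iset : Set ((Fin 2 → ℂ) × (Fin 2 → ℂ)) :=
  {p ∈ D2set | ∃ ω : ℂ, ‖ω‖ = 1 ∧ p.1 1 = ω * p.1 0 ∧ p.2 1 = ω * p.2 0}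

/-- The polynomial whose sign decides membership. -/
def ff (a b c d : ℂ) : ℝ :=
  ‖b * c - d * a‖ ^ 2 * ‖1 - conj c * a‖ ^ 2 - ‖a - c‖ ^ 2 * ‖a * conj c - b * conj d‖ ^ 2

/-- The closed half of the exceptional set. -/
def KK (p : (Fin 2 → ℂ) × (Fin 2 → ℂ)) : Prop :=
  ‖p.1 1‖ ≤ ‖p.1 0‖ ∧ ‖p.2 1‖ ≤ ‖p.2 0‖ ∧ ff (p.1 0) (p.1 1) (p.2 0) (p.2 1) ≤ 0

/-- The domain. -/
abbrev GG : Set ((Fin 2 → ℂ) × (Fin 2 → ℂ)) := D2set \ (U1' ∪ U1'' ∪ Iset)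

lemma id1 (a b c d : ℂ) : ‖a * conj c - b * conj d‖ ^ 2 =
    ‖b * c - d * a‖ ^ 2 + (‖a‖ ^ 2 - ‖b‖ ^ 2) * (‖c‖ ^ 2 - ‖d‖ ^ 2) := by
  simp only [Complex.sq_norm, Complex.normSq_apply]
  simp
  ring

lemma id2 (a c : ℂ) : ‖1 - conj c * a‖ ^ 2 =
    ‖a - c‖ ^ 2 + (1 - ‖a‖ ^ 2) * (1 - ‖c‖ ^ 2) := by
  simp only [Complex.sq_norm, Complex.normSq_apply]
  simp
  ring

lemma den_pos {a b : ℂ} (ha : ‖a‖ < 1) (hb : ‖b‖ < 1) :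
    ‖a - b‖ < ‖1 - conj b * a‖ := by
  have h := id2 a b
  have h1 : 0 < (1 - ‖a‖ ^ 2) * (1 - ‖b‖ ^ 2) := by
    apply mul_pos <;> nlinarith [norm_nonneg a, norm_nonneg b]
  exact lt_of_pow_lt_pow_left₀ 2 (norm_nonneg _) (by linarith)

lemma hyp_le {a b c e : ℂ} (ha : ‖a‖ < 1) (hb : ‖b‖ < 1) (hc : ‖c‖ < 1) (he : ‖e‖ < 1) :
    hypDist a b ≤ hypDist c e ↔ ‖a - b‖ * ‖1 - conj e * c‖ ≤ ‖c - e‖ * ‖1 - conj b * a‖ := by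
  have h1 := den_pos ha hb
  have h2 := den_pos hc he
  have p1 : 0 < ‖1 - conj b * a‖ := (norm_nonneg _).trans_lt h1
  have p2 : 0 < ‖1 - conj e * c‖ := (norm_nonneg _).trans_lt h2
  unfold hypDist
  rw [norm_div, norm_div, ← div_le_div_iff₀ p1 p2]
  have x1 : ‖a - b‖ / ‖1 - conj b * a‖ < 1 := (div_lt_one p1).2 h1
  have y1 : ‖c - e‖ / ‖1 - conj e * c‖ < 1 := (div_lt_one p2).2 h2
  have x0 : 0 ≤ ‖a - b‖ / ‖1 - conj b * a‖ := by positivity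
  have y0 : 0 ≤ ‖c - e‖ / ‖1 - conj e * c‖ := by positivity
  generalize ‖a - b‖ / ‖1 - conj b * a‖ = x at *
  generalize ‖c - e‖ / ‖1 - conj e * c‖ = y at *
  have hx : 0 < 1 - x := by linarith
  have hy : 0 < 1 - y := by linarith
  rw [Real.log_le_log_iff (by positivity) (by positivity), div_le_div_iff₀ hx hy]
  constructor <;> intro h <;> nlinarith

lemma hyp_ff {a b c d : ℂ} (ha : ‖a‖ < 1) (hc : ‖c‖ < 1) (h1 : ‖b‖ < ‖a‖) (h2 : ‖d‖ < ‖c‖) :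
    hypDist (b / a) (d / c) ≤ hypDist a c ↔ ff a b c d ≤ 0 := by
  have pa : 0 < ‖a‖ := (norm_nonneg _).trans_lt h1
  have pc : 0 < ‖c‖ := (norm_nonneg _).trans_lt h2
  have a0 : a ≠ 0 := norm_pos_iff.1 pa
  have c0 : c ≠ 0 := norm_pos_iff.1 pc
  have c0' : conj c ≠ 0 := by simpa using c0
  rw [hyp_le (by rw [norm_div]; exact (div_lt_one pa).2 h1)
    (by rw [norm_div]; exact (div_lt_one pc).2 h2) ha hc]
  have e1 : b / a - d / c = (b * c - d * a) / (a * c) := by field_simp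
  have e2 : 1 - conj (d / c) * (b / a) = (a * conj c - b * conj d) / (a * conj c) := by
    rw [map_div₀]; field_simp
  rw [e1, e2, norm_div, norm_div, norm_mul a c, norm_mul a (conj c), RCLike.norm_conj,
    div_mul_eq_mul_div, mul_div_assoc', div_le_div_iff_of_pos_right (by positivity),
    ← sq_le_sq₀ (by positivity) (by positivity)]
  unfold ff
  rw [mul_pow, mul_pow, sub_nonpos]

lemma ne_zero_iff2 (z : Fin 2 → ℂ) : z ≠ 0 ↔ (z 0 ≠ 0 ∨ z 1 ≠ 0) := by
  rw [Ne, funext_iff, Fin.forall_fin_two]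
  simp only [Pi.zero_apply]; tauto

lemma top_ne {z : Fin 2 → ℂ} (h : z ≠ 0) (h1 : ‖z 1‖ ≤ ‖z 0‖) : z 0 ≠ 0 := by
  intro h0
  rw [h0, norm_zero] at h1
  have : z 1 = 0 := norm_le_zero_iff.1 h1
  rw [ne_zero_iff2] at h; tauto

lemma KK_iff {p} (hp : p ∈ D2set) : (p ∈ U1' ∨ p ∈ Iset) ↔ KK p := by
  obtain ⟨z, w⟩ := p
  have hp' := hp
  obtain ⟨hz, hw, hne, hz0, hw0⟩ := hp
  simp only at hz hw hne hz0 hw0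
  have hz1 := hz 0
  have hw1 := hw 0
  simp only [U1', Iset, KK, mem_setOf_eq, hp', true_and]
  constructor
  · rintro (⟨h1, h2, h3⟩ | ⟨ω, hω, h1, h2⟩)
    · exact ⟨h1.le, h2.le, (hyp_ff hz1 hw1 h1 h2).1 h3⟩
    · have n1 : ‖z 1‖ = ‖z 0‖ := by rw [h1, norm_mul, hω, one_mul]
      have n2 : ‖w 1‖ = ‖w 0‖ := by rw [h2, norm_mul, hω, one_mul]
      refine ⟨n1.le, n2.le, ?_⟩
      unfold ff
      rw [id1, n1, h1, h2, show ω * z 0 * w 0 - ω * w 0 * z 0 = 0 by ring]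
      simp
  · rintro ⟨h1, h2, h3⟩
    by_cases hlt : ‖z 1‖ < ‖z 0‖ ∧ ‖w 1‖ < ‖w 0‖
    · exact Or.inl ⟨hlt.1, hlt.2, (hyp_ff hz1 hw1 hlt.1 hlt.2).2 h3⟩
    · right
      have a0 := top_ne hz0 h1
      have c0 := top_ne hw0 h2
      have heq : ‖z 1‖ = ‖z 0‖ ∨ ‖w 1‖ = ‖w 0‖ := by
        by_contra hh
        push Not at hh
        exact hlt ⟨lt_of_le_of_ne h1 hh.1, lt_of_le_of_ne h2 hh.2⟩
      have hS : ‖z 1 * w 0 - w 1 * z 0‖ ^ 2 ≤ 0 := by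
        have hpr : (‖z 0‖ ^ 2 - ‖z 1‖ ^ 2) * (‖w 0‖ ^ 2 - ‖w 1‖ ^ 2) = 0 := by
          rcases heq with h | h <;> rw [h] <;> ring
        unfold ff at h3
        rw [id1, hpr, id2] at h3
        have hpos : 0 < (1 - ‖z 0‖ ^ 2) * (1 - ‖w 0‖ ^ 2) := by
          apply mul_pos <;> nlinarith [norm_nonneg (z 0), norm_nonneg (w 0)]
        by_contra hh
        push Not at hh
        nlinarith [mul_pos hh hpos]
      have hS' : z 1 * w 0 - w 1 * z 0 = 0 := by
        have := pow_eq_zero_iff (two_ne_zero) |>.1 (le_antisymm hS (by positivity))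
        exact norm_eq_zero.1 this
      have hab : z 1 / z 0 = w 1 / w 0 := by
        rw [div_eq_div_iff a0 c0]; exact sub_eq_zero.1 hS'
      refine ⟨z 1 / z 0, ?_, by field_simp, by rw [hab]; field_simp⟩
      rcases heq with h | h
      · rw [norm_div, h, div_self (norm_ne_zero_iff.2 a0)]
      · rw [hab, norm_div, h, div_self (norm_ne_zero_iff.2 c0)]

lemma swap_swap (p) : swapPair (swapPair p) = p := by
  obtain ⟨z, w⟩ := p
  simp only [swapPair, Function.comp_assoc]
  ext i <;> simp

@[simp] lemma sw10 (p) : (swapPair p).1 0 = p.1 1 := by simp [swapPair]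
@[simp] lemma sw11 (p) : (swapPair p).1 1 = p.1 0 := by simp [swapPair]
@[simp] lemma sw20 (p) : (swapPair p).2 0 = p.2 1 := by simp [swapPair]
@[simp] lemma sw21 (p) : (swapPair p).2 1 = p.2 0 := by simp [swapPair]

lemma swap_cont : Continuous swapPair := by
  unfold swapPair
  fun_prop

lemma memD (p) : p ∈ D2set ↔ ‖p.1 0‖ < 1 ∧ ‖p.1 1‖ < 1 ∧ ‖p.2 0‖ < 1 ∧ ‖p.2 1‖ < 1 ∧
    (p.1 0 ≠ p.2 0 ∨ p.1 1 ≠ p.2 1) ∧ (p.1 0 ≠ 0 ∨ p.1 1 ≠ 0) ∧ (p.2 0 ≠ 0 ∨ p.2 1 ≠ 0) := by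
  simp only [D2set, mem_setOf_eq, ne_zero_iff2, uPolydisc, Fin.forall_fin_two]
  rw [Ne, funext_iff, Fin.forall_fin_two]
  tauto

lemma swapD (p) : swapPair p ∈ D2set ↔ p ∈ D2set := by
  rw [memD, memD]; simp; tauto

lemma swapI {p} (h : p ∈ Iset) : swapPair p ∈ Iset := by
  obtain ⟨hp, ω, hω, h1, h2⟩ := h
  refine ⟨(swapD p).2 hp, ω⁻¹, by simp [hω], ?_, ?_⟩
  all_goals
    have : ω ≠ 0 := by rintro rfl; simp at hω
    simp [h1, h2, this]

lemma memG (p) : p ∈ GG ↔ p ∈ D2set ∧ ¬ KK p ∧ ¬ KK (swapPair p) := by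
  simp only [GG, mem_diff, mem_union]
  refine and_congr_right fun hp => ?_
  rw [← KK_iff hp, ← KK_iff ((swapD p).2 hp)]
  have h1 : p ∈ U1'' ↔ swapPair p ∈ U1' := by
    constructor
    · rintro ⟨q, hq, rfl⟩; rwa [swap_swap]
    · intro h; exact ⟨_, h, swap_swap p⟩
  have h2 : swapPair p ∈ Iset ↔ p ∈ Iset :=
    ⟨fun h => by simpa [swap_swap] using swapI h, swapI⟩
  rw [h1, h2]; tauto

lemma swapG (p) : swapPair p ∈ GG ↔ p ∈ GG := by
  rw [memG, memG, swapD, swap_swap]; tauto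

lemma isOpenG : IsOpen GG := by
  have hK : IsClosed {p | KK p} := by
    simp only [KK, ff, setOf_and]
    refine (isClosed_le (by fun_prop) (by fun_prop)).inter
      ((isClosed_le (by fun_prop) (by fun_prop)).inter (isClosed_le ?_ (by fun_prop)))
    have hc := Complex.continuous_conj
    fun_prop
  have hK2 : IsClosed {p | KK (swapPair p)} := hK.preimage swap_cont
  have hD : IsOpen D2set := by
    have : D2set = {p | (‖p.1 0‖ < 1 ∧ ‖p.1 1‖ < 1 ∧ ‖p.2 0‖ < 1 ∧ ‖p.2 1‖ < 1) ∧
      p.1 ≠ p.2 ∧ p.1 ≠ 0 ∧ p.2 ≠ 0} := by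
      ext p
      simp only [D2set, mem_setOf_eq, uPolydisc, Fin.forall_fin_two]
      tauto
    rw [this]
    simp only [setOf_and]
    refine IsOpen.inter ?_ (IsOpen.inter ?_ (IsOpen.inter ?_ ?_))
    · refine IsOpen.inter ?_ (IsOpen.inter ?_ (IsOpen.inter ?_ ?_)) <;>
        exact isOpen_lt (by fun_prop) (by fun_prop)
    all_goals exact isOpen_ne_fun (by fun_prop) (by fun_prop)
  have : GG = D2set ∩ ({p | KK p}ᶜ ∩ {p | KK (swapPair p)}ᶜ) := by
    ext p; rw [memG]; rfl
  rw [this]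
  exact hD.inter (hK.isOpen_compl.inter hK2.isOpen_compl)

/-- strict opposite region -/
lemma memG_strict {p : (Fin 2 → ℂ) × (Fin 2 → ℂ)} (h1 : ‖p.1 1‖ < 1) (h2 : ‖p.2 0‖ < 1)
    (h3 : ‖p.1 0‖ < ‖p.1 1‖) (h4 : ‖p.2 1‖ < ‖p.2 0‖) : p ∈ GG := by
  rw [memG, memD]
  refine ⟨⟨h3.trans h1, h1, h2, h4.trans h2, ?_, Or.inr ?_, Or.inl ?_⟩, ?_, ?_⟩
  · by_contra! hh
    rw [hh.1, hh.2] at h3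
    linarith
  · exact norm_pos_iff.1 ((norm_nonneg _).trans_lt h3)
  · exact norm_pos_iff.1 ((norm_nonneg _).trans_lt h4)
  · rintro ⟨h, -⟩; linarith
  · rintro ⟨-, h, -⟩; simp at h; linarith

lemma joined_path {p q : (Fin 2 → ℂ) × (Fin 2 → ℂ)} (γ : ℝ → (Fin 2 → ℂ) × (Fin 2 → ℂ))
    (hc : Continuous γ) (h0 : γ 0 = p) (h1 : γ 1 = q)
    (hm : ∀ t, 0 ≤ t → t ≤ 1 → γ t ∈ GG) : JoinedIn GG p q :=
  ⟨{ toFun := fun t => γ t, continuous_toFun := by fun_prop, source' := by simpa using h0,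
     target' := by simpa using h1 }, fun t => hm t t.2.1 t.2.2⟩

lemma pair_ext (p : (Fin 2 → ℂ) × (Fin 2 → ℂ)) : (![p.1 0, p.1 1], ![p.2 0, p.2 1]) = p := by
  ext i <;> fin_cases i <;> rfl

lemma L1 {p : (Fin 2 → ℂ) × (Fin 2 → ℂ)} (hp : p ∈ GG) (h1 : ‖p.1 0‖ ≤ ‖p.1 1‖)
    (h2 : ‖p.2 1‖ ≤ ‖p.2 0‖) : JoinedIn GG p (![0, p.1 1], ![p.2 0, 0]) := by
  have hD := ((memG p).1 hp).1
  rw [memD] at hD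
  obtain ⟨-, b1, c1, -, -, ha, hd⟩ := hD
  have b0 : 0 < ‖p.1 1‖ := by
    by_contra! h
    have e1 := norm_le_zero_iff.1 h
    have e2 := norm_le_zero_iff.1 (h1.trans h)
    tauto
  have c0 : 0 < ‖p.2 0‖ := by
    by_contra! h
    have e1 := norm_le_zero_iff.1 h
    have e2 := norm_le_zero_iff.1 (h2.trans h)
    tauto
  refine joined_path (fun t => (![(1 - (t : ℂ)) * p.1 0, p.1 1], ![p.2 0, (1 - (t : ℂ)) * p.2 1]))
    ?_ ?_ ?_ ?_
  · refine Continuous.prodMk ?_ ?_ <;> refine continuous_pi fun i => ?_ <;> fin_cases i <;>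
      simp <;> fun_prop
  · simpa using pair_ext p
  · simp
  · intro t t0 t1
    rcases t0.eq_or_lt with rfl | t0
    · simpa [pair_ext p] using hp
    · have e : ‖(1 - (t : ℂ))‖ = 1 - t := by
        rw [show (1 - (t : ℂ)) = ((1 - t : ℝ) : ℂ) by push_cast; rfl, Complex.norm_real,
          Real.norm_of_nonneg (by linarith)]
      apply memG_strict
      · simpa using b1
      · simpa using c1
      · simp [e]; nlinarith
      · simp [e]; nlinarith

lemma punct : IsPathConnected {z : ℂ | ‖z‖ < 1 ∧ z ≠ 0} := by
  have h : IsPathConnected (Complex.exp '' {z : ℂ | z.re < 0}) := by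
    refine IsPathConnected.image ?_ Complex.continuous_exp
    exact (convex_halfSpace_re_lt 0).isPathConnected ⟨-1, by simp⟩
  convert h using 1
  ext z
  constructor
  · rintro ⟨h1, h2⟩
    refine ⟨Complex.log z, ?_, Complex.exp_log h2⟩
    simp only [mem_setOf_eq, Complex.log_re]
    exact Real.log_neg (norm_pos_iff.2 h2) h1
  · rintro ⟨w, hw, rfl⟩
    exact ⟨by rw [Complex.norm_exp]; exact Real.exp_lt_one_iff.2 hw, Complex.exp_ne_zero _⟩

lemma L2 {b c : ℂ} (hb : ‖b‖ < 1) (hb0 : b ≠ 0) (hc : ‖c‖ < 1) (hc0 : c ≠ 0) :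
    JoinedIn GG (![0, b], ![c, 0]) (![0, 1/2], ![1/2, 0]) := by
  have h := (punct.prod punct).joinedIn (b, c) ⟨⟨hb, hb0⟩, ⟨hc, hc0⟩⟩ (1/2, 1/2)
    (by constructor <;> constructor <;> norm_num)
  have hf : Continuous (fun x : ℂ × ℂ =>
      ((![0, x.1], ![x.2, 0]) : (Fin 2 → ℂ) × (Fin 2 → ℂ))) := by
    refine Continuous.prodMk ?_ ?_ <;> refine continuous_pi fun i => ?_ <;> fin_cases i <;>
      simp <;> fun_prop
  refine (h.map hf).mono ?_
  rintro _ ⟨⟨x, y⟩, ⟨⟨h1, h2⟩, ⟨h3, h4⟩⟩, rfl⟩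
  simp only at h1 h2 h3 h4
  apply memG_strict <;> simp [h1, h2, h3, h4]

lemma L12 {p : (Fin 2 → ℂ) × (Fin 2 → ℂ)} (hp : p ∈ GG) (h1 : ‖p.1 0‖ ≤ ‖p.1 1‖)
    (h2 : ‖p.2 1‖ ≤ ‖p.2 0‖) : JoinedIn GG p (![0, 1/2], ![1/2, 0]) := by
  have hj := L1 hp h1 h2
  refine hj.trans ?_
  have hD := ((memG _).1 hj.target_mem).1
  rw [memD] at hD
  simp at hD
  exact L2 hD.1 hD.2.2.2.1 hD.2.1 hD.2.2.2.2

lemma joined_swap {p q : (Fin 2 → ℂ) × (Fin 2 → ℂ)} (h : JoinedIn GG (swapPair p) q) :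
    JoinedIn GG p (swapPair q) := by
  have := h.map swap_cont
  rw [swap_swap] at this
  refine this.mono ?_
  rintro _ ⟨x, hx, rfl⟩
  exact (swapG x).2 hx

lemma base_swap : JoinedIn GG (swapPair (![0, 1/2], ![1/2, 0])) (![0, 1/2], ![1/2, 0]) := by
  have hq : ((![1/2, 1/2], ![1/2, -1/2]) : (Fin 2 → ℂ) × (Fin 2 → ℂ)) ∈ GG := by
    rw [memG, memD]
    refine ⟨by norm_num, ?_, ?_⟩
    · rintro ⟨-, -, h⟩
      norm_num [ff, map_ofNat] at h
    · rintro ⟨-, -, h⟩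
      norm_num [ff, map_ofNat] at h
  have j1 := L12 hq (by simp) (by simp)
  have j2 := joined_swap (L12 ((swapG _).2 hq) (by simp) (by simp))
  exact j2.symm.trans j1

lemma L12' {p : (Fin 2 → ℂ) × (Fin 2 → ℂ)} (hp : p ∈ GG) (h1 : ‖p.1 1‖ ≤ ‖p.1 0‖)
    (h2 : ‖p.2 0‖ ≤ ‖p.2 1‖) : JoinedIn GG p (![0, 1/2], ![1/2, 0]) :=
  (joined_swap (L12 ((swapG p).2 hp) (by simpa) (by simpa))).trans base_swap

lemma ff_line (a b c d v : ℂ) (ha : ‖a‖ < 1) (hc : ‖c‖ < 1) (hd : ‖d‖ ≤ ‖c‖)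
    (h : 0 < ff a b c d) : ∃ B : ℝ, ∀ t : ℝ, 0 ≤ t * B → 0 < ff a (b + t * v) c d := by
  refine ⟨((b * c - d * a) * conj (v * c)).re * ‖1 - conj c * a‖ ^ 2 +
    ‖a - c‖ ^ 2 * ((a * conj c - b * conj d) * conj (v * conj d)).re, fun t ht => ?_⟩
  have key : ff a (b + t * v) c d = ff a b c d +
      2 * (t * (((b * c - d * a) * conj (v * c)).re * ‖1 - conj c * a‖ ^ 2 +
    ‖a - c‖ ^ 2 * ((a * conj c - b * conj d) * conj (v * conj d)).re)) +
      t ^ 2 * ‖v‖ ^ 2 * (‖c‖ ^ 2 * ‖1 - conj c * a‖ ^ 2 - ‖d‖ ^ 2 * ‖a - c‖ ^ 2) := by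
    have e1 : ‖(b + t * v) * c - d * a‖ ^ 2 = ‖b * c - d * a‖ ^ 2 +
        2 * t * ((b * c - d * a) * conj (v * c)).re + t ^ 2 * ‖v‖ ^ 2 * ‖c‖ ^ 2 := by
      simp only [Complex.sq_norm, Complex.normSq_apply]
      simp
      ring
    have e2 : ‖a * conj c - (b + t * v) * conj d‖ ^ 2 = ‖a * conj c - b * conj d‖ ^ 2 -
        2 * t * ((a * conj c - b * conj d) * conj (v * conj d)).re
          + t ^ 2 * ‖v‖ ^ 2 * ‖d‖ ^ 2 := by
      simp only [Complex.sq_norm, Complex.normSq_apply]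
      simp
      ring
    unfold ff
    rw [e1, e2]
    ring
  have h1 := (den_pos ha hc).le
  have h2 : ‖d‖ ^ 2 * ‖a - c‖ ^ 2 ≤ ‖c‖ ^ 2 * ‖1 - conj c * a‖ ^ 2 := by gcongr
  have h3 : 0 ≤ t ^ 2 * ‖v‖ ^ 2 *
      (‖c‖ ^ 2 * ‖1 - conj c * a‖ ^ 2 - ‖d‖ ^ 2 * ‖a - c‖ ^ 2) :=
    mul_nonneg (by positivity) (by linarith)
  rw [key]
  linarith

lemma exists_end (b v : ℂ) (r : ℝ) (hv : ‖v‖ = 1) (B s : ℝ) (hb : b = s * v) (hs0 : 0 ≤ s)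
    (hsr : s < r) : ∃ T : ℝ, 0 ≤ T * B ∧ ‖b + T * v‖ = r := by
  rcases le_total 0 B with h | h
  · refine ⟨r - s, mul_nonneg (by linarith) h, ?_⟩
    rw [hb, show (s : ℂ) * v + ((r - s : ℝ) : ℂ) * v = (r : ℂ) * v by push_cast; ring, norm_mul,
      hv, Complex.norm_real, Real.norm_of_nonneg (by linarith), mul_one]
  · refine ⟨-(r + s), by nlinarith, ?_⟩
    rw [hb, show (s : ℂ) * v + ((-(r + s) : ℝ) : ℂ) * v = -((r : ℂ) * v) by push_cast; ring,
      norm_neg, norm_mul, hv, Complex.norm_real, Real.norm_of_nonneg (by linarith), mul_one]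

lemma exists_dir (b : ℂ) : ∃ v : ℂ, ‖v‖ = 1 ∧ b = ‖b‖ * v := by
  by_cases h : b = 0
  · exact ⟨1, by simp, by simp [h]⟩
  · have h' : (‖b‖ : ℂ) ≠ 0 := by exact_mod_cast norm_ne_zero_iff.2 h
    refine ⟨b / ‖b‖, ?_, by field_simp⟩
    rw [norm_div, Complex.norm_real, norm_norm, div_self (norm_ne_zero_iff.2 h)]

lemma L5 {p : (Fin 2 → ℂ) × (Fin 2 → ℂ)} (hp : p ∈ GG) (h1 : ‖p.1 1‖ < ‖p.1 0‖)
    (h2 : ‖p.2 1‖ < ‖p.2 0‖) : JoinedIn GG p (![0, 1/2], ![1/2, 0]) := by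
  obtain ⟨hD, hK, -⟩ := (memG p).1 hp
  rw [memD] at hD
  obtain ⟨a1, b1, c1, d1, -, -, -⟩ := hD
  have hf : 0 < ff (p.1 0) (p.1 1) (p.2 0) (p.2 1) := by
    by_contra! h
    exact hK ⟨h1.le, h2.le, h⟩
  have a0 : p.1 0 ≠ 0 := norm_pos_iff.1 ((norm_nonneg _).trans_lt h1)
  have c0 : p.2 0 ≠ 0 := norm_pos_iff.1 ((norm_nonneg _).trans_lt h2)
  obtain ⟨v, hv, hbv⟩ := exists_dir (p.1 1)
  obtain ⟨B, hB⟩ := ff_line _ _ _ _ v a1 c1 h2.le hf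
  obtain ⟨r, hr1, hr2⟩ := exists_between a1
  obtain ⟨T, hT, hTr⟩ := exists_end _ v r hv B _ hbv (norm_nonneg _) (h1.trans hr1)
  have hj : JoinedIn GG p (![p.1 0, p.1 1 + T * v], ![p.2 0, p.2 1]) := by
    refine joined_path (fun t => (![p.1 0, p.1 1 + ((t * T : ℝ) : ℂ) * v], ![p.2 0, p.2 1]))
      ?_ ?_ ?_ ?_
    · refine Continuous.prodMk ?_ ?_ <;> refine continuous_pi fun i => ?_ <;> fin_cases i <;>
        simp <;> fun_prop
    · simpa using pair_ext p
    · simp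
    · intro t t0 t1
      have hpos := hB (t * T) (by rw [mul_assoc]; exact mul_nonneg t0 hT)
      have hlt : ‖p.1 1 + ((t * T : ℝ) : ℂ) * v‖ < 1 := by
        have e : p.1 1 + ((t * T : ℝ) : ℂ) * v =
            ((1 - t : ℝ) : ℂ) * p.1 1 + (t : ℂ) * (p.1 1 + T * v) := by push_cast; ring
        rw [e]
        refine (norm_add_le _ _).trans_lt ?_
        rw [norm_mul, norm_mul, hTr, Complex.norm_real, Complex.norm_real,
          Real.norm_of_nonneg t0, Real.norm_of_nonneg (by linarith)]
        nlinarith [h1.trans hr1, norm_nonneg (p.1 1)]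
      generalize p.1 1 + ((t * T : ℝ) : ℂ) * v = b at hpos hlt
      rw [memG, memD]
      refine ⟨⟨a1, hlt, c1, d1, ?_, Or.inl a0, Or.inl c0⟩, ?_, ?_⟩
      · by_contra! hh
        obtain ⟨e1, e2⟩ := hh
        simp at e1 e2
        rw [e1, e2] at hpos
        simp [ff, mul_comm] at hpos
      · rintro ⟨-, -, h⟩
        simp at h
        linarith
      · rintro ⟨-, h, -⟩
        simp at h
        linarith
  refine hj.trans (L12 hj.target_mem ?_ ?_)
  · simp only [Matrix.cons_val_zero, Matrix.cons_val_one]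
    rw [hTr]; exact hr1.le
  · simpa using h2.le

lemma L5' {p : (Fin 2 → ℂ) × (Fin 2 → ℂ)} (hp : p ∈ GG) (h1 : ‖p.1 0‖ < ‖p.1 1‖)
    (h2 : ‖p.2 0‖ < ‖p.2 1‖) : JoinedIn GG p (![0, 1/2], ![1/2, 0]) :=
  (joined_swap (L5 ((swapG p).2 hp) (by simpa) (by simpa))).trans base_swap

lemma pathG : IsPathConnected GG := by
  refine ⟨(![0, 1/2], ![1/2, 0]), base_swap.target_mem, fun {p} hp => ?_⟩
  symm
  rcases le_or_gt ‖p.1 0‖ ‖p.1 1‖ with h1 | h1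
  · rcases le_or_gt ‖p.2 1‖ ‖p.2 0‖ with h2 | h2
    · exact L12 hp h1 h2
    · rcases h1.eq_or_lt with h | h
      · exact L12' hp h.ge h2.le
      · exact L5' hp h h2
  · rcases le_or_gt ‖p.2 0‖ ‖p.2 1‖ with h2 | h2
    · exact L12' hp h1.le h2
    · exact L5 hp h1 h2

/-- `𝒟₂ ∖ U₁` is a domain, i.e. nonempty, open and connected. -/
theorem statement_17 :
    IsOpen (D2set \ (U1' ∪ U1'' ∪ Iset)) ∧
    IsConnected (D2set \ (U1' ∪ U1'' ∪ Iset)) := 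
  ⟨isOpenG, pathG.isConnected⟩
end
end

section
/- Let n ≥ 2, let 𝒟ₙ = {(z, w) ∈ 𝔻ⁿ × 𝔻ⁿ : z ≠ w, z ≠ 0, w ≠ 0}, and let ℙ¹ denote the complex projective line. For (z, w) ∈ 𝒟ₙ and ξ = [σ : τ] ∈ ℙ¹, the extremal problem corresponding to (z, w, ξ) is the three-point Pick problem 0 ↦ 0, z ↦ t₀·σ, w ↦ t₀·τ, where t₀ > 0 is the unique positive number making this problem extremal (whether this problem is degenerate does not depend on the chosen representative (σ, τ) of ξ). Let 𝒜_d ⊆ 𝒟ₙ × ℙ¹ be the set of (z, w, ξ) whose corresponding extremal problem is degenerate. Then for every nonempty open connected G ⊆ 𝒟ₙ, the set (G × ℙ¹)∖𝒜_d is a domain (open and connected); in particular (𝒟ₙ × ℙ¹)∖𝒜_d is a domain. -/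
open Complex Set ComplexConjugate

noncomputable section

/-- The set `𝒟ₙ`. -/
def Dset (n : ℕ) : Set ((Fin n → ℂ) × (Fin n → ℂ)) :=
  {p | p.1 ∈ uPolydisc n ∧ p.2 ∈ uPolydisc n ∧ p.1 ≠ p.2 ∧ p.1 ≠ 0 ∧ p.2 ≠ 0}

/-- The complex projective line `ℙ¹`. -/
abbrev ProjLine := Projectivization ℂ (Fin 2 → ℂ)

/-- The quotient topology on the projective line. -/
instance : TopologicalSpace ProjLine :=
  inferInstanceAs (TopologicalSpace (Quotient (projectivizationSetoid ℂ (Fin 2 → ℂ))))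

/-- The set `𝒜_d` of data `(z, w, ξ)` whose corresponding extremal three-point Pick
problem (with targets rescaled by the unique `t > 0` making the problem extremal)
is degenerate. -/
def Adeg (n : ℕ) : Set (((Fin n → ℂ) × (Fin n → ℂ)) × ProjLine) :=
  {q | q.1 ∈ Dset n ∧ ∃ v : Fin 2 → ℂ, ∃ hv : v ≠ 0,
    q.2 = Projectivization.mk ℂ v hv ∧ ∃ t : ℝ, 0 < t ∧
      ‖(t:ℂ) * v 0‖ < 1 ∧ ‖(t:ℂ) * v 1‖ < 1 ∧
      ExtremalPick n 3 ![(0 : Fin n → ℂ), q.1.1, q.1.2]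
        ![(0:ℂ), (t:ℂ) * v 0, (t:ℂ) * v 1] ∧
      DegeneratePick n ![(0 : Fin n → ℂ), q.1.1, q.1.2]
        ![(0:ℂ), (t:ℂ) * v 0, (t:ℂ) * v 1]}

open Topology Filter Metric

/-! ### Möbius maps -/

lemma mob_den_ne {a l : ℂ} (ha : ‖a‖ < 1) (hl : ‖l‖ ≤ 1) : 1 - conj a * l ≠ 0 := by
  intro h
  have h1 : conj a * l = 1 := (sub_eq_zero.1 h).symm
  have h2 : ‖a‖ * ‖l‖ = 1 := by
    have := congrArg norm h1
    simpa [norm_mul] using this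
  nlinarith [norm_nonneg a, norm_nonneg l]

lemma mob_normSq_identity (a l : ℂ) :
    normSq (1 - conj a * l) - normSq (a - l) = (1 - normSq a) * (1 - normSq l) := by
  simp only [normSq_apply, sub_re, sub_im, mul_re, mul_im, conj_re, conj_im, one_re, one_im]
  ring

lemma mob_norm_identity {a l : ℂ} (ha : ‖a‖ < 1) (hl : ‖l‖ ≤ 1) :
    1 - ‖mob a l‖ ^ 2 = (1 - ‖a‖ ^ 2) * (1 - ‖l‖ ^ 2) / ‖1 - conj a * l‖ ^ 2 := by
  have h := mob_den_ne ha hl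
  have h' : normSq (1 - conj a * l) ≠ 0 := by simpa [normSq_eq_zero] using h
  unfold mob
  rw [norm_div, div_pow, ← normSq_eq_norm_sq, ← normSq_eq_norm_sq, ← normSq_eq_norm_sq,
    ← normSq_eq_norm_sq, ← mob_normSq_identity, sub_div, div_self h']

lemma mob_norm_le {a l : ℂ} (ha : ‖a‖ < 1) (hl : ‖l‖ ≤ 1) : ‖mob a l‖ ≤ 1 := by
  have h := mob_norm_identity ha hl
  have : 0 ≤ (1 - ‖a‖ ^ 2) * (1 - ‖l‖ ^ 2) / ‖1 - conj a * l‖ ^ 2 := by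
    apply div_nonneg (mul_nonneg _ _) (by positivity)
    · nlinarith [norm_nonneg a]
    · nlinarith [norm_nonneg l]
  nlinarith [norm_nonneg (mob a l)]

/-- quantitative contraction of Möbius maps on a smaller disc -/
lemma mob_norm_le_lt {a : ℂ} {r : ℝ} (ha : ‖a‖ < 1) (hr : r < 1) :
    ∃ r' : ℝ, 0 ≤ r' ∧ r' < 1 ∧ ∀ l : ℂ, ‖l‖ ≤ r → ‖mob a l‖ ≤ r' := by
  by_cases hr0 : r < 0
  · exact ⟨0, le_rfl, one_pos, fun l hl => absurd (norm_nonneg l) (by linarith)⟩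
  push Not at hr0
  set d : ℝ := (1 - ‖a‖ ^ 2) * (1 - r ^ 2) / 4 with hd
  have hapos : 0 < 1 - ‖a‖ ^ 2 := by nlinarith [norm_nonneg a]
  have hrpos : 0 < 1 - r ^ 2 := by nlinarith
  have hdpos : 0 < d := by positivity
  refine ⟨Real.sqrt (1 - d), Real.sqrt_nonneg _, ?_, fun l hl => ?_⟩
  · rw [Real.sqrt_lt' one_pos]; linarith
  · apply Real.le_sqrt_of_sq_le
    have h := mob_norm_identity ha (hl.trans hr.le)
    have hne := mob_den_ne ha (hl.trans hr.le)
    have h4 : ‖1 - conj a * l‖ ^ 2 ≤ 4 := by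
      have : ‖1 - conj a * l‖ ≤ 1 + ‖a‖ * ‖l‖ := by
        refine (norm_sub_le _ _).trans ?_
        simp
      have h2 : ‖1 - conj a * l‖ ≤ 2 := by nlinarith [norm_nonneg a, norm_nonneg l]
      nlinarith [norm_nonneg (1 - conj a * l)]
    have : d ≤ (1 - ‖a‖ ^ 2) * (1 - ‖l‖ ^ 2) / ‖1 - conj a * l‖ ^ 2 := by
      have hp : 0 < ‖1 - conj a * l‖ ^ 2 := by positivity
      rw [hd, div_le_div_iff₀ (by norm_num) hp]
      have : 1 - r ^ 2 ≤ 1 - ‖l‖ ^ 2 := by nlinarith [norm_nonneg l]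
      have := mul_le_mul_of_nonneg_left this hapos.le
      have h0 : 0 ≤ (1 - ‖a‖ ^ 2) * (1 - r ^ 2) := by positivity
      nlinarith [mul_le_mul_of_nonneg_left h4 h0]
    linarith

lemma mob_norm_lt {a l : ℂ} (ha : ‖a‖ < 1) (hl : ‖l‖ < 1) : ‖mob a l‖ < 1 := by
  obtain ⟨r', _, h1, h2⟩ := mob_norm_le_lt ha hl
  exact (h2 l le_rfl).trans_lt h1

lemma mob_zero_left (l : ℂ) : mob 0 l = -l := by simp [mob]
lemma mob_zero_right (a : ℂ) : mob a 0 = a := by simp [mob]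
lemma mob_self (a : ℂ) : mob a a = 0 := by simp [mob]

lemma mob_mob {a l : ℂ} (ha : ‖a‖ < 1) (hl : ‖l‖ ≤ 1) : mob a (mob a l) = l := by
  have h1 := mob_den_ne ha hl
  have h2 := mob_den_ne ha ha.le
  have h3 : 1 - conj a * mob a l = (1 - conj a * a) / (1 - conj a * l) := by
    unfold mob; rw [eq_div_iff h1]
    have : (a - l) / (1 - conj a * l) * (1 - conj a * l) = a - l := div_mul_cancel₀ _ h1
    linear_combination (- conj a) * this
  have h4 : a - mob a l = l * (1 - conj a * a) / (1 - conj a * l) := by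
    unfold mob; rw [eq_div_iff h1]
    have : (a - l) / (1 - conj a * l) * (1 - conj a * l) = a - l := div_mul_cancel₀ _ h1
    linear_combination (- 1) * this
  have : mob a (mob a l) = (a - mob a l) / (1 - conj a * mob a l) := rfl
  rw [this, h3, h4, div_div_div_cancel_right₀ h1, mul_div_assoc, div_self h2, mul_one]

lemma mob_inj {a l l' : ℂ} (ha : ‖a‖ < 1) (hl : ‖l‖ ≤ 1) (hl' : ‖l'‖ ≤ 1)
    (h : mob a l = mob a l') : l = l' := by
  rw [← mob_mob ha hl, h, mob_mob ha hl']

lemma mob_rot {κ : ℂ} (hκ : ‖κ‖ = 1) (a l : ℂ) : mob (κ * a) (κ * l) = κ * mob a l := by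
  have h : conj κ * κ = 1 := by
    rw [mul_comm, mul_conj, normSq_eq_norm_sq, hκ]; simp
  unfold mob
  have : conj (κ * a) * (κ * l) = conj a * l := by
    rw [map_mul]; linear_combination (conj a * l) * h
  rw [this]; ring

lemma mob_norm_comm (a l : ℂ) : ‖mob a l‖ = ‖mob l a‖ := by
  unfold mob
  rw [norm_div, norm_div, norm_sub_rev a l]
  congr 1
  rw [← norm_conj (1 - conj l * a)]
  congr 1
  simp [mul_comm]

lemma mob_differentiableAt {a l : ℂ} (ha : ‖a‖ < 1) (hl : ‖l‖ ≤ 1) :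
    DifferentiableAt ℂ (mob a) l := by
  unfold mob
  have := mob_den_ne ha hl
  fun_prop (disch := assumption)

/-! ### Vector-valued Möbius maps and Schur functions -/

lemma uPolydisc_eq_ball (n : ℕ) : uPolydisc n = ball (0 : Fin n → ℂ) 1 := by
  ext x
  simp [uPolydisc, pi_norm_lt_iff]

def mobv {n : ℕ} (z w : Fin n → ℂ) : Fin n → ℂ := fun i => mob (z i) (w i)

def Schur (n : ℕ) (F : (Fin n → ℂ) → ℂ) : Prop :=
  DifferentiableOn ℂ F (uPolydisc n) ∧ ∀ x ∈ uPolydisc n, ‖F x‖ ≤ 1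

lemma zero_mem_uPolydisc (n : ℕ) : (0 : Fin n → ℂ) ∈ uPolydisc n := by
  simp [uPolydisc]

lemma mobv_mem {n : ℕ} {z w : Fin n → ℂ} (hz : z ∈ uPolydisc n) (hw : w ∈ uPolydisc n) :
    mobv z w ∈ uPolydisc n := fun i => mob_norm_lt (hz i) (hw i)

lemma mobv_mobv {n : ℕ} {z w : Fin n → ℂ} (hz : z ∈ uPolydisc n) (hw : w ∈ uPolydisc n) :
    mobv z (mobv z w) = w := by
  funext i; exact mob_mob (hz i) (hw i).le

lemma mobv_ne_zero {n : ℕ} {z w : Fin n → ℂ} (hz : z ∈ uPolydisc n) (hw : w ∈ uPolydisc n)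
    (h : z ≠ w) : mobv z w ≠ 0 := by
  intro h0
  apply h
  funext i
  have h1 : mob (z i) (w i) = mob (z i) (z i) := by
    rw [mob_self]; exact congrFun h0 i
  exact (mob_inj (hz i) (hw i).le (hz i).le h1).symm

lemma mobv_norm_comm {n : ℕ} (z w : Fin n → ℂ) : ‖mobv z w‖ = ‖mobv w z‖ := by
  simp only [Pi.norm_def]
  congr 2
  funext i
  ext
  exact mob_norm_comm _ _

lemma mobv_differentiableOn {n : ℕ} {z : Fin n → ℂ} (hz : z ∈ uPolydisc n) :
    DifferentiableOn ℂ (mobv z) (uPolydisc n) := by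
  rw [differentiableOn_pi]
  intro i x hx
  apply DifferentiableAt.differentiableWithinAt
  exact (mob_differentiableAt (hz i) (hx i).le).comp x (differentiableAt_apply i x)

/-- recentering a holomorphic function at `x`, `F x` -/
def recen {n : ℕ} (F : (Fin n → ℂ) → ℂ) (x : Fin n → ℂ) : (Fin n → ℂ) → ℂ :=
  fun y => mob (F x) (F (mobv x y))

lemma recen_schur {n : ℕ} {F : (Fin n → ℂ) → ℂ} (hF : Schur n F) {x : Fin n → ℂ}
    (hx : x ∈ uPolydisc n) (h1 : ‖F x‖ < 1) : Schur n (recen F x) := by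
  refine ⟨?_, fun y hy => mob_norm_le h1 (hF.2 _ (mobv_mem hx hy))⟩
  have h2 : DifferentiableOn ℂ (fun y => F (mobv x y)) (uPolydisc n) :=
    hF.1.comp (mobv_differentiableOn hx) (fun y hy => mobv_mem hx hy)
  intro y hy
  exact (mob_differentiableAt h1 (hF.2 _ (mobv_mem hx hy))).comp_differentiableWithinAt y (h2 y hy)

lemma mobv_zero_right {n : ℕ} (x : Fin n → ℂ) : mobv x 0 = x := by
  funext i; exact mob_zero_right _

lemma recen_zero {n : ℕ} (F : (Fin n → ℂ) → ℂ) (x : Fin n → ℂ) : recen F x 0 = 0 := by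
  simp [recen, mobv_zero_right, mob_self]

lemma recen_mobv {n : ℕ} (F : (Fin n → ℂ) → ℂ) {x y : Fin n → ℂ} (hx : x ∈ uPolydisc n)
    (hy : y ∈ uPolydisc n) : recen F x (mobv x y) = mob (F x) (F y) := by
  simp [recen, mobv_mobv hx hy]

lemma schwarz_poly {n : ℕ} {F : (Fin n → ℂ) → ℂ} (hF : Schur n F) (h0 : F 0 = 0)
    {x : Fin n → ℂ} (hx : x ∈ uPolydisc n) : ‖F x‖ ≤ ‖x‖ := by
  obtain ⟨h1, h2⟩ := hF
  rw [uPolydisc_eq_ball] at *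
  refine norm_le_norm_of_mapsTo_ball h1 (fun y hy => ?_) h0 (by simpa using hx)
  simpa using h2 y hy

lemma schwarz_pick {n : ℕ} {F : (Fin n → ℂ) → ℂ} (hF : Schur n F) {x y : Fin n → ℂ}
    (hx : x ∈ uPolydisc n) (hy : y ∈ uPolydisc n) (h1 : ‖F x‖ < 1) :
    ‖mob (F x) (F y)‖ ≤ ‖mobv x y‖ := by
  rw [← recen_mobv F hx hy]
  exact schwarz_poly (recen_schur hF hx h1) (recen_zero F x) (mobv_mem hx hy)

lemma poly_norm_lt {n : ℕ} {x : Fin n → ℂ} (hx : x ∈ uPolydisc n) : ‖x‖ < 1 := by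
  rw [uPolydisc_eq_ball] at hx; simpa using hx

/-- strict Schwarz-Pick for strictly bounded functions -/
lemma schwarz_pick_strict {n : ℕ} {F : (Fin n → ℂ) → ℂ} (hF : DifferentiableOn ℂ F (uPolydisc n))
    {r : ℝ} (hr : r < 1) (hb : ∀ x ∈ uPolydisc n, ‖F x‖ ≤ r) {x y : Fin n → ℂ}
    (hx : x ∈ uPolydisc n) (hy : y ∈ uPolydisc n) (hxy : x ≠ y) :
    ‖mob (F x) (F y)‖ < ‖mobv x y‖ := by
  have hS : Schur n F := ⟨hF, fun x hx => (hb x hx).trans hr.le⟩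
  have h1 : ‖F x‖ < 1 := (hb x hx).trans_lt hr
  obtain ⟨r', hr0, hr1, hr'⟩ := mob_norm_le_lt h1 hr
  have hpos : 0 < ‖mobv x y‖ := norm_pos_iff.2 (mobv_ne_zero hx hy hxy)
  obtain ⟨h2, h3⟩ := recen_schur hS hx h1
  have hm := mobv_mem hx hy
  have hb' : ∀ z ∈ uPolydisc n, ‖recen F x z‖ ≤ r' := fun z hz => hr' _ (hb _ (mobv_mem hx hz))
  rw [← recen_mobv F hx hy]
  rw [uPolydisc_eq_ball] at h2 hm hb'
  have := dist_le_div_mul_dist_of_mapsTo_ball (R₂ := r') h2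
    (fun z hz => by simpa [recen_zero] using hb' z hz) hm
  simp only [recen_zero, dist_zero_right, div_one] at this
  nlinarith

/-- characterization of extremal two-point problems -/
lemma extremal_two_iff {n : ℕ} {F : (Fin n → ℂ) → ℂ} (hF : Schur n F) {x y : Fin n → ℂ}
    (hx : x ∈ uPolydisc n) (hy : y ∈ uPolydisc n) (hxy : x ≠ y)
    (hFx : ‖F x‖ < 1) (hFy : ‖F y‖ < 1) :
    ExtremalPick n 2 ![x, y] ![F x, F y] ↔ ‖mob (F x) (F y)‖ = ‖mobv x y‖ := by
  constructor
  · rintro ⟨-, h⟩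
    by_contra hne
    have hlt := lt_of_le_of_ne (schwarz_pick hF hx hy hFx) hne
    apply h
    have hex : ∃ i, ‖mobv x y‖ = ‖mobv x y i‖ := by
      have hn : Nonempty (Fin n) := by
        by_contra hemp
        rw [not_nonempty_iff] at hemp
        exact hxy (Subsingleton.elim _ _)
      obtain ⟨i, -, hi⟩ := Finset.exists_mem_eq_sup' Finset.univ_nonempty
        (fun i => ‖mobv x y i‖)
      refine ⟨i, le_antisymm ((pi_norm_le_iff_of_nonneg (norm_nonneg _)).2 fun j => ?_)
        (norm_le_pi_norm _ i)⟩
      rw [← hi]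
      exact Finset.le_sup' (fun i => ‖mobv x y i‖) (Finset.mem_univ j)
    obtain ⟨i, hi⟩ := hex
    have hmne : mob (x i) (y i) ≠ 0 := by
      intro h0
      have : ‖mobv x y i‖ = 0 := by simp [mobv, h0]
      rw [hi, this] at hlt
      exact absurd (norm_nonneg _) (not_le.2 hlt)
    set k := mob (F x) (F y) / mob (x i) (y i) with hk
    have hk1 : ‖k‖ < 1 := by
      rw [hk, norm_div, div_lt_one (norm_pos_iff.2 hmne)]
      rw [hi] at hlt; exact hlt
    have hkb : ∀ u ∈ uPolydisc n, ‖k * mob (x i) (u i)‖ ≤ ‖k‖ := fun u hu => by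
      rw [norm_mul]
      exact mul_le_of_le_one_right (norm_nonneg _) (mob_norm_le (hx i) (hu i).le)
    obtain ⟨r', _, hr1, hr'⟩ := mob_norm_le_lt hFx hk1
    refine ⟨fun u => mob (F x) (k * mob (x i) (u i)), ?_, ⟨r', hr1, fun u hu => hr' _ (hkb u hu)⟩,
      ?_⟩
    · intro u hu
      have hd0 : DifferentiableWithinAt ℂ (fun u : Fin n → ℂ => mob (x i) (u i)) (uPolydisc n) u :=
        (differentiableOn_pi.1 (mobv_differentiableOn hx)) i u hu
      exact (mob_differentiableAt hFx ((hkb u hu).trans hk1.le)).comp_differentiableWithinAt u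
        (hd0.const_mul k)
    · intro j
      fin_cases j
      · simp [mob_self, mob_zero_right]
      · have : k * mob (x i) (y i) = mob (F x) (F y) := by
          rw [hk]; field_simp
        simp [this, mob_mob hFx hFy.le]
  · intro h
    refine ⟨⟨F, hF.1, hF.2, fun j => by fin_cases j <;> rfl⟩, ?_⟩
    rintro ⟨G, hG, ⟨r, hr, hb⟩, hv⟩
    have h0 : G x = F x := hv 0
    have h1 : G y = F y := hv 1
    have := schwarz_pick_strict hG hr hb hx hy hxy
    rw [h0, h1, h] at this
    exact lt_irrefl _ this

/-! ### A Montel-type compactness lemma along ultrafilters -/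

lemma ball_subset_poly {n : ℕ} {x : Fin n → ℂ} : ball x (1 - ‖x‖) ⊆ uPolydisc n := by
  rw [uPolydisc_eq_ball]
  apply ball_subset_ball'
  simp

lemma schur_lip {n : ℕ} {F : (Fin n → ℂ) → ℂ} (hF : Schur n F) {x y : Fin n → ℂ}
    (hx : x ∈ uPolydisc n) (hy : y ∈ ball x (1 - ‖x‖)) :
    ‖F y - F x‖ ≤ 2 / (1 - ‖x‖) * ‖y - x‖ := by
  have := dist_le_div_mul_dist_of_mapsTo_ball (R₂ := 2) (hF.1.mono ball_subset_poly)
    (fun z hz => by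
      rw [mem_closedBall, dist_eq_norm]
      have := norm_sub_le (F z) (F x)
      have h1 := hF.2 z (ball_subset_poly hz)
      have h2 := hF.2 x hx
      linarith) hy
  simpa [dist_eq_norm] using this

lemma schur_fderiv {n : ℕ} {F : (Fin n → ℂ) → ℂ} (hF : Schur n F) {x : Fin n → ℂ}
    (hx : x ∈ uPolydisc n) : ‖fderiv ℂ F x‖ ≤ 2 / (1 - ‖x‖) := by
  have hR : 0 < 1 - ‖x‖ := by linarith [poly_norm_lt hx]
  exact norm_fderiv_le_div_of_mapsTo_ball (R₂ := 2) (hF.1.mono ball_subset_poly)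
    (fun z hz => by
      rw [mem_closedBall, dist_eq_norm]
      have := norm_sub_le (F z) (F x)
      have h1 := hF.2 z (ball_subset_poly hz)
      have h2 := hF.2 x hx
      linarith) hR

lemma isOpen_uPolydisc (n : ℕ) : IsOpen (uPolydisc n) := by
  rw [uPolydisc_eq_ball]; exact isOpen_ball

lemma schur_second {n : ℕ} {F : (Fin n → ℂ) → ℂ} (hF : Schur n F) {x y : Fin n → ℂ}
    (hx : x ∈ uPolydisc n) (hy : y ∈ ball x (1 - ‖x‖)) :
    ‖F y - F x - fderiv ℂ F x (y - x)‖ ≤ 4 * (‖y - x‖ / (1 - ‖x‖)) ^ 2 := by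
  have hR : 0 < 1 - ‖x‖ := by linarith [poly_norm_lt hx]
  have hd : HasFDerivAt F (fderiv ℂ F x) x :=
    (hF.1.differentiableAt ((isOpen_uPolydisc n).mem_nhds hx)).hasFDerivAt
  have h := dist_le_mul_div_pow_of_mapsTo_ball_of_isLittleO (n := 1) (R₂ := 4)
    (f := fun y => F y - fderiv ℂ F x (y - x)) (c := x) (R₁ := 1 - ‖x‖) (z := y)
    ((hF.1.mono ball_subset_poly).sub (by fun_prop))
    (fun z hz => by
      rw [mem_closedBall, dist_eq_norm]
      have h1 := hF.2 z (ball_subset_poly hz)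
      have h2 := hF.2 x hx
      have h3 : ‖fderiv ℂ F x (z - x)‖ ≤ 2 := by
        refine (ContinuousLinearMap.le_of_opNorm_le _ (schur_fderiv hF hx) _).trans ?_
        rw [mem_ball, dist_eq_norm] at hz
        calc 2 / (1 - ‖x‖) * ‖z - x‖ ≤ 2 / (1 - ‖x‖) * (1 - ‖x‖) := by gcongr
          _ = 2 := by field_simp
      have h4 := norm_sub_le (F z - fderiv ℂ F x (z - x)) (F x)
      have h5 := norm_sub_le (F z) (fderiv ℂ F x (z - x))
      simp only [sub_self, map_zero, sub_zero]
      linarith)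
    (by
      have := hd.isLittleO
      simp only [sub_self, map_zero, sub_zero, pow_one]
      refine (this.norm_right).congr_left fun z => ?_
      simp; ring) hy
  simp only [sub_self, map_zero, sub_zero, dist_eq_norm] at h
  have he : F y - F x - fderiv ℂ F x (y - x) = F y - fderiv ℂ F x (y - x) - F x := by ring
  rw [he]
  exact h

lemma montel {n : ℕ} {ι : Type*} (u : Ultrafilter ι) (F : ι → (Fin n → ℂ) → ℂ)
    (hF : ∀ i, Schur n (F i)) :
    ∃ G, Schur n G ∧ ∀ (x : ι → Fin n → ℂ) (x0 : Fin n → ℂ), x0 ∈ uPolydisc n →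
      Tendsto x u (𝓝 x0) → Tendsto (fun i => F i (x i)) u (𝓝 (G x0)) := by
  have hpt : ∀ x : Fin n → ℂ, ∃ g : ℂ, x ∈ uPolydisc n →
      ‖g‖ ≤ 1 ∧ Tendsto (fun i => F i x) u (𝓝 g) := by
    intro x
    by_cases hx : x ∈ uPolydisc n
    · obtain ⟨g, hg, hg'⟩ := (isCompact_closedBall (0 : ℂ) 1).ultrafilter_le_nhds
        (u.map (fun i => F i x)) (by
          rw [Ultrafilter.coe_map, le_principal_iff, mem_map]
          exact univ_mem' fun i => by simpa using (hF i).2 x hx)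
      exact ⟨g, fun _ => ⟨by simpa using hg, by simpa [Tendsto] using hg'⟩⟩
    · exact ⟨0, fun h => absurd h hx⟩
  choose G hG using hpt
  refine ⟨G, ⟨?_, fun x hx => (hG x hx).1⟩, ?_⟩
  · intro x hx
    have hR : 0 < 1 - ‖x‖ := by linarith [poly_norm_lt hx]
    have : ProperSpace ((Fin n → ℂ) →L[ℂ] ℂ) := FiniteDimensional.proper_rclike ℂ _
    obtain ⟨L, hL, hL'⟩ := (isCompact_closedBall (0 : (Fin n → ℂ) →L[ℂ] ℂ)
      (2 / (1 - ‖x‖))).ultrafilter_le_nhds (u.map (fun i => fderiv ℂ (F i) x)) (by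
          rw [Ultrafilter.coe_map, le_principal_iff, mem_map]
          exact univ_mem' fun i => by simpa using schur_fderiv (hF i) hx)
    have hL' : Tendsto (fun i => fderiv ℂ (F i) x) u (𝓝 L) := by simpa [Tendsto] using hL'
    apply DifferentiableAt.differentiableWithinAt
    refine HasFDerivAt.differentiableAt (f' := L) (HasFDerivAt.of_isLittleO ?_)
    have key : ∀ y ∈ ball x (1 - ‖x‖),
        ‖G y - G x - L (y - x)‖ ≤ 4 * (‖y - x‖ / (1 - ‖x‖)) ^ 2 := by
      intro y hy
      have h1 : Tendsto (fun i => ‖F i y - F i x - fderiv ℂ (F i) x (y - x)‖) u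
          (𝓝 ‖G y - G x - L (y - x)‖) := by
        refine (((hG y (ball_subset_poly hy)).2.sub (hG x hx).2).sub ?_).norm
        exact ((ContinuousLinearMap.apply ℂ ℂ (y - x)).continuous.tendsto L).comp hL'
      exact le_of_tendsto h1 (Eventually.of_forall fun i => schur_second (hF i) hx hy)
    rw [Asymptotics.isLittleO_iff]
    intro c hc
    set δ := min (1 - ‖x‖) (c * (1 - ‖x‖) ^ 2 / 4) with hδ
    have hδ0 : 0 < δ := by positivity
    filter_upwards [ball_mem_nhds x hδ0] with y hy
    have hy1 : y ∈ ball x (1 - ‖x‖) := ball_subset_ball (min_le_left _ _) hy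
    refine (key y hy1).trans ?_
    rw [mem_ball, dist_eq_norm] at hy
    have hy2 : ‖y - x‖ ≤ c * (1 - ‖x‖) ^ 2 / 4 := hy.le.trans (min_le_right _ _)
    rw [div_pow]
    rw [← mul_div_assoc, div_le_iff₀ (by positivity)]
    nlinarith [norm_nonneg (y - x)]
  · intro x x0 hx0 hx
    have hR : 0 < 1 - ‖x0‖ := by linarith [poly_norm_lt hx0]
    have h1 : Tendsto (fun i => F i (x i) - F i x0) u (𝓝 0) := by
      refine squeeze_zero_norm' (a := fun i => 2 / (1 - ‖x0‖) * ‖x i - x0‖) ?_ ?_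
      · filter_upwards [hx (ball_mem_nhds x0 hR)] with i hi
        exact schur_lip (hF i) hx0 hi
      · have : Tendsto (fun i => x i - x0) u (𝓝 0) := by
          simpa using hx.sub_const x0
        simpa using this.norm.const_mul (2 / (1 - ‖x0‖))
    simpa using h1.add (hG x0 hx0).2

/-! ### Rigidity -/

lemma slice_schwarz {n : ℕ} {H : (Fin n → ℂ) → ℂ} (hH : Schur n H) (h0 : H 0 = 0)
    {ζ : Fin n → ℂ} (hζ : ζ ∈ uPolydisc n) (hζ0 : ζ ≠ 0) (he : ‖H ζ‖ = ‖ζ‖) :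
    ∀ s : ℂ, ‖s‖ * ‖ζ‖ < 1 → H (s • ζ) = s * H ζ := by
  have hp : 0 < ‖ζ‖ := norm_pos_iff.2 hζ0
  have hmem : ∀ s ∈ ball (0 : ℂ) (1 / ‖ζ‖), s • ζ ∈ uPolydisc n := by
    intro s hs
    rw [uPolydisc_eq_ball]
    simp only [mem_ball, dist_zero_right] at hs ⊢
    rw [norm_smul]
    rwa [lt_div_iff₀ hp] at hs
  have hd : DifferentiableOn ℂ (fun s : ℂ => H (s • ζ)) (ball 0 (1 / ‖ζ‖)) :=
    hH.1.comp (by fun_prop) hmem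
  have h1 : (1 : ℂ) ∈ ball (0 : ℂ) (1 / ‖ζ‖) := by
    simp only [mem_ball, dist_zero_right, norm_one]
    rw [lt_div_iff₀ hp, one_mul]; exact poly_norm_lt hζ
  have hds : dslope (fun s : ℂ => H (s • ζ)) 0 1 = H ζ := by
    rw [dslope_of_ne _ one_ne_zero]
    simp [slope, h0]
  have := affine_of_mapsTo_ball_of_norm_dslope_eq_div (R₂ := 1) (c := 0) (z₀ := 1) hd
    (fun s hs => by simpa [h0] using hH.2 _ (hmem s hs)) h1 (by rw [hds, he]; simp)
  intro s hs
  have h2 := this (show s ∈ ball (0 : ℂ) (1 / ‖ζ‖) by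
    simp only [mem_ball, dist_zero_right]; rwa [lt_div_iff₀ hp])
  simp only [hds] at h2
  simpa [h0] using h2

lemma exists_coord_norm_eq {n : ℕ} {x : Fin n → ℂ} (hx : x ≠ 0) : ∃ i, ‖x i‖ = ‖x‖ := by
  have hn : Nonempty (Fin n) := by
    by_contra hemp
    rw [not_nonempty_iff] at hemp
    exact hx (Subsingleton.elim _ _)
  obtain ⟨i, -, hi⟩ := Finset.exists_mem_eq_sup' Finset.univ_nonempty (fun i => ‖x i‖)
  refine ⟨i, le_antisymm (norm_le_pi_norm _ i)
    ((pi_norm_le_iff_of_nonneg (norm_nonneg _)).2 fun j => ?_)⟩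
  rw [← hi]
  exact Finset.le_sup' (fun i => ‖x i‖) (Finset.mem_univ j)

lemma fderiv_slice {n : ℕ} {H : (Fin n → ℂ) → ℂ} (hH : Schur n H) (h0 : H 0 = 0)
    {ζ : Fin n → ℂ} (hζ : ζ ∈ uPolydisc n) (hζ0 : ζ ≠ 0) (he : ‖H ζ‖ = ‖ζ‖) :
    fderiv ℂ H 0 ζ = H ζ := by
  have hd : HasFDerivAt H (fderiv ℂ H 0) ((0 : ℂ) • ζ) := by
    rw [zero_smul]
    exact (hH.1.differentiableAt
      ((isOpen_uPolydisc n).mem_nhds (zero_mem_uPolydisc n))).hasFDerivAt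
  have h1 : HasDerivAt (fun s : ℂ => H (s • ζ)) (fderiv ℂ H 0 ζ) 0 := by
    have h2 : HasDerivAt (fun s : ℂ => s • ζ) ζ 0 := by
      simpa using (hasDerivAt_id (0 : ℂ)).smul_const ζ
    exact hd.comp_hasDerivAt 0 h2
  have h2 : HasDerivAt (fun s : ℂ => s * H ζ) (H ζ) 0 := by
    simpa using (hasDerivAt_id (0 : ℂ)).mul_const (H ζ)
  have hp : 0 < ‖ζ‖ := norm_pos_iff.2 hζ0
  have h3 : (fun s : ℂ => H (s • ζ)) =ᶠ[𝓝 0] fun s => s * H ζ := by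
    filter_upwards [ball_mem_nhds (0 : ℂ) (show 0 < 1 / ‖ζ‖ by positivity)] with s hs
    apply slice_schwarz hH h0 hζ hζ0 he
    simp only [mem_ball, dist_zero_right] at hs
    rwa [lt_div_iff₀ hp] at hs
  exact h1.unique (h2.congr_of_eventuallyEq h3)

lemma core_inter {n : ℕ} {H : (Fin n → ℂ) → ℂ} (hH : Schur n H) (h0 : H 0 = 0)
    {ζ ω : Fin n → ℂ} (hζ : ζ ∈ uPolydisc n) (hζ0 : ζ ≠ 0) (he : ‖H ζ‖ = ‖ζ‖)
    (hω : ω ∈ uPolydisc n) (hω0 : ω ≠ 0) (he' : ‖H ω‖ = ‖ω‖) :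
    ∃ i, ∃ κ : ℂ, ‖κ‖ = 1 ∧ H ζ = κ * ζ i ∧ H ω = κ * ω i := by
  have d1 := fderiv_slice hH h0 hζ hζ0 he
  have d2 := fderiv_slice hH h0 hω hω0 he'
  have hp : 0 < ‖ζ‖ := norm_pos_iff.2 hζ0
  have hp' : 0 < ‖ω‖ := norm_pos_iff.2 hω0
  have hu : H ζ ≠ 0 := by rw [← norm_pos_iff, he]; exact hp
  have hv : H ω ≠ 0 := by rw [← norm_pos_iff, he']; exact hp'
  set x : Fin n → ℂ := (H ζ)⁻¹ • ζ + (H ω)⁻¹ • ω with hx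
  have hL : fderiv ℂ H 0 x = 2 := by
    rw [hx, map_add, map_smul, map_smul, d1, d2]
    simp only [smul_eq_mul, inv_mul_cancel₀ hu, inv_mul_cancel₀ hv]; norm_num
  have hL1 : ‖fderiv ℂ H 0‖ ≤ 1 := by
    obtain ⟨a, b⟩ := hH
    rw [uPolydisc_eq_ball] at a b
    exact norm_fderiv_le_one_of_mapsTo_ball a (fun z hz => by simpa [h0] using b z hz) one_pos
  have hx2 : 2 ≤ ‖x‖ := by
    have := ContinuousLinearMap.le_of_opNorm_le _ hL1 x
    rw [hL] at this
    simpa using this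
  have hxne : x ≠ 0 := by rintro h; rw [h] at hx2; norm_num at hx2
  obtain ⟨i, hi⟩ := exists_coord_norm_eq hxne
  have ha : ‖(H ζ)⁻¹ * ζ i‖ ≤ 1 := by
    rw [norm_mul, norm_inv, he, inv_mul_le_one₀ hp]; exact norm_le_pi_norm ζ i
  have hb : ‖(H ω)⁻¹ * ω i‖ ≤ 1 := by
    rw [norm_mul, norm_inv, he', inv_mul_le_one₀ hp']; exact norm_le_pi_norm ω i
  have hs : 2 ≤ ‖(H ζ)⁻¹ * ζ i + (H ω)⁻¹ * ω i‖ := by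
    have : x i = (H ζ)⁻¹ * ζ i + (H ω)⁻¹ * ω i := by simp [hx]
    rw [← this, hi]; exact hx2
  generalize hA : (H ζ)⁻¹ * ζ i = A at *
  generalize hB : (H ω)⁻¹ * ω i = B at *
  have hpar := parallelogram_law_with_norm ℝ A B
  have hAB : A = B := by
    rw [← sub_eq_zero, ← norm_eq_zero]
    nlinarith [norm_nonneg A, norm_nonneg B, norm_nonneg (A - B), norm_nonneg (A + B)]
  have hA1 : ‖A‖ = 1 := by
    have := norm_add_le A B
    linarith
  have hA0 : A ≠ 0 := by rw [← norm_ne_zero_iff, hA1]; exact one_ne_zero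
  refine ⟨i, A⁻¹, by rw [norm_inv, hA1, inv_one], ?_, ?_⟩
  · rw [eq_inv_mul_iff_mul_eq₀ hA0, ← hA]; field_simp
  · rw [eq_inv_mul_iff_mul_eq₀ hA0, hAB, ← hB]; field_simp

lemma core_strict {n : ℕ} {H : (Fin n → ℂ) → ℂ} (hH : Schur n H) (h0 : H 0 = 0)
    {ζ ω : Fin n → ℂ} (hζ : ζ ∈ uPolydisc n) (hζ0 : ζ ≠ 0) (he : ‖H ζ‖ = ‖ζ‖)
    (hω : ω ∈ uPolydisc n) {i : Fin n} (hi : ∀ j, j ≠ i → ‖ζ j‖ < ‖ζ i‖) (hωi : ω i ≠ 0) :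
    ∃ κ : ℂ, ‖κ‖ = 1 ∧ H ζ = κ * ζ i ∧ H ω = κ * ω i := by
  have hp : 0 < ‖ζ‖ := norm_pos_iff.2 hζ0
  have hni : ‖ζ i‖ = ‖ζ‖ := by
    obtain ⟨j, hj⟩ := exists_coord_norm_eq hζ0
    by_cases hji : j = i
    · rw [← hji, hj]
    · exact absurd (norm_le_pi_norm ζ i) (not_le.2 (hj ▸ hi j hji))
  have hzi : ζ i ≠ 0 := by rw [← norm_pos_iff, hni]; exact hp
  set c := H ζ / ζ i with hc
  have hc1 : ‖c‖ = 1 := by rw [hc, norm_div, he, hni, div_self hp.ne']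
  set p : Fin n → ℂ := (ω i / ζ i) • ζ with hpdef
  have hpi : p i = ω i := by simp [hpdef, div_mul_cancel₀ _ hzi]
  have hpn : ‖p‖ = ‖ω i‖ := by
    rw [hpdef, norm_smul, norm_div, hni, div_mul_cancel₀ _ hp.ne']
  have hpP : p ∈ uPolydisc n := by
    rw [uPolydisc_eq_ball]; simpa [hpn] using hω i
  have hHp : H p = c * ω i := by
    rw [hpdef, slice_schwarz hH h0 hζ hζ0 he]
    · rw [hc]; ring
    · rw [norm_div, hni, div_mul_cancel₀ _ hp.ne']; exact hω i
  have hpj : ∀ j, j ≠ i → ‖p j‖ < ‖ω i‖ := by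
    intro j hj
    have : ‖p j‖ = ‖ω i‖ / ‖ζ i‖ * ‖ζ j‖ := by simp [hpdef]
    rw [this, div_mul_eq_mul_div, div_lt_iff₀ (norm_pos_iff.2 hzi)]
    exact mul_lt_mul_of_pos_left (hi j hj) (norm_pos_iff.2 hωi)
  -- the affine complex line through `p` and `ω`
  set ℓ : ℂ → Fin n → ℂ := fun s => p + s • (ω - p) with hℓ
  have hℓc : Continuous ℓ := by fun_prop
  have hℓd : Differentiable ℂ ℓ := by fun_prop
  have hℓi : ∀ s, ℓ s i = ω i := fun s => by simp [hℓ, hpi]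
  set U : Set ℂ := ℓ ⁻¹' (uPolydisc n) with hU
  have hUo : IsOpen U := (isOpen_uPolydisc n).preimage hℓc
  have hUconv : Convex ℝ U := by
    intro s hs t ht a b ha hb hab
    have hcv : Convex ℝ (uPolydisc n) := by rw [uPolydisc_eq_ball]; exact convex_ball _ _
    have := hcv hs ht ha hb hab
    have he : ℓ (a • s + b • t) = a • ℓ s + b • ℓ t := by
      funext j
      have hab' : (a : ℂ) + b = 1 := by exact_mod_cast hab
      simp only [hℓ, Pi.add_apply, Pi.smul_apply, smul_eq_mul, real_smul, Pi.sub_apply]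
      linear_combination (-p j) * hab'
    rw [hU, mem_preimage, he]; exact this
  have h0U : (0 : ℂ) ∈ U := by simpa [hU, hℓ] using hpP
  have h1U : (1 : ℂ) ∈ U := by simpa [hU, hℓ] using hω
  have hd : DifferentiableOn ℂ (fun s => H (ℓ s)) U :=
    hH.1.comp hℓd.differentiableOn (fun s hs => hs)
  have hev : ∀ᶠ s in 𝓝 (0 : ℂ), ‖ℓ s‖ ≤ ‖ω i‖ := by
    have : ∀ᶠ s in 𝓝 (0 : ℂ), ∀ j, ‖ℓ s j‖ ≤ ‖ω i‖ := by
      rw [eventually_all]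
      intro j
      by_cases hj : j = i
      · exact Eventually.of_forall fun s => by rw [hj, hℓi]
      · have hcj : Continuous fun s => ‖ℓ s j‖ := by fun_prop
        have : ‖ℓ 0 j‖ < ‖ω i‖ := by simpa [hℓ] using hpj j hj
        exact (hcj.continuousAt.eventually_lt continuousAt_const this).mono fun s hs => hs.le
    exact this.mono fun s hs => (pi_norm_le_iff_of_nonneg (norm_nonneg _)).2 hs
  have hH0 : H (ℓ 0) = c * ω i := by simpa [hℓ] using hHp
  have hmax : IsLocalMax (norm ∘ fun s => H (ℓ s)) 0 := by
    filter_upwards [hev, hUo.mem_nhds h0U] with s hs hsU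
    simp only [Function.comp, hH0, norm_mul, hc1, one_mul]
    exact (schwarz_poly hH h0 hsU).trans hs
  have hconst := eventually_eq_of_isLocalMax_norm
    ((hUo.eventually_mem h0U).mono fun s hs => hd.differentiableAt (hUo.mem_nhds hs)) hmax
  have := (hd.analyticOnNhd hUo).eqOn_of_preconnected_of_eventuallyEq
    (analyticOnNhd_const (v := H (ℓ 0))) hUconv.isPreconnected h0U hconst h1U
  refine ⟨c, hc1, by rw [hc, div_mul_cancel₀ _ hzi], ?_⟩
  have h1 : ℓ 1 = ω := by simp [hℓ]
  simp only [h1, hH0] at this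
  exact this

/-! ### The degenerate locus -/

def nd {n : ℕ} (p : (Fin n → ℂ) × (Fin n → ℂ)) : Fin 3 → Fin n → ℂ := ![0, p.1, p.2]
def lo : Fin 3 → Fin 3 := ![1, 0, 0]
def hi : Fin 3 → Fin 3 := ![2, 2, 1]

/-- the subproblem with nodes `a`, `b` is extremal for the values of `F` -/
def ExtAt {n : ℕ} (F : (Fin n → ℂ) → ℂ) (p : (Fin n → ℂ) × (Fin n → ℂ)) (a b : Fin 3) : Prop :=
  ‖mob (F (nd p a)) (F (nd p b))‖ = ‖mobv (nd p a) (nd p b)‖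

def Dg (n : ℕ) (k : Fin 3) (p : (Fin n → ℂ) × (Fin n → ℂ)) (v : Fin 2 → ℂ) : Prop :=
  ∃ F, Schur n F ∧ F 0 = 0 ∧ F p.1 * v 1 = F p.2 * v 0 ∧ ExtAt F p (lo k) (hi k)

lemma ExtAt.symm {n : ℕ} {F : (Fin n → ℂ) → ℂ} {p : (Fin n → ℂ) × (Fin n → ℂ)} {a b : Fin 3}
    (h : ExtAt F p a b) : ExtAt F p b a := by
  unfold ExtAt at *
  rw [mob_norm_comm, mobv_norm_comm, h]

lemma lo_hi_of_ne : ∀ a b : Fin 3, a ≠ b → ∃ k, (lo k = a ∧ hi k = b) ∨ (lo k = b ∧ hi k = a) := by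
  decide

lemma lo_hi_of_distinct : ∀ k l m : Fin 3, k ≠ l → k ≠ m → l ≠ m →
    (lo k = m ∧ hi k = l) ∨ (lo k = l ∧ hi k = m) := by
  decide

lemma exists_third : ∀ k l : Fin 3, k ≠ l → ∃ m, k ≠ m ∧ l ≠ m := by decide

lemma exists_other : ∀ k : Fin 3, ∃ l, k ≠ l := by decide

lemma eq_of_distinct : ∀ k l m : Fin 3, k ≠ l → k ≠ m → l ≠ m →
    ∀ j, j = k ∨ j = l ∨ j = m := by decide

lemma ExtAt.third {n : ℕ} {F : (Fin n → ℂ) → ℂ} {p : (Fin n → ℂ) × (Fin n → ℂ)} {k l m : Fin 3}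
    (h : ExtAt F p (lo k) (hi k)) (h1 : k ≠ l) (h2 : k ≠ m) (h3 : l ≠ m) : ExtAt F p m l := by
  rcases lo_hi_of_distinct k l m h1 h2 h3 with ⟨a, b⟩ | ⟨a, b⟩
  · rwa [a, b] at h
  · rw [a, b] at h; exact h.symm

lemma nd_mem {n : ℕ} {p : (Fin n → ℂ) × (Fin n → ℂ)} (hp : p ∈ Dset n) (j : Fin 3) :
    nd p j ∈ uPolydisc n := by
  fin_cases j
  · exact zero_mem_uPolydisc n
  · exact hp.1
  · exact hp.2.1

lemma nd_ne {n : ℕ} {p : (Fin n → ℂ) × (Fin n → ℂ)} (hp : p ∈ Dset n) {a b : Fin 3}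
    (hab : a ≠ b) : nd p a ≠ nd p b := by
  obtain ⟨_, _, h1, h2, h3⟩ := hp
  fin_cases a <;> fin_cases b <;> simp_all [nd, eq_comm]

lemma Schur.lt_one {n : ℕ} {F : (Fin n → ℂ) → ℂ} (hF : Schur n F) (h0 : F 0 = 0)
    {x : Fin n → ℂ} (hx : x ∈ uPolydisc n) : ‖F x‖ < 1 :=
  (schwarz_poly hF h0 hx).trans_lt (poly_norm_lt hx)

lemma ExtAt.vals_ne {n : ℕ} {F : (Fin n → ℂ) → ℂ} {p : (Fin n → ℂ) × (Fin n → ℂ)}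
    (hp : p ∈ Dset n) (h0 : F 0 = 0) {a b : Fin 3} (hab : a ≠ b)
    (h : ExtAt F p a b) : F p.1 ≠ 0 ∨ F p.2 ≠ 0 := by
  by_contra hc
  push Not at hc
  have hz : ∀ j, F (nd p j) = 0 := by
    intro j
    fin_cases j
    · exact h0
    · exact hc.1
    · exact hc.2
  unfold ExtAt at h
  rw [hz, hz, mob_self, norm_zero] at h
  exact mobv_ne_zero (nd_mem hp a) (nd_mem hp b) (nd_ne hp hab) (norm_eq_zero.1 h.symm)

lemma parallel {a b c d : ℂ} (h : a ≠ 0 ∨ b ≠ 0) (he : a * d = b * c) :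
    ∃ s : ℂ, c = s * a ∧ d = s * b := by
  rcases h with h | h
  · refine ⟨c / a, by field_simp, ?_⟩
    field_simp; linear_combination he
  · refine ⟨d / b, ?_, by field_simp⟩
    field_simp; linear_combination -he

lemma lo_ne_hi : ∀ k, lo k ≠ hi k := by decide

lemma scale_le {n : ℕ} {F F' : (Fin n → ℂ) → ℂ} (hF' : Schur n F') {x y : Fin n → ℂ}
    (hx : x ∈ uPolydisc n) (hy : y ∈ uPolydisc n) (hxy : x ≠ y)
    (he : ‖mob (F x) (F y)‖ = ‖mobv x y‖) {s : ℂ} (h1 : F' x = s * F x) (h2 : F' y = s * F y) :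
    ‖s‖ ≤ 1 := by
  by_contra hs
  push Not at hs
  have hs0 : s ≠ 0 := by rw [← norm_pos_iff]; linarith
  have := schwarz_pick_strict (F := fun z => s⁻¹ * F' z) (r := ‖s‖⁻¹) (hF'.1.const_mul s⁻¹)
    (inv_lt_one_of_one_lt₀ hs) (fun z hz => by
      rw [norm_mul, norm_inv]
      exact mul_le_of_le_one_right (by positivity) (hF'.2 z hz)) hx hy hxy
  simp only [h1, h2, inv_mul_cancel_left₀ hs0, he] at this
  exact lt_irrefl _ this

lemma mob_alg_aux {a a' ζ ζ' κ : ℂ} (hκ : ‖κ‖ = 1) (ha : ‖a‖ < 1) (ha' : ‖a'‖ < 1)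
    (hζ' : ‖ζ'‖ < 1) (h : a = κ * ζ) (h' : mob a a' = κ * mob ζ ζ') : a' = κ * ζ' := by
  rw [← mob_rot hκ, ← h] at h'
  exact mob_inj ha ha'.le (by rw [norm_mul, hκ, one_mul]; exact hζ'.le) h'

lemma mob_alg {a ζ : Fin 3 → ℂ} (ha : ∀ j, ‖a j‖ < 1) (hζ : ∀ j, ‖ζ j‖ < 1) (ha0 : a 0 = 0)
    (hζ0 : ζ 0 = 0) {k l m : Fin 3} (hkl : k ≠ l) (hkm : k ≠ m) (hlm : l ≠ m) {κ : ℂ}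
    (hκ : ‖κ‖ = 1) (h1 : mob (a m) (a k) = κ * mob (ζ m) (ζ k))
    (h2 : mob (a m) (a l) = κ * mob (ζ m) (ζ l)) : ∀ j, a j = κ * ζ j := by
  have hm : a m = κ * ζ m := by
    rcases eq_of_distinct k l m hkl hkm hlm 0 with h | h | h
    · rw [← h, ha0, hζ0, mob_zero_right, mob_zero_right] at h1; exact h1
    · rw [← h, ha0, hζ0, mob_zero_right, mob_zero_right] at h2; exact h2
    · rw [← h, ha0, hζ0, mul_zero]
  intro j
  rcases eq_of_distinct k l m hkl hkm hlm j with rfl | rfl | rfl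
  · exact mob_alg_aux hκ (ha m) (ha _) (hζ _) hm h1
  · exact mob_alg_aux hκ (ha m) (ha _) (hζ _) hm h2
  · exact hm

/-- the line through `(z_i, w_i)` -/
def Ln {n : ℕ} (p : (Fin n → ℂ) × (Fin n → ℂ)) (i : Fin n) : Submodule ℂ (Fin 2 → ℂ) :=
  Submodule.span ℂ {![p.1 i, p.2 i]}

lemma mem_Ln_of {n : ℕ} {p : (Fin n → ℂ) × (Fin n → ℂ)} {F : (Fin n → ℂ) → ℂ} {v : Fin 2 → ℂ}
    (hv : F p.1 * v 1 = F p.2 * v 0) (hne : F p.1 ≠ 0 ∨ F p.2 ≠ 0) {i : Fin n} {κ : ℂ}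
    (h : ∀ j, F (nd p j) = κ * nd p j i) : v ∈ Ln p i := by
  obtain ⟨s, h0, h1⟩ := parallel hne hv
  have e1 : F p.1 = κ * p.1 i := h 1
  have e2 : F p.2 = κ * p.2 i := h 2
  unfold Ln
  rw [Submodule.mem_span_singleton]
  refine ⟨s * κ, ?_⟩
  ext j
  fin_cases j
  · simp [h0, e1, mul_assoc]
  · simp [h1, e2, mul_assoc]

lemma Dg_inter {n : ℕ} {p : (Fin n → ℂ) × (Fin n → ℂ)} (hp : p ∈ Dset n) {v : Fin 2 → ℂ}
    (hv : v ≠ 0) {k l : Fin 3} (hkl : k ≠ l) (hk : Dg n k p v) (hl : Dg n l p v) :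
    ∃ i, v ∈ Ln p i := by
  obtain ⟨F, hF, hF0, hFv, hFE⟩ := hk
  obtain ⟨G, hG, hG0, hGv, hGE⟩ := hl
  have hFne := hFE.vals_ne hp hF0 (lo_ne_hi k)
  have hGne := hGE.vals_ne hp hG0 (lo_ne_hi l)
  obtain ⟨s, hs0, hs1⟩ := parallel hFne hFv
  obtain ⟨t, ht0, ht1⟩ := parallel hGne hGv
  have hs : s ≠ 0 := by
    rintro rfl
    apply hv; ext j; fin_cases j
    · simpa using hs0
    · simpa using hs1
  have ht : t ≠ 0 := by
    rintro rfl
    apply hv; ext j; fin_cases j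
    · simpa using ht0
    · simpa using ht1
  have hGF : ∀ j, G (nd p j) = (s / t) * F (nd p j) := by
    intro j
    fin_cases j
    · simp [nd, hG0, hF0]
    · have : t * G p.1 = s * F p.1 := by rw [← ht0, ← hs0]
      change G p.1 = s / t * F p.1
      field_simp; linear_combination this
    · have : t * G p.2 = s * F p.2 := by rw [← ht1, ← hs1]
      change G p.2 = s / t * F p.2
      field_simp; linear_combination this
  have hFG : ∀ j, F (nd p j) = (t / s) * G (nd p j) := by
    intro j; rw [hGF]; field_simp
  have n1 : ‖s / t‖ ≤ 1 := scale_le hG (nd_mem hp _) (nd_mem hp _) (nd_ne hp (lo_ne_hi k)) hFE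
    (hGF _) (hGF _)
  have n2 : ‖t / s‖ ≤ 1 := scale_le hF (nd_mem hp _) (nd_mem hp _) (nd_ne hp (lo_ne_hi l)) hGE
    (hFG _) (hFG _)
  have n3 : ‖t / s‖ = 1 := by
    apply le_antisymm n2
    have : ‖s / t‖ * ‖t / s‖ = 1 := by rw [← norm_mul]; field_simp; simp
    nlinarith [norm_nonneg (t / s), norm_nonneg (s / t)]
  have hFE' : ExtAt F p (lo l) (hi l) := by
    unfold ExtAt at *
    rw [hFG, hFG (hi l), mob_rot n3, norm_mul, n3, one_mul, hGE]
  obtain ⟨m, hkm, hlm⟩ := exists_third k l hkl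
  have E1 := hFE.third hkl hkm hlm
  have E2 := hFE'.third hkl.symm hlm hkm
  have hm1 := hF.lt_one hF0 (nd_mem hp m)
  obtain ⟨i, κ, hκ, c1, c2⟩ := core_inter (recen_schur hF (nd_mem hp m) hm1) (recen_zero _ _)
    (mobv_mem (nd_mem hp m) (nd_mem hp k))
    (mobv_ne_zero (nd_mem hp m) (nd_mem hp k) (nd_ne hp hkm.symm))
    (by rw [recen_mobv _ (nd_mem hp m) (nd_mem hp k)]; exact E2)
    (mobv_mem (nd_mem hp m) (nd_mem hp l))
    (mobv_ne_zero (nd_mem hp m) (nd_mem hp l) (nd_ne hp hlm.symm))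
    (by rw [recen_mobv _ (nd_mem hp m) (nd_mem hp l)]; exact E1)
  rw [recen_mobv _ (nd_mem hp m) (nd_mem hp _)] at c1 c2
  exact ⟨i, mem_Ln_of hFv hFne (mob_alg (a := fun j => F (nd p j)) (ζ := fun j => nd p j i)
    (fun j => hF.lt_one hF0 (nd_mem hp j)) (fun j => nd_mem hp j i) hF0 rfl hkl hkm hlm hκ c1 c2)⟩

/-- genericity of a pair `(z, w)` -/
def Gen {n : ℕ} (p : (Fin n → ℂ) × (Fin n → ℂ)) : Prop :=
  ∀ k : Fin 3, (∀ i, mobv (nd p (lo k)) (nd p (hi k)) i ≠ 0) ∧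
    ∀ i j, i ≠ j → ‖mobv (nd p (lo k)) (nd p (hi k)) i‖ ≠ ‖mobv (nd p (lo k)) (nd p (hi k)) j‖

lemma Gen.ne_zero {n : ℕ} {p : (Fin n → ℂ) × (Fin n → ℂ)} (h : Gen p) {a b : Fin 3}
    (hab : a ≠ b) (i : Fin n) : mobv (nd p a) (nd p b) i ≠ 0 := by
  obtain ⟨k, ⟨h1, h2⟩ | ⟨h1, h2⟩⟩ := lo_hi_of_ne a b hab
  · have := (h k).1 i
    rwa [h1, h2] at this
  · have := (h k).1 i
    rw [h1, h2] at this
    rw [← norm_ne_zero_iff] at this ⊢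
    unfold mobv at *
    rwa [mob_norm_comm]

lemma Gen.norm_ne {n : ℕ} {p : (Fin n → ℂ) × (Fin n → ℂ)} (h : Gen p) {a b : Fin 3}
    (hab : a ≠ b) {i j : Fin n} (hij : i ≠ j) :
    ‖mobv (nd p a) (nd p b) i‖ ≠ ‖mobv (nd p a) (nd p b) j‖ := by
  obtain ⟨k, ⟨h1, h2⟩ | ⟨h1, h2⟩⟩ := lo_hi_of_ne a b hab
  · have := (h k).2 i j hij
    rwa [h1, h2] at this
  · have := (h k).2 i j hij
    rw [h1, h2] at this
    unfold mobv at *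
    rwa [mob_norm_comm, mob_norm_comm (nd p a j)]

lemma Dg_gen {n : ℕ} {p : (Fin n → ℂ) × (Fin n → ℂ)} (hp : p ∈ Dset n) (hg : Gen p)
    {v : Fin 2 → ℂ} {k : Fin 3} (hk : Dg n k p v) : ∃ i, v ∈ Ln p i := by
  obtain ⟨F, hF, hF0, hFv, hFE⟩ := hk
  have hFne := hFE.vals_ne hp hF0 (lo_ne_hi k)
  obtain ⟨l, hkl⟩ : ∃ l : Fin 3, k ≠ l := exists_other k
  obtain ⟨m, hkm, hlm⟩ := exists_third k l hkl
  have E1 := hFE.third hkl hkm hlm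
  have hm1 := hF.lt_one hF0 (nd_mem hp m)
  have hne := mobv_ne_zero (nd_mem hp m) (nd_mem hp l) (nd_ne hp hlm.symm)
  obtain ⟨i, hi⟩ := exists_coord_norm_eq hne
  obtain ⟨κ, hκ, c1, c2⟩ := core_strict (recen_schur hF (nd_mem hp m) hm1) (recen_zero _ _)
    (mobv_mem (nd_mem hp m) (nd_mem hp l)) hne
    (by rw [recen_mobv _ (nd_mem hp m) (nd_mem hp l)]; exact E1)
    (mobv_mem (nd_mem hp m) (nd_mem hp k)) (i := i)
    (fun j hj => lt_of_le_of_ne (by rw [hi]; exact norm_le_pi_norm _ j)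
      (hg.norm_ne hlm.symm hj)) (hg.ne_zero hkm.symm i)
  rw [recen_mobv _ (nd_mem hp m) (nd_mem hp _)] at c1 c2
  exact ⟨i, mem_Ln_of hFv hFne (mob_alg (a := fun j => F (nd p j)) (ζ := fun j => nd p j i)
    (fun j => hF.lt_one hF0 (nd_mem hp j)) (fun j => nd_mem hp j i) hF0 rfl hkl hkm hlm hκ c2 c1)⟩

lemma mem_Adeg_iff {n : ℕ} {p : (Fin n → ℂ) × (Fin n → ℂ)} (hp : p ∈ Dset n)
    {v : Fin 2 → ℂ} (hv : v ≠ 0) :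
    (p, (Projectivization.mk ℂ v hv : ProjLine)) ∈ Adeg n ↔ ∃ k, Dg n k p v := by
  constructor
  · rintro ⟨-, v', hv', hvv', t, ht, -, -, ⟨⟨F, hF1, hF2, hF⟩, -⟩, a, b, hab, hE⟩
    have hS : Schur n F := ⟨hF1, hF2⟩
    have hF0 : F 0 = 0 := hF 0
    have hFz : F p.1 = t * v' 0 := hF 1
    have hFw : F p.2 = t * v' 1 := hF 2
    have hlam : ∀ j, (![(0:ℂ), (t:ℂ) * v' 0, (t:ℂ) * v' 1] : Fin 3 → ℂ) j = F (nd p j) :=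
      fun j => (hF j).symm
    rw [hlam, hlam] at hE
    have hE' := (extremal_two_iff hS (nd_mem hp a) (nd_mem hp b) (nd_ne hp hab)
      (hS.lt_one hF0 (nd_mem hp a)) (hS.lt_one hF0 (nd_mem hp b))).1 hE
    have hE'' : ExtAt F p a b := hE'
    obtain ⟨c, hc⟩ := (Projectivization.mk_eq_mk_iff ℂ v v' hv hv').1 hvv'
    have hpar : F p.1 * v 1 = F p.2 * v 0 := by
      rw [hFz, hFw, ← hc]
      simp only [Pi.smul_apply, Units.smul_def, smul_eq_mul]; ring
    obtain ⟨k, ⟨h1, h2⟩ | ⟨h1, h2⟩⟩ := lo_hi_of_ne a b hab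
    · exact ⟨k, F, hS, hF0, hpar, by rwa [h1, h2]⟩
    · exact ⟨k, F, hS, hF0, hpar, by rw [h1, h2]; exact hE''.symm⟩
  · rintro ⟨k, F, hS, hF0, hpar, hE⟩
    have hne := hE.vals_ne hp hF0 (lo_ne_hi k)
    obtain ⟨s, h0, h1⟩ := parallel hne hpar
    have hs : s ≠ 0 := by
      rintro rfl
      apply hv; ext j; fin_cases j
      · simpa using h0
      · simpa using h1
    have hv' : (![F p.1, F p.2] : Fin 2 → ℂ) ≠ 0 := by
      intro h
      have e0 := congrFun h 0
      have e1 := congrFun h 1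
      simp at e0 e1
      rcases hne with h | h
      · exact h e0
      · exact h e1
    have hEP : ExtremalPick n 2 ![nd p (lo k), nd p (hi k)] ![F (nd p (lo k)), F (nd p (hi k))] :=
      (extremal_two_iff hS (nd_mem hp _) (nd_mem hp _) (nd_ne hp (lo_ne_hi k))
      (hS.lt_one hF0 (nd_mem hp _)) (hS.lt_one hF0 (nd_mem hp _))).2 hE
    have hlam : ∀ j, (![(0:ℂ), ((1:ℝ):ℂ) * (![F p.1, F p.2] : Fin 2 → ℂ) 0,
        ((1:ℝ):ℂ) * (![F p.1, F p.2] : Fin 2 → ℂ) 1] : Fin 3 → ℂ) j = F (nd p j) := by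
      intro j
      fin_cases j
      · simp [nd, hF0]
      · simp [nd]
      · simp [nd]
    refine ⟨hp, ![F p.1, F p.2], hv', ?_, 1, one_pos, ?_, ?_, ⟨⟨F, hS.1, hS.2, ?_⟩, ?_⟩,
      lo k, hi k, lo_ne_hi k, ?_⟩
    · rw [Projectivization.mk_eq_mk_iff]
      refine ⟨Units.mk0 s hs, ?_⟩
      ext j; fin_cases j
      · simp [Units.smul_def, h0]
      · simp [Units.smul_def, h1]
    · simpa using hS.lt_one hF0 hp.1
    · simpa using hS.lt_one hF0 hp.2.1
    · exact fun j => (hlam j).symm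
    · rintro ⟨G, hG, hr, hGv⟩
      have hGF : ∀ j, G (nd p j) = F (nd p j) := fun j => (hGv j).trans (hlam j)
      refine hEP.2 ⟨G, hG, hr, fun j => ?_⟩
      fin_cases j
      · exact hGF _
      · exact hGF _
    · rw [hlam, hlam]; exact hEP

/-! ### Closedness -/

lemma mob_tendsto {ι : Type*} {l : Filter ι} {a b : ι → ℂ} {a0 b0 : ℂ}
    (ha : Tendsto a l (𝓝 a0)) (hb : Tendsto b l (𝓝 b0)) (h1 : ‖a0‖ < 1) (h2 : ‖b0‖ ≤ 1) :
    Tendsto (fun i => mob (a i) (b i)) l (𝓝 (mob a0 b0)) := by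
  unfold mob
  exact (ha.sub hb).div (tendsto_const_nhds.sub
    (((Complex.continuous_conj.tendsto a0).comp ha).mul hb)) (mob_den_ne h1 h2)

lemma mobv_tendsto {n : ℕ} {ι : Type*} {l : Filter ι} {a b : ι → Fin n → ℂ} {a0 b0 : Fin n → ℂ}
    (ha : Tendsto a l (𝓝 a0)) (hb : Tendsto b l (𝓝 b0)) (h1 : a0 ∈ uPolydisc n)
    (h2 : b0 ∈ uPolydisc n) :
    Tendsto (fun i => mobv (a i) (b i)) l (𝓝 (mobv a0 b0)) := by
  rw [tendsto_pi_nhds] at *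
  exact fun i => mob_tendsto (ha i) (hb i) (h1 i) (h2 i).le

lemma nd_continuous {n : ℕ} (j : Fin 3) : Continuous fun p : (Fin n → ℂ) × (Fin n → ℂ) => nd p j := by
  fin_cases j
  · exact continuous_const
  · exact continuous_fst
  · exact continuous_snd

lemma schur_zero (n : ℕ) : Schur n (fun _ => 0) := ⟨differentiableOn_const _, by simp⟩

lemma Dg_closed {n : ℕ} {k : Fin 3} {p0 : (Fin n → ℂ) × (Fin n → ℂ)} {v0 : Fin 2 → ℂ}
    (hp : p0 ∈ Dset n) (u : Ultrafilter (((Fin n → ℂ) × (Fin n → ℂ)) × (Fin 2 → ℂ)))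
    (hu : (u : Filter (((Fin n → ℂ) × (Fin n → ℂ)) × (Fin 2 → ℂ))) ≤ 𝓝 (p0, v0)) (hD : ∀ᶠ q : ((Fin n → ℂ) × (Fin n → ℂ)) × (Fin 2 → ℂ) in u, Dg n k q.1 q.2) :
    Dg n k p0 v0 := by
  classical
  have hch : ∀ q : ((Fin n → ℂ) × (Fin n → ℂ)) × (Fin 2 → ℂ), ∃ F, Schur n F ∧
      (Dg n k q.1 q.2 → F 0 = 0 ∧ F q.1.1 * q.2 1 = F q.1.2 * q.2 0 ∧
        ExtAt F q.1 (lo k) (hi k)) := by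
    intro q
    by_cases h : Dg n k q.1 q.2
    · obtain ⟨F, h1, h2⟩ := h
      exact ⟨F, h1, fun _ => h2⟩
    · exact ⟨_, schur_zero n, fun h' => (h h').elim⟩
  choose F hF hFD using hch
  obtain ⟨G, hG, hlim⟩ := montel u F hF
  have hid : Tendsto (fun q => q) (u : Filter (((Fin n → ℂ) × (Fin n → ℂ)) × (Fin 2 → ℂ))) (𝓝 (p0, v0)) := hu
  have h1 : Tendsto (fun q : ((Fin n → ℂ) × (Fin n → ℂ)) × (Fin 2 → ℂ) => q.1) u (𝓝 p0) :=
    (continuous_fst.tendsto (p0, v0)).comp hid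
  have h2 : Tendsto (fun q : ((Fin n → ℂ) × (Fin n → ℂ)) × (Fin 2 → ℂ) => q.2) u (𝓝 v0) :=
    (continuous_snd.tendsto (p0, v0)).comp hid
  have hnd : ∀ j, Tendsto (fun q : ((Fin n → ℂ) × (Fin n → ℂ)) × (Fin 2 → ℂ) => nd q.1 j) u
      (𝓝 (nd p0 j)) := fun j => ((nd_continuous j).tendsto p0).comp h1
  have hv : ∀ j, Tendsto (fun q : ((Fin n → ℂ) × (Fin n → ℂ)) × (Fin 2 → ℂ) => q.2 j) u
      (𝓝 (v0 j)) := tendsto_pi_nhds.1 h2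
  have hFn : ∀ j, Tendsto (fun q => F q (nd q.1 j)) u (𝓝 (G (nd p0 j))) :=
    fun j => hlim _ _ (nd_mem hp j) (hnd j)
  have hG0 : G 0 = 0 := by
    refine tendsto_nhds_unique_of_eventuallyEq (hFn 0) tendsto_const_nhds ?_
    filter_upwards [hD] with q hq using (hFD q hq).1
  refine ⟨G, hG, hG0, ?_, ?_⟩
  · refine tendsto_nhds_unique_of_eventuallyEq ((hFn 1).mul (hv 1)) ((hFn 2).mul (hv 0)) ?_
    filter_upwards [hD] with q hq using (hFD q hq).2.1
  · refine tendsto_nhds_unique_of_eventuallyEq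
      (mob_tendsto (hFn (lo k)) (hFn (hi k)) (hG.lt_one hG0 (nd_mem hp _))
        (hG.lt_one hG0 (nd_mem hp _)).le).norm
      (mobv_tendsto (hnd (lo k)) (hnd (hi k)) (nd_mem hp _) (nd_mem hp _)).norm ?_
    filter_upwards [hD] with q hq using (hFD q hq).2.2

lemma Dg_fiber_closed {n : ℕ} (k : Fin 3) {p : (Fin n → ℂ) × (Fin n → ℂ)} (hp : p ∈ Dset n) :
    IsClosed {v | Dg n k p v} := by
  rw [isClosed_iff_ultrafilter]
  intro v u hu hD
  refine Dg_closed hp (u.map (fun v => (p, v))) ?_ ?_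
  · exact ((Continuous.prodMk_right p).tendsto v).comp hu
  · exact hD

lemma notDg_open {n : ℕ} {G : Set ((Fin n → ℂ) × (Fin n → ℂ))} (hG : G ⊆ Dset n) (hGo : IsOpen G) :
    IsOpen {q : ((Fin n → ℂ) × (Fin n → ℂ)) × (Fin 2 → ℂ) |
      q.1 ∈ G ∧ q.2 ≠ 0 ∧ ¬ ∃ k, Dg n k q.1 q.2} := by
  have h1 : IsOpen {q : ((Fin n → ℂ) × (Fin n → ℂ)) × (Fin 2 → ℂ) | q.1 ∈ G} :=
    hGo.preimage continuous_fst
  have h2 : IsOpen {q : ((Fin n → ℂ) × (Fin n → ℂ)) × (Fin 2 → ℂ) | q.2 ≠ 0} :=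
    isOpen_ne.preimage continuous_snd
  rw [isOpen_iff_ultrafilter]
  rintro ⟨p, v⟩ ⟨hp, hv, hk⟩ u hu
  have e1 : ∀ᶠ q : ((Fin n → ℂ) × (Fin n → ℂ)) × (Fin 2 → ℂ) in u, q.1 ∈ G := hu (h1.mem_nhds hp)
  have e2 : ∀ᶠ q : ((Fin n → ℂ) × (Fin n → ℂ)) × (Fin 2 → ℂ) in u, q.2 ≠ 0 := hu (h2.mem_nhds hv)
  have e3 : ∀ k, ∀ᶠ q : ((Fin n → ℂ) × (Fin n → ℂ)) × (Fin 2 → ℂ) in u, ¬ Dg n k q.1 q.2 := by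
    intro k
    rw [Ultrafilter.eventually_not]
    intro h
    exact hk ⟨k, Dg_closed (hG hp) u hu h⟩
  have e3' := eventually_all.2 e3
  change ∀ᶠ q : ((Fin n → ℂ) × (Fin n → ℂ)) × (Fin 2 → ℂ) in u, _
  filter_upwards [e1, e2, e3'] with q a b c
  exact ⟨a, b, fun ⟨k, hk⟩ => c k hk⟩

/-! ### Complements of finitely many complex subspaces -/

lemma line_countable {E : Type*} [AddCommGroup E] [Module ℂ E] {ι : Type*} [Countable ι]
    (T : ι → Submodule ℂ E) (x y : E) (hx : ∀ i, x ∉ T i) :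
    {s : ℂ | ∃ i, x + s • (y - x) ∈ T i}.Countable := by
  have : {s : ℂ | ∃ i, x + s • (y - x) ∈ T i} = ⋃ i, {s : ℂ | x + s • (y - x) ∈ T i} := by
    ext s; simp
  rw [this]
  refine countable_iUnion fun i => Set.Subsingleton.countable ?_
  intro s hs t ht
  by_contra hne
  have h1 : (s - t) • (y - x) ∈ T i := by
    have := (T i).sub_mem hs ht
    convert this using 1
    module
  have h2 : y - x ∈ T i := ((T i).smul_mem_iff (sub_ne_zero.2 hne)).1 h1
  apply hx i
  have := (T i).sub_mem hs ((T i).smul_mem s h2)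
  simpa using this

lemma compl_preconnected {E : Type*} [NormedAddCommGroup E] [NormedSpace ℂ E] {ι : Type*}
    [Countable ι] (T : ι → Submodule ℂ E) : IsPreconnected {x : E | ∀ i, x ∉ T i} := by
  apply isPreconnected_of_forall_pair
  intro x hx y hy
  have hc := line_countable T x y hx
  have hr : 1 < Module.rank ℝ ℂ := by rw [Complex.rank_real_complex]; norm_num
  have hS := (hc.isConnected_compl_of_one_lt_rank hr).isPreconnected
  refine ⟨(fun s : ℂ => x + s • (y - x)) '' {s : ℂ | ∃ i, x + s • (y - x) ∈ T i}ᶜ, ?_, ?_, ?_, ?_⟩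
  · rintro _ ⟨s, hs, rfl⟩ i hi
    exact hs ⟨i, hi⟩
  · refine ⟨0, ?_, by simp⟩
    rintro ⟨i, hi⟩
    exact hx i (by simpa using hi)
  · refine ⟨1, ?_, by simp⟩
    rintro ⟨i, hi⟩
    exact hy i (by simpa using hi)
  · exact hS.image _ (by fun_prop)

lemma compl_dense {E : Type*} [NormedAddCommGroup E] [NormedSpace ℂ E] {ι : Type*}
    [Countable ι] (T : ι → Submodule ℂ E) (hne : ∃ x : E, ∀ i, x ∉ T i) :
    Dense {x : E | ∀ i, x ∉ T i} := by
  obtain ⟨x, hx⟩ := hne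
  intro y
  have hc := line_countable T x y hx
  have hd : Dense ({s : ℂ | ∃ i, x + s • (y - x) ∈ T i}ᶜ) := hc.dense_compl ℝ
  have hcont : Continuous (fun s : ℂ => x + s • (y - x)) := by fun_prop
  have := image_closure_subset_closure_image hcont (mem_image_of_mem _ (hd 1))
  simp only [one_smul, add_sub_cancel] at this
  refine closure_mono ?_ this
  rintro _ ⟨s, hs, rfl⟩ i hi
  exact hs ⟨i, hi⟩

lemma Ln_compl_nonempty {n : ℕ} (p : (Fin n → ℂ) × (Fin n → ℂ)) :
    ∃ v : Fin 2 → ℂ, ∀ i, v ∉ Ln p i := by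
  by_contra h
  push Not at h
  refine Subspace.biUnion_ne_univ_of_top_notMem (k := ℂ) (s := Finset.univ.image (Ln p)) ?_ ?_
  · simp only [Finset.mem_image, Finset.mem_univ, true_and, not_exists]
    intro i hi
    have h1 : Module.finrank ℂ (Ln p i) ≤ 1 := by
      unfold Ln
      exact (finrank_span_le_card _).trans (by simp)
    rw [hi, finrank_top] at h1
    simp at h1
  · rw [eq_univ_iff_forall]
    intro v
    obtain ⟨i, hi⟩ := h v
    simp only [mem_iUnion]
    exact ⟨Ln p i, by simp, hi⟩

lemma Ln_dense {n : ℕ} (p : (Fin n → ℂ) × (Fin n → ℂ)) : Dense {v | ∀ i, v ∉ Ln p i} :=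
  compl_dense _ (Ln_compl_nonempty p)

/-! ### Nonempty fibers -/

lemma Dg_excl {n : ℕ} {p : (Fin n → ℂ) × (Fin n → ℂ)} (hp : p ∈ Dset n) (k : Fin 3) :
    ∃ v : Fin 2 → ℂ, ¬ Dg n k p v := by
  have key : ∀ F : (Fin n → ℂ) → ℂ, ∀ a b : Fin 3, a ≠ b → ExtAt F p a b →
      F (nd p a) ≠ F (nd p b) := by
    intro F a b hab h he
    unfold ExtAt at h
    rw [he, mob_self, norm_zero] at h
    exact mobv_ne_zero (nd_mem hp a) (nd_mem hp b) (nd_ne hp hab) (norm_eq_zero.1 h.symm)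
  fin_cases k
  · refine ⟨![1, 1], ?_⟩
    rintro ⟨F, hF, h0, hv, hE⟩
    refine key F 1 2 (by decide) hE ?_
    simpa [nd] using hv
  · refine ⟨![1, 0], ?_⟩
    rintro ⟨F, hF, h0, hv, hE⟩
    refine key F 0 2 (by decide) hE ?_
    simpa [nd, h0] using hv
  · refine ⟨![0, 1], ?_⟩
    rintro ⟨F, hF, h0, hv, hE⟩
    refine key F 0 1 (by decide) hE ?_
    simpa [nd, h0, eq_comm] using hv

lemma fiber_nonempty {n : ℕ} (hn : 0 < n) {p : (Fin n → ℂ) × (Fin n → ℂ)} (hp : p ∈ Dset n) :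
    ∃ v : Fin 2 → ℂ, v ≠ 0 ∧ ¬ ∃ k, Dg n k p v := by
  by_contra hcon
  push Not at hcon
  set S : Set (Fin 2 → ℂ) := {v | ∀ i, v ∉ Ln p i} with hS
  have hSc : IsPreconnected S := compl_preconnected _
  have hS0 : ∀ v ∈ S, v ≠ 0 := by
    rintro v hv rfl
    exact hv ⟨0, hn⟩ (Submodule.zero_mem _)
  have hcl : ∀ k, IsClosed {v | Dg n k p v} := fun k => Dg_fiber_closed k hp
  have hall : ∀ k, ¬ (S ⊆ {v | Dg n k p v}) := by
    intro k hk
    obtain ⟨v, hv⟩ := Dg_excl hp k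
    exact hv ((hcl k).closure_subset_iff.2 hk (Ln_dense p v))
  have hdis : ∀ k l, k ≠ l → ∀ v ∈ S, Dg n k p v → ¬ Dg n l p v := by
    intro k l hkl v hv h1 h2
    obtain ⟨i, hi⟩ := Dg_inter hp (hS0 v hv) hkl h1 h2
    exact hv i hi
  obtain ⟨v, hv⟩ := Ln_compl_nonempty p
  obtain ⟨k, hk⟩ := hcon v (hS0 v hv)
  obtain ⟨w, hw, hwk⟩ := not_subset.1 (hall k)
  obtain ⟨l, hl⟩ := hcon w (hS0 w hw)
  have := isPreconnected_closed_iff.1 hSc {v | Dg n k p v} (⋃ l ∈ {l | l ≠ k}, {v | Dg n l p v})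
    (hcl k) ((Set.toFinite _).isClosed_biUnion fun l _ => hcl l) (by
      intro x hx
      obtain ⟨m, hm⟩ := hcon x (hS0 x hx)
      by_cases hmk : m = k
      · subst hmk; exact Or.inl hm
      · exact Or.inr (mem_biUnion hmk hm)) ⟨v, hv, hk⟩
    ⟨w, hw, mem_biUnion (x := l) (by rintro rfl; exact hwk hl) hl⟩
  obtain ⟨x, hx, h1, h2⟩ := this
  simp only [mem_iUnion] at h2
  obtain ⟨m, hm, h2⟩ := h2
  exact hdis k m (Ne.symm hm) x hx h1 h2

/-! ### Density of generic pairs -/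

lemma mob_frequently_ne {a s0 : ℂ} (ha : ‖a‖ < 1) (hs : ‖s0‖ < 1) (c : ℝ) :
    ∃ᶠ s in 𝓝 s0, ‖mob a s‖ ≠ c := by
  intro hcon
  have hc : ∀ᶠ s in 𝓝 s0, ‖mob a s‖ = c := by
    filter_upwards [hcon] with s h using not_not.1 h
  have hlt : ∀ᶠ s in 𝓝 s0, ‖s‖ < 1 := (isOpen_lt continuous_norm continuous_const).mem_nhds hs
  have h0 := hc.self_of_nhds
  have hmax : IsLocalMax (norm ∘ mob a) s0 := by
    filter_upwards [hc] with s h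
    simp only [Function.comp]
    rw [h, h0]
  have hev := Complex.eventually_eq_of_isLocalMax_norm
    (hlt.mono fun s h => mob_differentiableAt ha h.le) hmax
  have hall : ∀ᶠ s in 𝓝 s0, s = s0 := by
    filter_upwards [hev, hlt] with s h1 h2 using mob_inj ha h2.le hs.le h1
  have h1 : ∀ᶠ s in 𝓝[≠] s0, s = s0 := hall.filter_mono nhdsWithin_le_nhds
  have h2 : ∀ᶠ s in 𝓝[≠] s0, s ≠ s0 := self_mem_nhdsWithin
  obtain ⟨s, h3, h4⟩ := (h1.and h2).exists
  exact h4 h3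

lemma exists_perturb {n : ℕ} (k : Fin 3) (i : Fin n) (p : (Fin n → ℂ) × (Fin n → ℂ)) :
    ∃ φ : ℂ → (Fin n → ℂ) × (Fin n → ℂ), Continuous φ ∧ φ (nd p (hi k) i) = p ∧
      (∀ s, nd (φ s) (lo k) = nd p (lo k)) ∧
      ∀ s, nd (φ s) (hi k) = Function.update (nd p (hi k)) i s := by
  fin_cases k
  · refine ⟨fun s => (p.1, Function.update p.2 i s), ?_, ?_, fun s => rfl, fun s => rfl⟩
    · exact continuous_const.prodMk ((continuous_const (y := p.2)).update i continuous_id)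
    · simp [nd, hi]
  · refine ⟨fun s => (p.1, Function.update p.2 i s), ?_, ?_, fun s => rfl, fun s => rfl⟩
    · exact continuous_const.prodMk ((continuous_const (y := p.2)).update i continuous_id)
    · simp [nd, hi]
  · refine ⟨fun s => (Function.update p.1 i s, p.2), ?_, ?_, fun s => rfl, fun s => rfl⟩
    · exact ((continuous_const (y := p.1)).update i continuous_id).prodMk continuous_const
    · simp [nd, hi]

/-- a single genericity condition: either coordinate `i` is nonzero, or norms of coordinates
`i` and `j` differ. -/
def Cond {n : ℕ} (t : Fin 3 × Fin n × Option (Fin n)) (p : (Fin n → ℂ) × (Fin n → ℂ)) : Prop :=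
  match t with
  | (k, i, none) => ‖mobv (nd p (lo k)) (nd p (hi k)) i‖ ≠ 0
  | (k, i, some j) => i ≠ j →
      ‖mobv (nd p (lo k)) (nd p (hi k)) i‖ ≠ ‖mobv (nd p (lo k)) (nd p (hi k)) j‖

lemma nd_mem' {n : ℕ} {p : (Fin n → ℂ) × (Fin n → ℂ)} (h1 : p.1 ∈ uPolydisc n)
    (h2 : p.2 ∈ uPolydisc n) (j : Fin 3) : nd p j ∈ uPolydisc n := by
  fin_cases j
  · exact zero_mem_uPolydisc n
  · exact h1
  · exact h2

lemma cond_dense {n : ℕ} (t : Fin 3 × Fin n × Option (Fin n))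
    {W : Set ((Fin n → ℂ) × (Fin n → ℂ))} (hW : W ⊆ uPolydisc n ×ˢ uPolydisc n)
    (hWo : IsOpen W) (hne : W.Nonempty) : ∃ p ∈ W, Cond t p := by
  obtain ⟨p, hp⟩ := hne
  obtain ⟨k, i, o⟩ := t
  obtain ⟨φ, hφ, hφp, hlo, hhi⟩ := exists_perturb k i p
  have hm := fun j => nd_mem' (hW hp).1 (hW hp).2 j
  have hev : ∀ᶠ s in 𝓝 (nd p (hi k) i), φ s ∈ W := by
    apply hφ.continuousAt.eventually_mem
    rw [hφp]; exact hWo.mem_nhds hp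
  have hi' : ∀ s, mobv (nd (φ s) (lo k)) (nd (φ s) (hi k)) i = mob (nd p (lo k) i) s := by
    intro s
    rw [hlo, hhi]; simp [mobv]
  cases o with
  | none =>
    obtain ⟨s, hs, hsW⟩ := ((mob_frequently_ne (hm (lo k) i) (hm (hi k) i) 0).and_eventually
      hev).exists
    refine ⟨φ s, hsW, ?_⟩
    simp only [Cond]
    rwa [hi']
  | some j =>
    obtain ⟨s, hs, hsW⟩ := ((mob_frequently_ne (hm (lo k) i) (hm (hi k) i)
      ‖mobv (nd p (lo k)) (nd p (hi k)) j‖).and_eventually hev).exists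
    refine ⟨φ s, hsW, ?_⟩
    intro hij
    rw [hi']
    convert hs using 2
    rw [hlo, hhi]
    simp [mobv, Function.update_of_ne hij.symm]

lemma cond_eventually {n : ℕ} (t : Fin 3 × Fin n × Option (Fin n))
    {p : (Fin n → ℂ) × (Fin n → ℂ)} (hp : p ∈ uPolydisc n ×ˢ uPolydisc n) (h : Cond t p) :
    ∀ᶠ q in 𝓝 p, Cond t q := by
  obtain ⟨k, i, o⟩ := t
  have hm := fun j => nd_mem' hp.1 hp.2 j
  have hT := fun i => (tendsto_pi_nhds.1 (mobv_tendsto ((nd_continuous (lo k)).tendsto p)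
    ((nd_continuous (hi k)).tendsto p) (hm _) (hm _)) i).norm
  cases o with
  | none => exact Filter.Tendsto.eventually_ne (hT i) h
  | some j =>
    by_cases hij : i = j
    · exact Eventually.of_forall fun q hq => (hq hij).elim
    · filter_upwards [Filter.Tendsto.eventually_ne ((hT i).sub (hT j)) (sub_ne_zero.2 (h hij))] with q hq using fun _ => sub_ne_zero.1 hq

lemma cond_finset {n : ℕ} (s : Finset (Fin 3 × Fin n × Option (Fin n))) :
    ∀ W : Set ((Fin n → ℂ) × (Fin n → ℂ)), W ⊆ uPolydisc n ×ˢ uPolydisc n → IsOpen W →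
      W.Nonempty → ∃ p ∈ W, ∀ t ∈ s, Cond t p := by
  classical
  induction s using Finset.induction_on with
  | empty => intro W _ _ ⟨p, hp⟩; exact ⟨p, hp, by simp⟩
  | insert t s _ ih =>
    intro W hW hWo hne
    obtain ⟨p, hp, hpt⟩ := cond_dense t hW hWo hne
    have hnb : ∀ᶠ q in 𝓝 p, q ∈ W ∧ Cond t q :=
      (hWo.eventually_mem hp).and (cond_eventually t (hW hp) hpt)
    obtain ⟨W', hW', hW'o, hpW'⟩ := _root_.mem_nhds_iff.1 hnb
    obtain ⟨q, hq, hqs⟩ := ih W' (fun x hx => hW (hW' hx).1) hW'o ⟨p, hpW'⟩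
    refine ⟨q, (hW' hq).1, fun t' ht' => ?_⟩
    rcases Finset.mem_insert.1 ht' with rfl | h
    · exact (hW' hq).2
    · exact hqs _ h

lemma gen_dense {n : ℕ} {W : Set ((Fin n → ℂ) × (Fin n → ℂ))} (hW : W ⊆ Dset n)
    (hWo : IsOpen W) (hne : W.Nonempty) : ∃ p ∈ W, Gen p := by
  obtain ⟨p, hp, h⟩ := cond_finset Finset.univ W (fun x hx => ⟨(hW hx).1, (hW hx).2.1⟩) hWo hne
  refine ⟨p, hp, fun k => ⟨fun i => ?_, fun i j hij => ?_⟩⟩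
  · exact norm_ne_zero_iff.1 (h (k, i, none) (Finset.mem_univ _))
  · exact h (k, i, some j) (Finset.mem_univ _) hij

/-! ### The total space -/

def Xt {n : ℕ} (G : Set ((Fin n → ℂ) × (Fin n → ℂ))) :
    Set (((Fin n → ℂ) × (Fin n → ℂ)) × (Fin 2 → ℂ)) :=
  {q | q.1 ∈ G ∧ q.2 ≠ 0 ∧ ¬ ∃ k, Dg n k q.1 q.2}

lemma Xt_preconnected {n : ℕ} (hn : 0 < n) {G : Set ((Fin n → ℂ) × (Fin n → ℂ))}
    (hG : G ⊆ Dset n) (hGo : IsOpen G) (hGc : IsPreconnected G) : IsPreconnected (Xt G) := by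
  have hXo : IsOpen (Xt G) := notDg_open hG hGo
  intro U V hU hV hUV ⟨a, haX, haU⟩ ⟨b, hbX, hbV⟩
  have hUo := isOpenMap_fst _ (hXo.inter hU)
  have hVo := isOpenMap_fst _ (hXo.inter hV)
  have hcov : G ⊆ Prod.fst '' (Xt G ∩ U) ∪ Prod.fst '' (Xt G ∩ V) := by
    intro p hp
    obtain ⟨v, hv, hk⟩ := fiber_nonempty hn (hG hp)
    have hx : (p, v) ∈ Xt G := ⟨hp, hv, hk⟩
    rcases hUV hx with h | h
    · exact Or.inl ⟨_, ⟨hx, h⟩, rfl⟩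
    · exact Or.inr ⟨_, ⟨hx, h⟩, rfl⟩
  obtain ⟨p0, hp0⟩ := hGc _ _ hUo hVo hcov ⟨a.1, haX.1, a, ⟨haX, haU⟩, rfl⟩
    ⟨b.1, hbX.1, b, ⟨hbX, hbV⟩, rfl⟩
  obtain ⟨p, ⟨hpG, hpU, hpV⟩, hg⟩ := gen_dense (fun x hx => hG hx.1)
    (hGo.inter (hUo.inter hVo)) ⟨p0, hp0⟩
  obtain ⟨⟨_, v⟩, ⟨hvX, hvU⟩, rfl⟩ := hpU
  obtain ⟨⟨p, w⟩, ⟨hwX, hwV⟩, rfl⟩ := hpV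
  dsimp only at *
  have hSX : ∀ x ∈ {v | ∀ i, v ∉ Ln p i}, (p, x) ∈ Xt G := by
    intro x hx
    refine ⟨hpG, ?_, ?_⟩
    · rintro h0
      exact hx ⟨0, hn⟩ (by change x = 0 at h0; rw [h0]; exact Submodule.zero_mem _)
    · rintro ⟨k, hk⟩
      obtain ⟨i, hi⟩ := Dg_gen (hG hpG) hg hk
      exact hx i hi
  have hcont : Continuous fun x : Fin 2 → ℂ => (p, x) := Continuous.prodMk_right p
  obtain ⟨v', hv'S, hv'U⟩ := (Ln_dense p).exists_mem_open (hU.preimage hcont) ⟨v, hvU⟩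
  obtain ⟨w', hw'S, hw'V⟩ := (Ln_dense p).exists_mem_open (hV.preimage hcont) ⟨w, hwV⟩
  obtain ⟨x, hx, hx1, hx2⟩ := compl_preconnected (Ln p) _ _ (hU.preimage hcont) (hV.preimage hcont)
    (fun x hx => hUV (hSX x hx)) ⟨v', hv'S, hv'U⟩ ⟨w', hw'S, hw'V⟩
  exact ⟨(p, x), hSX x hx, hx1, hx2⟩

/-! ### Transfer to the projective line -/

lemma X_eq {n : ℕ} {G : Set ((Fin n → ℂ) × (Fin n → ℂ))} (hG : G ⊆ Dset n)
    (f : {q : ((Fin n → ℂ) × (Fin n → ℂ)) × (Fin 2 → ℂ) // q.2 ≠ 0} →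
      ((Fin n → ℂ) × (Fin n → ℂ)) × ProjLine)
    (hf : f = fun q => (q.1.1, Projectivization.mk ℂ q.1.2 q.2)) :
    (G ×ˢ (Set.univ : Set ProjLine)) \ Adeg n = f '' (Subtype.val ⁻¹' (Xt G)) := by
  subst hf
  ext ⟨p, ξ⟩
  constructor
  · rintro ⟨⟨hp, -⟩, hA⟩
    induction ξ using Projectivization.ind with
    | h v hv =>
      rw [mem_Adeg_iff (hG hp) hv] at hA
      exact ⟨⟨(p, v), hv⟩, ⟨hp, hv, hA⟩, rfl⟩
  · rintro ⟨⟨⟨p', v⟩, hv⟩, ⟨hp, hv', hA⟩, he⟩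
    obtain ⟨rfl, rfl⟩ := Prod.mk.inj he
    refine ⟨⟨hp, mem_univ _⟩, ?_⟩
    rw [mem_Adeg_iff (hG hp) hv]
    exact hA

lemma mk_continuous : Continuous fun v : {v : Fin 2 → ℂ // v ≠ 0} =>
    (Projectivization.mk ℂ v.1 v.2 : ProjLine) := by
  exact continuous_quotient_mk' (s := projectivizationSetoid ℂ (Fin 2 → ℂ))

lemma mk_isOpenMap : IsOpenMap fun v : {v : Fin 2 → ℂ // v ≠ 0} =>
    (Projectivization.mk ℂ v.1 v.2 : ProjLine) := by
  intro U hU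
  change IsOpen ((fun v : {v : Fin 2 → ℂ // v ≠ 0} =>
    (Projectivization.mk ℂ v.1 v.2 : ProjLine)) ⁻¹' _)
  have hc : ∀ c : ℂˣ, Continuous fun v : {v : Fin 2 → ℂ // v ≠ 0} =>
      (⟨c • v.1, by simpa [Units.smul_def] using v.2⟩ : {v : Fin 2 → ℂ // v ≠ 0}) := by
    intro c
    refine Continuous.subtype_mk ?_ _
    simp only [Units.smul_def]
    fun_prop
  convert isOpen_iUnion fun c : ℂˣ => hU.preimage (hc c) using 1
  ext v
  simp only [mem_preimage, mem_image, mem_iUnion]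
  constructor
  · rintro ⟨w, hw, he⟩
    obtain ⟨c, hcw⟩ := (Projectivization.mk_eq_mk_iff ℂ w.1 v.1 w.2 v.2).1 he
    refine ⟨c, ?_⟩
    convert hw using 1
    exact Subtype.ext hcw
  · rintro ⟨c, hcU⟩
    exact ⟨_, hcU, (Projectivization.mk_eq_mk_iff ℂ _ v.1 _ v.2).2 ⟨c, rfl⟩⟩

lemma main_part {n : ℕ} (hn : 0 < n) {G : Set ((Fin n → ℂ) × (Fin n → ℂ))}
    (hG : G ⊆ Dset n) (hGo : IsOpen G) (hGc : IsConnected G) :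
    IsOpen ((G ×ˢ (Set.univ : Set ProjLine)) \ Adeg n) ∧
      IsConnected ((G ×ˢ (Set.univ : Set ProjLine)) \ Adeg n) := by
  have hX := X_eq hG _ rfl
  have hXo : IsOpen (Xt G) := notDg_open hG hGo
  have hXc := Xt_preconnected hn hG hGo hGc.isPreconnected
  set e : {q : ((Fin n → ℂ) × (Fin n → ℂ)) × (Fin 2 → ℂ) // q.2 ≠ 0} →
      ((Fin n → ℂ) × (Fin n → ℂ)) × {v : Fin 2 → ℂ // v ≠ 0} := fun q => (q.1.1, ⟨q.1.2, q.2⟩) with he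
  set m : ((Fin n → ℂ) × (Fin n → ℂ)) × {v : Fin 2 → ℂ // v ≠ 0} →
      ((Fin n → ℂ) × (Fin n → ℂ)) × ProjLine :=
    Prod.map id (fun v => Projectivization.mk ℂ v.1 v.2) with hm
  set j : ((Fin n → ℂ) × (Fin n → ℂ)) × {v : Fin 2 → ℂ // v ≠ 0} →
      ((Fin n → ℂ) × (Fin n → ℂ)) × (Fin 2 → ℂ) := Prod.map id Subtype.val with hj
  have hjo : IsOpenEmbedding j :=
    IsOpenEmbedding.id.prodMap (isOpen_ne.isOpenEmbedding_subtypeVal)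
  have hX' : (G ×ˢ (Set.univ : Set ProjLine)) \ Adeg n = m '' (j ⁻¹' Xt G) := by
    rw [hX]
    ext x
    constructor
    · rintro ⟨q, hq, rfl⟩
      exact ⟨e q, hq, rfl⟩
    · rintro ⟨⟨p, v⟩, hq, rfl⟩
      exact ⟨⟨(p, v.1), v.2⟩, hq, rfl⟩
  have hmo : IsOpenMap m := IsOpenMap.id.prodMap mk_isOpenMap
  have hmc : Continuous m := continuous_id.prodMap mk_continuous
  rw [hX']
  refine ⟨hmo _ (hXo.preimage hjo.continuous), ?_, ?_⟩
  · obtain ⟨p, hp⟩ := hGc.nonempty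
    obtain ⟨v, hv, hk⟩ := fiber_nonempty hn (hG hp)
    exact ⟨_, (p, ⟨v, hv⟩), ⟨hp, hv, hk⟩, rfl⟩
  · refine IsPreconnected.image ?_ _ hmc.continuousOn
    refine (hXc.preimage_of_isOpenMap hjo.injective hjo.isOpenMap ?_)
    rintro ⟨p, v⟩ hq
    exact ⟨(p, ⟨v, hq.2.1⟩), rfl⟩

/-! ### `Dset` is a domain -/

lemma Dset_isOpen (n : ℕ) : IsOpen (Dset n) := by
  have h1 : IsOpen {p : (Fin n → ℂ) × (Fin n → ℂ) | p.1 ∈ uPolydisc n} :=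
    (isOpen_uPolydisc n).preimage continuous_fst
  have h2 : IsOpen {p : (Fin n → ℂ) × (Fin n → ℂ) | p.2 ∈ uPolydisc n} :=
    (isOpen_uPolydisc n).preimage continuous_snd
  have h3 : IsOpen {p : (Fin n → ℂ) × (Fin n → ℂ) | p.1 ≠ p.2} :=
    isOpen_ne_fun continuous_fst continuous_snd
  have h4 : IsOpen {p : (Fin n → ℂ) × (Fin n → ℂ) | p.1 ≠ 0} :=
    isOpen_ne_fun continuous_fst continuous_const
  have h5 : IsOpen {p : (Fin n → ℂ) × (Fin n → ℂ) | p.2 ≠ 0} :=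
    isOpen_ne_fun continuous_snd continuous_const
  exact h1.inter (h2.inter (h3.inter (h4.inter h5)))

lemma Dset_isConnected {n : ℕ} (hn : 0 < n) : IsConnected (Dset n) := by
  constructor
  · refine ⟨(fun _ => 1/2, fun _ => 1/3), fun i => by norm_num, fun i => by norm_num, ?_, ?_, ?_⟩
    · intro h
      have := congrFun h ⟨0, hn⟩
      norm_num at this
    · intro h
      have := congrFun h ⟨0, hn⟩
      norm_num at this
    · intro h
      have := congrFun h ⟨0, hn⟩
      norm_num at this
  · have h := compl_preconnected (E := (Fin n → ℂ) × (Fin n → ℂ))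
      ![LinearMap.ker (LinearMap.fst ℂ (Fin n → ℂ) (Fin n → ℂ) - LinearMap.snd ℂ _ _),
        LinearMap.ker (LinearMap.fst ℂ (Fin n → ℂ) (Fin n → ℂ)),
        LinearMap.ker (LinearMap.snd ℂ (Fin n → ℂ) (Fin n → ℂ))]
    set e : (Fin n → ℂ) ≃ₜ ball (0 : Fin n → ℂ) 1 := Homeomorph.unitBall with he
    have he0 : (e 0 : Fin n → ℂ) = 0 := Homeomorph.coe_unitBall_apply_zero
    have hinj : ∀ x y, (e x : Fin n → ℂ) = e y ↔ x = y := fun x y => by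
      rw [Subtype.coe_inj, e.injective.eq_iff]
    have hinj0 : ∀ x, (e x : Fin n → ℂ) = 0 ↔ x = 0 := fun x => by
      rw [← hinj x 0, he0]
    have hc : Continuous fun q : (Fin n → ℂ) × (Fin n → ℂ) =>
        ((e q.1 : Fin n → ℂ), (e q.2 : Fin n → ℂ)) :=
      (continuous_subtype_val.comp (e.continuous.comp continuous_fst)).prodMk
        (continuous_subtype_val.comp (e.continuous.comp continuous_snd))
    convert h.image _ hc.continuousOn using 1
    ext ⟨z, w⟩
    simp only [Dset, mem_ofPred_eq, uPolydisc_eq_ball, mem_image, Prod.exists, Prod.mk.injEq,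
      Fin.forall_fin_succ, IsEmpty.forall_iff, and_true]
    constructor
    · rintro ⟨hz, hw, h1, h2, h3⟩
      refine ⟨e.symm ⟨z, hz⟩, e.symm ⟨w, hw⟩, ⟨?_, ?_, ?_⟩, by simp, by simp⟩
      · intro hh
        have : e.symm ⟨z, hz⟩ = e.symm ⟨w, hw⟩ := by simpa [sub_eq_zero] using hh
        exact h1 (by simpa using this)
      · intro hh
        have : e.symm ⟨z, hz⟩ = 0 := by simpa using hh
        rw [← hinj0] at this
        exact h2 (by simpa using this)
      · intro hh
        have : e.symm ⟨w, hw⟩ = 0 := by simpa using hh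
        rw [← hinj0] at this
        exact h3 (by simpa using this)
    · rintro ⟨a, b, ⟨h1, h2, h3⟩, rfl, rfl⟩
      refine ⟨(e a).2, (e b).2, ?_, ?_, ?_⟩
      · rw [Ne, hinj]; simpa [sub_eq_zero] using h1
      · rw [Ne, hinj0]; simpa using h2
      · rw [Ne, hinj0]; simpa using h3

/-- for every subdomain `G` of `𝒟ₙ`, the set `(G × ℙ¹) ∖ 𝒜_d` is a
domain; in particular `(𝒟ₙ × ℙ¹) ∖ 𝒜_d` is a domain. -/
theorem statement_18 (n : ℕ) (hn : 2 ≤ n) :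
    (∀ G : Set ((Fin n → ℂ) × (Fin n → ℂ)), G ⊆ Dset n → IsOpen G → IsConnected G →
      IsOpen ((G ×ˢ (Set.univ : Set ProjLine)) \ Adeg n) ∧
      IsConnected ((G ×ˢ (Set.univ : Set ProjLine)) \ Adeg n)) ∧
    IsOpen ((Dset n ×ˢ (Set.univ : Set ProjLine)) \ Adeg n) ∧
    IsConnected ((Dset n ×ˢ (Set.univ : Set ProjLine)) \ Adeg n) := by
  have hn0 : 0 < n := by omega
  refine ⟨fun G hG hGo hGc => main_part hn0 hG hGo hGc, ?_⟩
  exact main_part hn0 subset_rfl (Dset_isOpen n) (Dset_isConnected hn0)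
end
end

section
/- Let n ≥ 1, let z, w ∈ 𝔻ⁿ∖{0} with z ≠ w, and let (σ, τ) ∈ ℂ²∖{(0,0)}. Then there exists exactly one t > 0 such that t·σ, t·τ ∈ 𝔻 and the three-point Pick problem on 𝔻ⁿ sending 0 ↦ 0, z ↦ t·σ, w ↦ t·τ is extremal. Moreover, the map (z, w, (σ, τ)) ↦ t is continuous on {(z, w) ∈ 𝔻ⁿ × 𝔻ⁿ : z ≠ w, z ≠ 0, w ≠ 0} × (ℂ²∖{(0,0)}). -/
open Complex Set ComplexConjugate

noncomputable section

open Metric Filter Topology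

namespace S19

variable {E : Type*} [NormedAddCommGroup E] [NormedSpace ℂ E]

/-- `r` is an admissible bound. -/
def Adm (z w : E) (σ τ : ℂ) (r : ℝ) : Prop :=
  ∃ F : E → ℂ, DifferentiableOn ℂ F (ball 0 1) ∧ (∀ x ∈ ball (0:E) 1, ‖F x‖ ≤ r) ∧
    F 0 = 0 ∧ F z = σ ∧ F w = τ

theorem subball {c : E} {y : E} (hy : y ∈ ball c (1 - ‖c‖)) : y ∈ ball (0:E) 1 := by
  rw [mem_ball_iff_norm] at hy
  rw [mem_ball_zero_iff]
  have := norm_add_le (y - c) c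
  rw [sub_add_cancel] at this
  linarith

theorem lip {F : E → ℂ} {r : ℝ} (hd : DifferentiableOn ℂ F (ball 0 1))
    (hb : ∀ x ∈ ball (0:E) 1, ‖F x‖ ≤ r) {c y : E} (hy : y ∈ ball c (1 - ‖c‖)) :
    ‖F y - F c‖ ≤ 2 * r / (1 - ‖c‖) * ‖y - c‖ := by
  have hR : 0 < 1 - ‖c‖ := nonempty_ball.mp ⟨y, hy⟩
  have h := Complex.dist_le_div_mul_dist_of_mapsTo_ball (f := F) (c := c) (R₁ := 1 - ‖c‖)
    (R₂ := 2 * r) (hd.mono fun _ h => subball h) ?_ hy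
  · simpa [dist_eq_norm] using h
  · intro x hx
    rw [mem_closedBall, dist_eq_norm]
    have h1 := hb x (subball hx)
    have h2 := hb c (subball (mem_ball_self hR))
    linarith [norm_sub_le (F x) (F c)]

theorem fder {F : E → ℂ} {r : ℝ} (hd : DifferentiableOn ℂ F (ball 0 1))
    (hb : ∀ x ∈ ball (0:E) 1, ‖F x‖ ≤ r) {c : E} (hc : c ∈ ball (0:E) 1) :
    ‖fderiv ℂ F c‖ ≤ 2 * r / (1 - ‖c‖) := by
  have hR : 0 < 1 - ‖c‖ := by rw [mem_ball_zero_iff] at hc; linarith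
  refine Complex.norm_fderiv_le_div_of_mapsTo_ball (hd.mono fun _ h => subball h) ?_ hR
  intro x hx
  rw [mem_closedBall, dist_eq_norm]
  have h1 := hb x (subball hx)
  have h2 := hb c hc
  linarith [norm_sub_le (F x) (F c)]

theorem second {F : E → ℂ} {r : ℝ} (hd : DifferentiableOn ℂ F (ball 0 1))
    (hb : ∀ x ∈ ball (0:E) 1, ‖F x‖ ≤ r) {c y : E} (hy : y ∈ ball c (1 - ‖c‖)) :
    ‖F y - F c - fderiv ℂ F c (y - c)‖ ≤ 4 * r * (‖y - c‖ / (1 - ‖c‖)) ^ 2 := by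
  have hR : 0 < 1 - ‖c‖ := nonempty_ball.mp ⟨y, hy⟩
  have hc : c ∈ ball (0:E) 1 := subball (mem_ball_self hR)
  have h := Complex.dist_le_mul_div_pow_of_mapsTo_ball_of_isLittleO
    (f := fun y => F y - fderiv ℂ F c (y - c)) (c := c) (R₁ := 1 - ‖c‖)
    (R₂ := 4 * r) (n := 1) ?_ ?_ ?_ hy
  · have e : F y - F c - fderiv ℂ F c (y - c) =
      (F y - fderiv ℂ F c (y - c)) - (F c - fderiv ℂ F c (c - c)) := by simp; ring
    rw [e]
    simpa [dist_eq_norm] using h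
  · refine (hd.mono fun _ h => subball h).sub ?_
    fun_prop
  · intro x hx
    rw [mem_closedBall, dist_eq_norm]
    have h1 := hb x (subball hx)
    have h2 := hb c hc
    have h3 := (fderiv ℂ F c).le_of_opNorm_le (fder hd hb hc) (x - c)
    rw [mem_ball_iff_norm] at hx
    have hr : 0 ≤ r := (norm_nonneg _).trans h1
    have h4 : 2 * r / (1 - ‖c‖) * ‖x - c‖ ≤ 2 * r := by
      calc 2 * r / (1 - ‖c‖) * ‖x - c‖ ≤ 2 * r / (1 - ‖c‖) * (1 - ‖c‖) := by gcongr
        _ = 2 * r := by field_simp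
    simp only [sub_self, map_zero, sub_zero]
    have := norm_sub_le (F x - fderiv ℂ F c (x - c)) (F c)
    have := norm_sub_le (F x) (fderiv ℂ F c (x - c))
    linarith
  · have hda : HasFDerivAt F (fderiv ℂ F c) c :=
      (hd.differentiableAt (isOpen_ball.mem_nhds hc)).hasFDerivAt
    have := hda.isLittleO
    simp only [sub_self, map_zero, sub_zero, pow_one]
    refine Asymptotics.IsLittleO.norm_right ?_
    refine this.congr_left fun x => ?_
    ring

theorem ulim {G : Type*} [NormedAddCommGroup G] [ProperSpace G] (U : Ultrafilter ℕ) (f : ℕ → G)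
    (B : ℝ) (h : ∀ k, ‖f k‖ ≤ B) : ∃ l, Tendsto f U (𝓝 l) := by
  obtain ⟨l, -, hl⟩ := (isCompact_closedBall (0:G) B).ultrafilter_le_nhds (U.map f) (by
    rw [le_principal_iff]
    exact Filter.mem_map.2 (Filter.univ_mem' fun k => by simpa using h k))
  exact ⟨l, hl⟩

theorem montel [FiniteDimensional ℂ E] (F : ℕ → E → ℂ) (r : ℕ → ℝ) (r0 B : ℝ)
    (hr : Tendsto r atTop (𝓝 r0)) (hB : ∀ k, r k ≤ B)
    (hd : ∀ k, DifferentiableOn ℂ (F k) (ball 0 1))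
    (hb : ∀ k, ∀ x ∈ ball (0:E) 1, ‖F k x‖ ≤ r k) :
    ∃ G : E → ℂ, DifferentiableOn ℂ G (ball 0 1) ∧ (∀ x ∈ ball (0:E) 1, ‖G x‖ ≤ r0) ∧
      ∀ x ∈ ball (0:E) 1, ∀ c, (∀ k, F k x = c) → G x = c := by
  let U : Ultrafilter ℕ := hyperfilter ℕ
  have hU : (U : Filter ℕ) ≤ atTop := by
    rw [← Nat.cofinite_eq_atTop]; exact hyperfilter_le_cofinite
  have hbB : ∀ k, ∀ x ∈ ball (0:E) 1, ‖F k x‖ ≤ B := fun k x hx => (hb k x hx).trans (hB k)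
  have h1 : ∀ x, ∃ l, x ∈ ball (0:E) 1 → Tendsto (fun k => F k x) U (𝓝 l) := by
    intro x
    by_cases hx : x ∈ ball (0:E) 1
    · obtain ⟨l, hl⟩ := ulim U (fun k => F k x) B fun k => hbB k x hx
      exact ⟨l, fun _ => hl⟩
    · exact ⟨0, fun h => absurd h hx⟩
  choose G hG using h1
  refine ⟨G, ?_, ?_, ?_⟩
  · intro c hc
    have hR : 0 < 1 - ‖c‖ := by rw [mem_ball_zero_iff] at hc; linarith
    have : ProperSpace (E →L[ℂ] ℂ) := FiniteDimensional.proper ℂ _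
    obtain ⟨L, hL⟩ := ulim U (fun k => fderiv ℂ (F k) c) _ fun k => fder (hd k) (hbB k) hc
    have key : ∀ y ∈ ball c (1 - ‖c‖),
        ‖G y - G c - L (y - c)‖ ≤ 4 * B * (‖y - c‖ / (1 - ‖c‖)) ^ 2 := by
      intro y hy
      have hL' : Tendsto (fun k => fderiv ℂ (F k) c (y - c)) U (𝓝 (L (y - c))) :=
        ((ContinuousLinearMap.apply ℂ ℂ (y - c)).continuous.tendsto L).comp hL
      have ht := (((hG y (subball hy)).sub (hG c hc)).sub hL').norm
      exact le_of_tendsto ht (Eventually.of_forall fun k => second (hd k) (hbB k) hy)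
    have : HasFDerivAt G L c := by
      rw [hasFDerivAt_iff_isLittleO]
      have hO : (fun y => G y - G c - L (y - c)) =O[𝓝 c] fun y => ‖y - c‖ ^ 2 := by
        refine Asymptotics.IsBigO.of_bound (4 * B / (1 - ‖c‖) ^ 2) ?_
        filter_upwards [ball_mem_nhds c hR] with y hy
        refine (key y hy).trans (le_of_eq ?_)
        simp
        field_simp
      refine hO.trans_isLittleO ?_
      have ht : Tendsto (fun y : E => y - c) (𝓝 c) (𝓝 0) := by
        have : Tendsto (fun y : E => y - c) (𝓝 c) (𝓝 (c - c)) :=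
          (continuous_id.sub continuous_const).tendsto c
        simpa using this
      exact (Asymptotics.isLittleO_norm_pow_id one_lt_two).comp_tendsto ht
    exact this.differentiableAt.differentiableWithinAt
  · intro x hx
    exact le_of_tendsto_of_tendsto (hG x hx).norm (hr.mono_left hU)
      (Eventually.of_forall fun k => hb k x hx)
  · intro x hx c hc
    refine tendsto_nhds_unique (hG x hx) ?_
    simp only [hc]
    exact tendsto_const_nhds

/-- Lagrange functions. -/
theorem lagr (z w : E) (hw1 : ‖w‖ < 1) (hz : z ≠ 0) (hzw : z ≠ w) :
    ∃ L : E → ℂ, Differentiable ℂ L ∧ L 0 = 0 ∧ L w = 0 ∧ L z = 1 ∧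
      ∀ x ∈ ball (0:E) 1, ‖L x‖ ≤ 2 / (‖z‖ * ‖z - w‖) := by
  have h1 : 0 < ‖z‖ := norm_pos_iff.2 hz
  have h2 : 0 < ‖z - w‖ := norm_pos_iff.2 (sub_ne_zero.2 hzw)
  obtain ⟨g, hg, hgz⟩ := exists_dual_vector ℂ z h1.ne'
  obtain ⟨g', hg', hgz'⟩ := exists_dual_vector ℂ (z - w) h2.ne'
  have c1 : (‖z‖ : ℂ) ≠ 0 := by exact_mod_cast h1.ne'
  have c2 : (‖z - w‖ : ℂ) ≠ 0 := by exact_mod_cast h2.ne'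
  refine ⟨fun x => g x * g' (x - w) / (‖z‖ * ‖z - w‖), ?_, ?_, ?_, ?_, ?_⟩
  · fun_prop
  · simp
  · simp
  · have e1 : g z = (‖z‖ : ℂ) := hgz
    have e2 : g' (z - w) = (‖z - w‖ : ℂ) := hgz'
    simp only [e1, e2]
    field_simp
  · intro x hx
    rw [mem_ball_zero_iff] at hx
    have a1 := g.le_of_opNorm_le hg.le x
    have a2 := g'.le_of_opNorm_le hg'.le (x - w)
    have a3 := norm_sub_le x w
    have : ‖g x * g' (x - w) / (‖z‖ * ‖z - w‖ : ℂ)‖ = ‖g x‖ * ‖g' (x - w)‖ / (‖z‖ * ‖z - w‖) := by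
      simp
    rw [this]
    gcongr
    calc ‖g x‖ * ‖g' (x - w)‖ ≤ 1 * 2 := by gcongr <;> linarith
      _ = 2 := by norm_num

theorem perturb {z w z' w' : E} {σ τ σ' τ' : ℂ} {r : ℝ}
    {F : E → ℂ} (hd : DifferentiableOn ℂ F (ball 0 1)) (hb : ∀ x ∈ ball (0:E) 1, ‖F x‖ ≤ r)
    (h0 : F 0 = 0) (hFz : F z = σ) (hFw : F w = τ)
    (hz1 : ‖z'‖ < 1) (hw1 : ‖w'‖ < 1) (hz : z' ≠ 0) (hw : w' ≠ 0) (hzw : z' ≠ w') (e1 e2 : ℝ)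
    (he1 : ‖F z' - F z‖ ≤ e1) (he2 : ‖F w' - F w‖ ≤ e2) :
    Adm z' w' σ' τ' (r + (‖σ' - σ‖ + e1) * (2 / (‖z'‖ * ‖z' - w'‖)) +
      (‖τ' - τ‖ + e2) * (2 / (‖w'‖ * ‖w' - z'‖))) := by
  obtain ⟨L, Ld, L0, Lw, Lz, Lb⟩ := lagr z' w' hw1 hz hzw
  obtain ⟨K, Kd, K0, Kz, Kw, Kb⟩ := lagr w' z' hz1 hw hzw.symm
  refine ⟨fun x => F x + (σ' - F z') * L x + (τ' - F w') * K x, ?_, ?_, ?_, ?_, ?_⟩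
  · exact (hd.add (Ld.differentiableOn.const_mul _)).add (Kd.differentiableOn.const_mul _)
  · intro x hx
    have b1 : ‖σ' - F z'‖ ≤ ‖σ' - σ‖ + e1 := by
      have : σ' - F z' = (σ' - σ) - (F z' - F z) := by rw [hFz]; ring
      rw [this]; exact (norm_sub_le _ _).trans (by linarith)
    have b2 : ‖τ' - F w'‖ ≤ ‖τ' - τ‖ + e2 := by
      have : τ' - F w' = (τ' - τ) - (F w' - F w) := by rw [hFw]; ring
      rw [this]; exact (norm_sub_le _ _).trans (by linarith)
    refine (norm_add₃_le).trans ?_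
    rw [norm_mul, norm_mul]
    have := (norm_nonneg _).trans b1
    have := (norm_nonneg _).trans b2
    gcongr
    · exact hb x hx
    · exact Lb x hx
    · exact Kb x hx
  · simp [h0, L0, K0]
  · simp [Lz, Kz]
  · simp [Lw, Kw]

/-- The least admissible bound. -/
def M (z w : E) (σ τ : ℂ) : ℝ := sInf {r | Adm z w σ τ r}

theorem adm_lb {z w : E} {σ τ : ℂ} {r : ℝ} (h : Adm z w σ τ r) : 0 ≤ r := by
  obtain ⟨F, -, hb, -⟩ := h
  exact (norm_nonneg _).trans (hb 0 (by simp))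

theorem isLeast_M [FiniteDimensional ℂ E] {z w : E} (hz1 : ‖z‖ < 1) (hw1 : ‖w‖ < 1)
    (hz : z ≠ 0) (hw : w ≠ 0) (hzw : z ≠ w) (σ τ : ℂ) :
    IsLeast {r | Adm z w σ τ r} (M z w σ τ) := by
  have hbdd : BddBelow {r | Adm z w σ τ r} := ⟨0, fun r h => adm_lb h⟩
  have hne : {r | Adm z w σ τ r}.Nonempty :=
    ⟨_, perturb (F := fun _ => 0) (σ := 0) (τ := 0) (r := 0) (z := 0) (w := 0)
      (differentiableOn_const 0) (by simp) rfl rfl rfl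
      hz1 hw1 hz hw hzw 0 0 (by simp) (by simp)⟩
  refine ⟨?_, fun r h => csInf_le hbdd h⟩
  have : ∀ k : ℕ, ∃ r, Adm z w σ τ r ∧ r < M z w σ τ + 1 / ((k:ℝ) + 1) := fun k =>
    exists_lt_of_csInf_lt hne (lt_add_of_pos_right _ (by positivity))
  choose r hr hlt using this
  choose F hd hb h0 hFz hFw using hr
  have hone : ∀ k : ℕ, 1 / ((k:ℝ) + 1) ≤ 1 := fun k => by
    rw [div_le_one (by positivity)]; linarith [(Nat.cast_nonneg k : (0:ℝ) ≤ k)]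
  have ht : Tendsto (fun k : ℕ => M z w σ τ + 1 / ((k:ℝ) + 1)) atTop (𝓝 (M z w σ τ)) := by
    simpa using (tendsto_one_div_add_atTop_nhds_zero_nat (𝕜 := ℝ)).const_add (M z w σ τ)
  obtain ⟨G, Gd, Gb, Gc⟩ := montel F (fun k : ℕ => M z w σ τ + 1 / ((k:ℝ) + 1)) (M z w σ τ)
    (M z w σ τ + 1) ht (fun k => by simpa using hone k) hd
    (fun k x hx => (hb k x hx).trans (hlt k).le)
  exact ⟨G, Gd, Gb, Gc 0 (by simp) 0 h0, Gc z (by simpa using hz1) _ hFz,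
    Gc w (by simpa using hw1) _ hFw⟩

theorem M_pos [FiniteDimensional ℂ E] {z w : E} (hz1 : ‖z‖ < 1) (hw1 : ‖w‖ < 1)
    (hz : z ≠ 0) (hw : w ≠ 0) (hzw : z ≠ w) {σ τ : ℂ} (h : (σ, τ) ≠ (0, 0)) :
    0 < M z w σ τ := by
  obtain ⟨F, -, hb, -, hFz, hFw⟩ := (isLeast_M hz1 hw1 hz hw hzw σ τ).1
  have h1 := hb z (by simpa using hz1)
  have h2 := hb w (by simpa using hw1)
  rw [hFz] at h1
  rw [hFw] at h2
  by_contra hM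
  push Not at hM
  have e1 : σ = 0 := norm_le_zero_iff.1 (h1.trans hM)
  have e2 : τ = 0 := norm_le_zero_iff.1 (h2.trans hM)
  exact h (by rw [e1, e2])

theorem M_lip [FiniteDimensional ℂ E] {z w z' w' : E} {σ τ σ' τ' : ℂ}
    (hz1 : ‖z‖ < 1) (hw1 : ‖w‖ < 1) (hz : z ≠ 0) (hw : w ≠ 0) (hzw : z ≠ w)
    (hz1' : ‖z'‖ < 1) (hw1' : ‖w'‖ < 1) (hz' : z' ≠ 0) (hw' : w' ≠ 0) (hzw' : z' ≠ w')
    (hzz : z' ∈ ball z (1 - ‖z‖)) (hww : w' ∈ ball w (1 - ‖w‖)) :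
    M z' w' σ' τ' ≤ M z w σ τ +
      (‖σ' - σ‖ + 2 * M z w σ τ / (1 - ‖z‖) * ‖z' - z‖) * (2 / (‖z'‖ * ‖z' - w'‖)) +
      (‖τ' - τ‖ + 2 * M z w σ τ / (1 - ‖w‖) * ‖w' - w‖) * (2 / (‖w'‖ * ‖w' - z'‖)) ∧
    M z w σ τ ≤ M z' w' σ' τ' +
      (‖σ' - σ‖ + 2 * M z' w' σ' τ' / (1 - ‖z‖) * ‖z' - z‖) * (2 / (‖z‖ * ‖z - w‖)) +
      (‖τ' - τ‖ + 2 * M z' w' σ' τ' / (1 - ‖w‖) * ‖w' - w‖) * (2 / (‖w‖ * ‖w - z‖)) := by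
  have l1 := isLeast_M hz1 hw1 hz hw hzw σ τ
  have l2 := isLeast_M hz1' hw1' hz' hw' hzw' σ' τ'
  constructor
  · obtain ⟨F, hd, hb, h0, hFz, hFw⟩ := l1.1
    exact l2.2 (perturb hd hb h0 hFz hFw hz1' hw1' hz' hw' hzw' _ _
      (lip hd hb hzz) (lip hd hb hww))
  · obtain ⟨F, hd, hb, h0, hFz, hFw⟩ := l2.1
    have := l1.2 (perturb (σ' := σ) (τ' := τ) hd hb h0 hFz hFw hz1 hw1 hz hw hzw _ _
      ((norm_sub_rev _ _).trans_le (lip hd hb hzz)) ((norm_sub_rev _ _).trans_le (lip hd hb hww)))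
    rwa [norm_sub_rev σ, norm_sub_rev τ] at this

/-- The set of nodes. -/
def DD (E : Type*) [NormedAddCommGroup E] : Set ((E × E) × (ℂ × ℂ)) :=
  {p | ‖p.1.1‖ < 1 ∧ ‖p.1.2‖ < 1 ∧ p.1.1 ≠ 0 ∧ p.1.2 ≠ 0 ∧ p.1.1 ≠ p.1.2}

theorem M_cont [FiniteDimensional ℂ E] :
    ContinuousOn (fun p : (E × E) × (ℂ × ℂ) => M p.1.1 p.1.2 p.2.1 p.2.2) (DD E) := by
  rintro ⟨⟨z, w⟩, ⟨σ, τ⟩⟩ ⟨hz1, hw1, hz, hw, hzw⟩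
  simp only at hz1 hw1 hz hw hzw
  set M0 := M z w σ τ with hM0
  let U : (E × E) × (ℂ × ℂ) → ℝ := fun p => M0 +
      (‖p.2.1 - σ‖ + 2 * M0 / (1 - ‖z‖) * ‖p.1.1 - z‖) * (2 / (‖p.1.1‖ * ‖p.1.1 - p.1.2‖)) +
      (‖p.2.2 - τ‖ + 2 * M0 / (1 - ‖w‖) * ‖p.1.2 - w‖) * (2 / (‖p.1.2‖ * ‖p.1.2 - p.1.1‖))
  let V : (E × E) × (ℂ × ℂ) → ℝ := fun p => M0 -
      (‖p.2.1 - σ‖ + 2 * U p / (1 - ‖z‖) * ‖p.1.1 - z‖) * (2 / (‖z‖ * ‖z - w‖)) -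
      (‖p.2.2 - τ‖ + 2 * U p / (1 - ‖w‖) * ‖p.1.2 - w‖) * (2 / (‖w‖ * ‖w - z‖))
  have p1 : ‖z‖ * ‖z - w‖ ≠ 0 :=
    mul_ne_zero (norm_ne_zero_iff.2 hz) (norm_ne_zero_iff.2 (sub_ne_zero.2 hzw))
  have p2 : ‖w‖ * ‖w - z‖ ≠ 0 :=
    mul_ne_zero (norm_ne_zero_iff.2 hw) (norm_ne_zero_iff.2 (sub_ne_zero.2 hzw.symm))
  have cU : ContinuousAt U ((z, w), (σ, τ)) := by
    refine ContinuousAt.add (ContinuousAt.add continuousAt_const (ContinuousAt.mul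
      (Continuous.continuousAt (by fun_prop)) (ContinuousAt.div continuousAt_const
      (Continuous.continuousAt (by fun_prop)) p1))) (ContinuousAt.mul
      (Continuous.continuousAt (by fun_prop)) (ContinuousAt.div continuousAt_const
      (Continuous.continuousAt (by fun_prop)) p2))
  have cV : ContinuousAt V ((z, w), (σ, τ)) := by
    refine ContinuousAt.sub (ContinuousAt.sub continuousAt_const ?_) ?_ <;> fun_prop
  have U0 : U ((z, w), (σ, τ)) = M0 := by simp [U]
  have V0 : V ((z, w), (σ, τ)) = M0 := by simp [V]
  have tU : Tendsto U (𝓝[DD E] ((z, w), (σ, τ))) (𝓝 M0) := by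
    have := cU.tendsto.mono_left (nhdsWithin_le_nhds (s := DD E)); rwa [U0] at this
  have tV : Tendsto V (𝓝[DD E] ((z, w), (σ, τ))) (𝓝 M0) := by
    have := cV.tendsto.mono_left (nhdsWithin_le_nhds (s := DD E)); rwa [V0] at this
  have ev : ∀ᶠ p in 𝓝[DD E] ((z, w), (σ, τ)), M p.1.1 p.1.2 p.2.1 p.2.2 ≤ U p ∧
      V p ≤ M p.1.1 p.1.2 p.2.1 p.2.2 := by
    have n1 : ∀ᶠ p : (E × E) × (ℂ × ℂ) in 𝓝[DD E] ((z, w), (σ, τ)),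
        p.1.1 ∈ ball z (1 - ‖z‖) := by
      refine nhdsWithin_le_nhds (ContinuousAt.preimage_mem_nhds
        (f := fun p : (E × E) × (ℂ × ℂ) => p.1.1) (by fun_prop) (ball_mem_nhds _ (by linarith)))
    have n2 : ∀ᶠ p : (E × E) × (ℂ × ℂ) in 𝓝[DD E] ((z, w), (σ, τ)),
        p.1.2 ∈ ball w (1 - ‖w‖) := by
      refine nhdsWithin_le_nhds (ContinuousAt.preimage_mem_nhds
        (f := fun p : (E × E) × (ℂ × ℂ) => p.1.2) (by fun_prop) (ball_mem_nhds _ (by linarith)))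
    filter_upwards [n1, n2, self_mem_nhdsWithin] with p h1 h2 hp
    obtain ⟨a, b, c, d, e⟩ := hp
    obtain ⟨hU, hV⟩ := M_lip (σ := σ) (τ := τ) (σ' := p.2.1) (τ' := p.2.2)
      hz1 hw1 hz hw hzw a b c d e h1 h2
    refine ⟨hU, ?_⟩
    have hU' : M p.1.1 p.1.2 p.2.1 p.2.2 ≤ U p := hU
    have q1 : 0 < 1 - ‖z‖ := by linarith
    have q2 : 0 < 1 - ‖w‖ := by linarith
    have m1 : (‖p.2.1 - σ‖ + 2 * M p.1.1 p.1.2 p.2.1 p.2.2 / (1 - ‖z‖) * ‖p.1.1 - z‖)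
        * (2 / (‖z‖ * ‖z - w‖)) ≤
        (‖p.2.1 - σ‖ + 2 * U p / (1 - ‖z‖) * ‖p.1.1 - z‖) * (2 / (‖z‖ * ‖z - w‖)) := by
      gcongr
    have m2 : (‖p.2.2 - τ‖ + 2 * M p.1.1 p.1.2 p.2.1 p.2.2 / (1 - ‖w‖) * ‖p.1.2 - w‖)
        * (2 / (‖w‖ * ‖w - z‖)) ≤
        (‖p.2.2 - τ‖ + 2 * U p / (1 - ‖w‖) * ‖p.1.2 - w‖) * (2 / (‖w‖ * ‖w - z‖)) := by
      gcongr
    simp only [V]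
    linarith
  exact tendsto_of_tendsto_of_tendsto_of_le_of_le' tV tU
    (ev.mono fun _ h => h.2) (ev.mono fun _ h => h.1)

theorem poly_eq (n : ℕ) : uPolydisc n = ball (0 : Fin n → ℂ) 1 := by
  ext x
  simp [uPolydisc, pi_norm_lt_iff]

theorem adm_scale {z w : E} {σ τ : ℂ} {r t : ℝ} (ht : 0 < t) :
    Adm z w (t * σ) (t * τ) r ↔ Adm z w σ τ (r / t) := by
  have tc : (t : ℂ) ≠ 0 := by exact_mod_cast ht.ne'
  constructor
  · rintro ⟨F, hd, hb, h0, hz, hw⟩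
    refine ⟨fun x => (t:ℂ)⁻¹ * F x, hd.const_mul _, fun x hx => ?_, by simp [h0],
      by simp [hz, tc], by simp [hw, tc]⟩
    rw [norm_mul, norm_inv, Complex.norm_of_nonneg ht.le, inv_mul_eq_div]
    gcongr
    exact hb x hx
  · rintro ⟨F, hd, hb, h0, hz, hw⟩
    refine ⟨fun x => (t:ℂ) * F x, hd.const_mul _, fun x hx => ?_, by simp [h0],
      by simp [hz], by simp [hw]⟩
    rw [norm_mul, Complex.norm_of_nonneg ht.le]
    have := hb x hx
    rw [le_div_iff₀ ht] at this
    linarith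

theorem extremal_iff {n : ℕ} {z w : Fin n → ℂ} {σ τ : ℂ} {t : ℝ} (ht : 0 < t) :
    ExtremalPick n 3 ![(0 : Fin n → ℂ), z, w] ![(0:ℂ), (t:ℂ) * σ, (t:ℂ) * τ] ↔
      IsLeast {r | Adm z w σ τ r} (1 / t) := by
  have e1 : (∃ F, Interpolates n 3 ![(0 : Fin n → ℂ), z, w] ![(0:ℂ), (t:ℂ) * σ, (t:ℂ) * τ] F) ↔
      Adm z w (t * σ) (t * τ) 1 := by
    simp [Interpolates, Adm, poly_eq, Fin.forall_fin_succ]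
  have e2 : (∃ F : (Fin n → ℂ) → ℂ, DifferentiableOn ℂ F (uPolydisc n) ∧
      (∃ r : ℝ, r < 1 ∧ ∀ x ∈ uPolydisc n, ‖F x‖ ≤ r) ∧
      ∀ j, F (![(0 : Fin n → ℂ), z, w] j) = ![(0:ℂ), (t:ℂ) * σ, (t:ℂ) * τ] j) ↔
      ∃ r < 1, Adm z w (t * σ) (t * τ) r := by
    constructor
    · rintro ⟨F, hd, ⟨r, hr, hb⟩, hj⟩
      rw [poly_eq] at hd hb
      exact ⟨r, hr, F, hd, hb, hj 0, hj 1, hj 2⟩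
    · rintro ⟨r, hr, F, hd, hb, h0, h1, h2⟩
      rw [← poly_eq] at hd hb
      exact ⟨F, hd, ⟨r, hr, hb⟩, by simp [Fin.forall_fin_succ, h0, h1, h2]⟩
  rw [ExtremalPick, e1, e2, adm_scale ht]
  refine and_congr Iff.rfl ?_
  constructor
  · intro h r hr
    by_contra hlt
    push Not at hlt
    refine h ⟨r * t, ?_, ?_⟩
    · rwa [lt_div_iff₀ ht] at hlt
    · rw [adm_scale ht, mul_div_cancel_right₀ _ ht.ne']
      exact hr
  · rintro h ⟨r, hr, hA⟩
    rw [adm_scale ht] at hA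
    have := h hA
    rw [div_le_div_iff_of_pos_right ht] at this
    linarith

theorem adm_one_lt {z w : E} {σ τ : ℂ} (h : Adm z w σ τ 1) (hz1 : ‖z‖ < 1) (hw1 : ‖w‖ < 1) :
    ‖σ‖ < 1 ∧ ‖τ‖ < 1 := by
  obtain ⟨F, hd, hb, h0, hz, hw⟩ := h
  have hm : MapsTo F (ball 0 1) (closedBall 0 1) := fun x hx => by simpa using hb x hx
  rw [← hz, ← hw]
  exact ⟨(Complex.norm_le_norm_of_mapsTo_ball hd hm h0 hz1).trans_lt hz1,
    (Complex.norm_le_norm_of_mapsTo_ball hd hm h0 hw1).trans_lt hw1⟩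

end S19

/-- for every admissible `(z, w)` and `(σ, τ) ≠ (0,0)` there is exactly
one `t > 0` such that the problem `0 ↦ 0, z ↦ tσ, w ↦ tτ` is extremal, and the
resulting function `(z, w, (σ, τ)) ↦ t` is continuous on `𝒟ₙ × (ℂ² ∖ {0})`. -/
theorem statement_19 (n : ℕ) (hn : 1 ≤ n) :
    (∀ z w : Fin n → ℂ, z ∈ uPolydisc n → w ∈ uPolydisc n →
      z ≠ 0 → w ≠ 0 → z ≠ w → ∀ σ τ : ℂ, (σ, τ) ≠ (0, 0) →
      ∃! t : ℝ, 0 < t ∧ ‖(t:ℂ) * σ‖ < 1 ∧ ‖(t:ℂ) * τ‖ < 1 ∧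
        ExtremalPick n 3 ![(0 : Fin n → ℂ), z, w] ![(0:ℂ), (t:ℂ) * σ, (t:ℂ) * τ]) ∧
    ∀ T : ((Fin n → ℂ) × (Fin n → ℂ)) × (ℂ × ℂ) → ℝ,
      (∀ p ∈ Dset n ×ˢ {q : ℂ × ℂ | q ≠ 0}, 0 < T p ∧
        ‖(T p : ℂ) * p.2.1‖ < 1 ∧ ‖(T p : ℂ) * p.2.2‖ < 1 ∧
        ExtremalPick n 3 ![(0 : Fin n → ℂ), p.1.1, p.1.2]
          ![(0:ℂ), (T p : ℂ) * p.2.1, (T p : ℂ) * p.2.2]) →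
      ContinuousOn T (Dset n ×ˢ {q : ℂ × ℂ | q ≠ 0}) := by
  constructor
  · intro z w hz1 hw1 hz hw hzw σ τ h
    rw [S19.poly_eq, Metric.mem_ball, dist_zero_right] at hz1 hw1
    have hl := S19.isLeast_M hz1 hw1 hz hw hzw σ τ
    have hp := S19.M_pos hz1 hw1 hz hw hzw h
    have ht : 0 < 1 / S19.M z w σ τ := by positivity
    have hl' : IsLeast {r | S19.Adm z w σ τ r} (1 / (1 / S19.M z w σ τ)) := by
      rwa [one_div_one_div]
    have hs := S19.adm_one_lt ((S19.adm_scale ht).2 hl'.1) hz1 hw1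
    refine ⟨1 / S19.M z w σ τ, ⟨ht, hs.1, hs.2, (S19.extremal_iff ht).2 hl'⟩, ?_⟩
    rintro t ⟨htp, -, -, hE⟩
    have := ((S19.extremal_iff htp).1 hE).unique hl
    rw [← this, one_div_one_div]
  · intro T hT
    have hsub : ∀ p ∈ Dset n ×ˢ {q : ℂ × ℂ | q ≠ 0}, p ∈ S19.DD (Fin n → ℂ) := by
      rintro p ⟨⟨h1, h2, h3, h4, h5⟩, -⟩
      rw [S19.poly_eq, Metric.mem_ball, dist_zero_right] at h1 h2
      exact ⟨h1, h2, h4, h5, h3⟩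
    have hc : ContinuousOn (fun p : ((Fin n → ℂ) × (Fin n → ℂ)) × (ℂ × ℂ) =>
        1 / S19.M p.1.1 p.1.2 p.2.1 p.2.2) (Dset n ×ˢ {q : ℂ × ℂ | q ≠ 0}) := by
      refine continuousOn_const.div (S19.M_cont.mono hsub) ?_
      intro p hp
      obtain ⟨a, b, c, d, e⟩ := hsub p hp
      exact (S19.M_pos a b c d e hp.2).ne'
    refine hc.congr ?_
    intro p hp
    obtain ⟨a, b, c, d, e⟩ := hsub p hp
    obtain ⟨htp, -, -, hE⟩ := hT p hp
    have := ((S19.extremal_iff htp).1 hE).unique (S19.isLeast_M a b c d e p.2.1 p.2.2)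
    simp only
    rw [← this, one_div_one_div]
end
end
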